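/- arXiv:2510.24621 — 7 statements merged into one kernel-verified Lean document; each statement's English description precedes it below -/
import Mathlib

section
/- For every real z ≥ 1 there is a constant C_z > 0 with the following property. Let n, m, k, d ≥ 1 be integers, let ε ∈ (0,1), and let P be a set of n points in Euclidean space ℝ^d. Suppose there exists a center set C* = {c_1^*,…,c_k^*} ⊂ ℝ^d of k points minimizing cost_z^(m)(P,·) over all k-point center sets, such that for an m-subset L^* ⊆ P attaining cost_z^(m)(P,C*) with inlier set P_I^* := P ∖ L^* and inlier clusters P_1^*,…,P_k^* (each P_i^* consists of the points of P_I^* whose nearest center is c_i^*, ties broken by a fixed rule): (i) min_{1≤i≤k} |P_i^*| ≥ 4m, and (ii) max_{p∈P_I^*} dist(p,C*)^z ≤ 4k·(Σ_{p∈P_I^*} dist(p,C*)^z)/(n − m). Then P admits an ε-coreset for robust (k,z)-clustering with m outliers of size at most C_z·k²·ε^{−2z}·min{ε^{−2}, d}·(1 + log(k/ε))^{C_z}. -/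
open Finset
open scoped Classical

/-- Distance from a point `p` to a finite center set `C ⊂ ℝ^d`:
`dist(p, C) = min_{c ∈ C} ‖p - c‖` (realized as the infimum distance to `C`). -/
noncomputable def distC {d : ℕ} (p : EuclideanSpace ℝ (Fin d))
    (C : Finset (EuclideanSpace ℝ (Fin d))) : ℝ :=
  Metric.infDist p (C : Set (EuclideanSpace ℝ (Fin d)))

/-- Robust `(k,z)`-clustering cost with `m` outliers: the minimum over subsets
`L ⊆ P` with `|L| = m` of `∑_{p ∈ P \ L} dist(p, C)^z`. -/
noncomputable def rcostZ {d : ℕ} (z : ℝ) (m : ℕ) (P : Finset (EuclideanSpace ℝ (Fin d)))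
    (C : Finset (EuclideanSpace ℝ (Fin d))) : ℝ :=
  sInf {y : ℝ | ∃ L : Finset (EuclideanSpace ℝ (Fin d)),
    L ⊆ P ∧ L.card = m ∧ y = ∑ p ∈ P \ L, distC p C ^ z}

/-- Weighted robust `(k,z)`-clustering cost of a weighted set `(S, w)`:
the minimum of `∑ w'(p) · dist(p, C)^z` over `0 ≤ w' ≤ w` of total weight `t`. -/
noncomputable def wrcostZ {d : ℕ} (z : ℝ) (t : ℝ) (S : Finset (EuclideanSpace ℝ (Fin d)))
    (w : EuclideanSpace ℝ (Fin d) → ℝ) (C : Finset (EuclideanSpace ℝ (Fin d))) : ℝ :=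
  sInf {y : ℝ | ∃ w' : EuclideanSpace ℝ (Fin d) → ℝ,
    (∀ p ∈ S, 0 ≤ w' p ∧ w' p ≤ w p) ∧
    (∑ p ∈ S, w' p) = t ∧ y = ∑ p ∈ S, w' p * distC p C ^ z}

/-- If every superlevel set of `v` has `δ`-mass at most `b`, then `∑ δ v ≤ b V` when `v ≤ V`. -/
theorem sum_mul_le_of_superlevel {α : Type*} (A : Finset α) (δ v : α → ℝ) (b V : ℝ)
    (hV : 0 ≤ V) (hv : ∀ p ∈ A, 0 ≤ v p ∧ v p ≤ V)
    (h : ∀ u, 0 ≤ u → u < V → ∑ p ∈ A with u < v p, δ p ≤ b) :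
    ∑ p ∈ A, δ p * v p ≤ b * V := by
  have hind : ∀ p ∈ A, ∫ u in (0:ℝ)..V, (if u < v p then δ p else 0) = δ p * v p := by
    intro p hp
    obtain ⟨h0, h1⟩ := hv p hp
    rw [intervalIntegral.integral_of_le hV]
    have : (fun u : ℝ => if u < v p then δ p else 0) = (Set.Iio (v p)).indicator fun _ => δ p := by
      ext u; simp [Set.indicator]
    rw [this, MeasureTheory.integral_indicator measurableSet_Iio,
      MeasureTheory.Measure.restrict_restrict measurableSet_Iio]
    have h2 : Set.Iio (v p) ∩ Set.Ioc 0 V = Set.Ioo 0 (v p) := by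
      ext u
      simp only [Set.mem_inter_iff, Set.mem_Iio, Set.mem_Ioc, Set.mem_Ioo]
      constructor
      · rintro ⟨a, b, c⟩; exact ⟨b, a⟩
      · rintro ⟨a, b⟩; exact ⟨b, a, by linarith⟩
    rw [h2]
    simp [h0, mul_comm]
  have hintv : ∀ p ∈ A, IntervalIntegrable (fun u : ℝ => if u < v p then δ p else 0)
      MeasureTheory.volume 0 V := by
    intro p _
    have : (fun u : ℝ => if u < v p then δ p else 0) = (Set.Iio (v p)).indicator fun _ => δ p := by
      ext u; simp [Set.indicator]
    rw [this, intervalIntegrable_iff]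
    exact MeasureTheory.IntegrableOn.indicator (MeasureTheory.integrableOn_const (by simp)) measurableSet_Iio
  rw [← Finset.sum_congr rfl hind, ← intervalIntegral.integral_finsetSum hintv]
  have : b * V = ∫ _ in (0:ℝ)..V, b := by simp [mul_comm]
  rw [this]
  refine intervalIntegral.integral_mono_on_of_le_Ioo hV ?_ (by simp) ?_
  · have := IntervalIntegrable.sum A hintv
    rwa [Finset.sum_fn] at this
  · intro u hu
    have := h u hu.1.le hu.2
    rwa [Finset.sum_filter] at this

theorem exp_le_one_add_add_sq {x : ℝ} (hx : x ≤ 1) : Real.exp x ≤ 1 + x + x ^ 2 := by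
  rcases le_or_gt (-1) x with h | h
  · have := Real.abs_exp_sub_one_sub_id_le (abs_le.2 ⟨h, hx⟩)
    have := (abs_le.1 this).2
    linarith
  · have h1 : Real.exp x ≤ 1 := Real.exp_le_one_iff.2 (by linarith)
    nlinarith

/-- Exponential moment of the signed change when a pair of weights `a, b` is merged at random. -/
theorem two_point_mgf_le_one {a b x : ℝ} (ha : 0 < a) (hb : 0 < b) (hx : |x| * (a + b) ≤ 1)
    {v : ℝ} (hv : a * b * x ^ 2 ≤ v) :
    a / (a + b) * Real.exp (b * x - v) + b / (a + b) * Real.exp (-(a * x) - v) ≤ 1 := by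
  have hab : 0 < a + b := by positivity
  have hx1 := le_abs_self x
  have hx2 := neg_abs_le x
  have h1 : Real.exp (b * x) ≤ 1 + b * x + (b * x) ^ 2 := by
    apply exp_le_one_add_add_sq
    nlinarith [abs_nonneg x]
  have h2 : Real.exp (-(a * x)) ≤ 1 + -(a * x) + (-(a * x)) ^ 2 := by
    apply exp_le_one_add_add_sq
    nlinarith [abs_nonneg x]
  have h3 : a / (a + b) * Real.exp (b * x) + b / (a + b) * Real.exp (-(a * x))
      ≤ 1 + a * b * x ^ 2 := by
    calc _ ≤ a / (a + b) * (1 + b * x + (b * x) ^ 2)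
          + b / (a + b) * (1 + -(a * x) + (-(a * x)) ^ 2) := by gcongr
      _ = 1 + a * b * x ^ 2 := by field_simp; ring
  rw [Real.exp_sub, Real.exp_sub]
  have h4 : 1 + a * b * x ^ 2 ≤ Real.exp v := by
    have := Real.add_one_le_exp v; linarith
  have hev := Real.exp_pos v
  have : a / (a + b) * (Real.exp (b * x) / Real.exp v)
      + b / (a + b) * (Real.exp (-(a * x)) / Real.exp v)
      = (a / (a + b) * Real.exp (b * x) + b / (a + b) * Real.exp (-(a * x))) / Real.exp v := by
    ring
  rw [this, div_le_one hev]
  linarith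

theorem exists_le_of_weighted_avg {a b x y M : ℝ} (ha : 0 < a) (hb : 0 < b)
    (h : a / (a + b) * x + b / (a + b) * y ≤ M) : x ≤ M ∨ y ≤ M := by
  by_contra! hc
  obtain ⟨h1, h2⟩ := hc
  have hab : 0 < a + b := by positivity
  have e : M = a / (a + b) * M + b / (a + b) * M := by field_simp
  have l1 : a / (a + b) * M < a / (a + b) * x := by gcongr
  have l2 : b / (a + b) * M < b / (a + b) * y := by gcongr
  linarith

/-- Merging equally labelled points in pairs: the weights per label are preserved, the number of
points per label is roughly halved, and the exponential potential of the weight changes of a finite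
family of test sets stays bounded. -/
theorem exists_pair_merging {α ι : Type*} (γ : α → ι) (cap : ι → ℝ) (w : α → ℝ)
    (J : Finset (Finset α × ℝ)) (A : Finset α)
    (hw : ∀ p ∈ A, 0 < w p ∧ w p ≤ cap (γ p))
    (hJ : ∀ j ∈ J, ∀ p ∈ A, p ∈ j.1 → |j.2| * (2 * cap (γ p)) ≤ 1) :
    ∃ w' : α → ℝ,
      (∀ p ∈ A, 0 ≤ w' p ∧ w' p ≤ 2 * cap (γ p)) ∧
      (∀ ψ : ι → ℝ, ∑ p ∈ A, w' p * ψ (γ p) = ∑ p ∈ A, w p * ψ (γ p)) ∧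
      (∀ i, 2 * (A.filter fun p => γ p = i ∧ 0 < w' p).card ≤
        (A.filter fun p => γ p = i).card + 1) ∧
      ∑ j ∈ J, Real.exp (j.2 * ∑ p ∈ A with p ∈ j.1, (w' p - w p)
        - j.2 ^ 2 * ∑ p ∈ A with p ∈ j.1, cap (γ p) * w p) ≤ J.card := by
  induction A using Finset.strongInduction with
  | H A ih =>
  by_cases hex : ∃ p ∈ A, ∃ q ∈ A, p ≠ q ∧ γ p = γ q
  · obtain ⟨p, hp, q, hq, hpq, hγ⟩ := hex
    obtain ⟨hwp, hcp⟩ := hw p hp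
    obtain ⟨hwq, hcq⟩ := hw q hq
    rw [← hγ] at hcq
    set B := (A.erase p).erase q with hB
    have hqB : q ∉ B := by simp [hB]
    have hpB : p ∉ insert q B := by simp [hB, hpq]
    have hA : A = insert p (insert q B) := by
      rw [hB, Finset.insert_erase (by simp [hq, hpq.symm]), Finset.insert_erase hp]
    have hBA : B ⊂ A := by
      refine lt_of_le_of_ne (α := Finset α) ?_ ?_
      · rw [hA]; intro x hx; simp [hx]
      · intro h; rw [h] at hqB; exact hqB hq
    obtain ⟨w0, h1, h2, h3, h4⟩ := ih B hBA (fun r hr => hw r (hBA.1 hr))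
      (fun j hj r hr => hJ j hj r (hBA.1 hr))
    -- the update giving weight `s` to `p` and `t` to `q`
    have key : ∀ s t : ℝ, 0 ≤ s → 0 ≤ t → s + t = w p + w q → (s = 0 ∨ t = 0) →
        ∑ j ∈ J, Real.exp (j.2 * ∑ p ∈ B with p ∈ j.1, (w0 p - w p)
          - j.2 ^ 2 * ∑ p ∈ B with p ∈ j.1, cap (γ p) * w p) *
          Real.exp (j.2 * ((if p ∈ j.1 then s - w p else 0) + (if q ∈ j.1 then t - w q else 0))
            - j.2 ^ 2 * ((if p ∈ j.1 then cap (γ p) * w p else 0) +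
              (if q ∈ j.1 then cap (γ p) * w q else 0))) ≤ J.card →
        ∃ w' : α → ℝ,
          (∀ p ∈ A, 0 ≤ w' p ∧ w' p ≤ 2 * cap (γ p)) ∧
          (∀ ψ : ι → ℝ, ∑ p ∈ A, w' p * ψ (γ p) = ∑ p ∈ A, w p * ψ (γ p)) ∧
          (∀ i, 2 * (A.filter fun p => γ p = i ∧ 0 < w' p).card ≤
            (A.filter fun p => γ p = i).card + 1) ∧
          ∑ j ∈ J, Real.exp (j.2 * ∑ p ∈ A with p ∈ j.1, (w' p - w p)
            - j.2 ^ 2 * ∑ p ∈ A with p ∈ j.1, cap (γ p) * w p) ≤ J.card := by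
      intro s t hs ht hst hst0 hpot
      set w' := Function.update (Function.update w0 p s) q t with hw'
      have e1 : w' p = s := by simp [hw', hpq]
      have e2 : w' q = t := by simp [hw']
      have e3 : ∀ r ∈ B, w' r = w0 r := by
        intro r hr
        have hr1 : r ≠ q := fun h => hqB (h ▸ hr)
        have hr2 : r ≠ p := fun h => hpB (h ▸ Finset.mem_insert_of_mem hr)
        simp [hw', hr1, hr2]
      refine ⟨w', ?_, ?_, ?_, ?_⟩
      · intro r hr
        rw [hA, Finset.mem_insert, Finset.mem_insert] at hr
        rcases hr with rfl | rfl | hr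
        · rw [e1]; constructor <;> linarith
        · rw [e2, ← hγ]; constructor <;> linarith
        · rw [e3 r hr]; exact h1 r hr
      · intro ψ
        rw [hA, Finset.sum_insert hpB, Finset.sum_insert hpB, Finset.sum_insert hqB,
          Finset.sum_insert hqB, ← h2 ψ, e1, e2, ← hγ,
          Finset.sum_congr rfl fun r hr => by rw [e3 r hr]]
        linear_combination ψ (γ p) * hst
      · intro i
        have hf : B.filter (fun r => γ r = i ∧ 0 < w' r)
            = B.filter (fun r => γ r = i ∧ 0 < w0 r) := by
          apply Finset.filter_congr
          intro r hr; rw [e3 r hr]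
        have h3i := h3 i
        rw [hA, Finset.filter_insert, Finset.filter_insert, Finset.filter_insert,
          Finset.filter_insert, hf, e1, e2, ← hγ]
        by_cases hi : γ p = i
        · have c2 : (insert p (insert q (B.filter fun r => γ r = i))).card
              = (B.filter fun r => γ r = i).card + 2 := by
            rw [Finset.card_insert_of_notMem, Finset.card_insert_of_notMem]
            · intro h; exact hqB (Finset.mem_filter.1 h).1
            · intro h
              apply hpB
              rw [Finset.mem_insert] at h ⊢
              exact h.imp id fun h => (Finset.mem_filter.1 h).1
          simp only [hi, true_and, if_true]
          rw [c2]
          rcases hst0 with h0 | h0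
          · rw [h0, if_neg (lt_irrefl _)]
            split_ifs
            · have := Finset.card_insert_le q (B.filter fun r => γ r = i ∧ 0 < w0 r)
              omega
            · omega
          · rw [h0, if_neg (lt_irrefl (0:ℝ))]
            split_ifs
            · have := Finset.card_insert_le p (B.filter fun r => γ r = i ∧ 0 < w0 r)
              omega
            · omega
        · simpa [hi] using h3i
      · refine le_trans (le_of_eq (Finset.sum_congr rfl fun j _ => ?_)) hpot
        rw [← Real.exp_add]
        congr 1
        simp only [Finset.sum_filter]
        rw [hA, Finset.sum_insert hpB, Finset.sum_insert hpB, Finset.sum_insert hqB,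
          Finset.sum_insert hqB, e1, e2, ← hγ,
          Finset.sum_congr rfl fun r hr => by rw [e3 r hr]]
        ring
    have avg : w p / (w p + w q) * (∑ j ∈ J, Real.exp (j.2 * ∑ p ∈ B with p ∈ j.1, (w0 p - w p)
          - j.2 ^ 2 * ∑ p ∈ B with p ∈ j.1, cap (γ p) * w p) *
          Real.exp (j.2 * ((if p ∈ j.1 then (w p + w q) - w p else 0)
              + (if q ∈ j.1 then 0 - w q else 0))
            - j.2 ^ 2 * ((if p ∈ j.1 then cap (γ p) * w p else 0) +
              (if q ∈ j.1 then cap (γ p) * w q else 0))))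
        + w q / (w p + w q) * (∑ j ∈ J, Real.exp (j.2 * ∑ p ∈ B with p ∈ j.1, (w0 p - w p)
          - j.2 ^ 2 * ∑ p ∈ B with p ∈ j.1, cap (γ p) * w p) *
          Real.exp (j.2 * ((if p ∈ j.1 then 0 - w p else 0)
              + (if q ∈ j.1 then (w p + w q) - w q else 0))
            - j.2 ^ 2 * ((if p ∈ j.1 then cap (γ p) * w p else 0) +
              (if q ∈ j.1 then cap (γ p) * w q else 0)))) ≤ J.card := by
      refine le_trans ?_ h4
      rw [Finset.mul_sum, Finset.mul_sum, ← Finset.sum_add_distrib]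
      refine Finset.sum_le_sum fun j hj => ?_
      set F := Real.exp (j.2 * ∑ p ∈ B with p ∈ j.1, (w0 p - w p)
          - j.2 ^ 2 * ∑ p ∈ B with p ∈ j.1, cap (γ p) * w p)
      have hF : 0 < F := Real.exp_pos _
      have hv : 0 ≤ j.2 ^ 2 := sq_nonneg _
      suffices hs : w p / (w p + w q) *
          Real.exp (j.2 * ((if p ∈ j.1 then (w p + w q) - w p else 0)
              + (if q ∈ j.1 then 0 - w q else 0))
            - j.2 ^ 2 * ((if p ∈ j.1 then cap (γ p) * w p else 0) +
              (if q ∈ j.1 then cap (γ p) * w q else 0)))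
          + w q / (w p + w q) *
          Real.exp (j.2 * ((if p ∈ j.1 then 0 - w p else 0)
              + (if q ∈ j.1 then (w p + w q) - w q else 0))
            - j.2 ^ 2 * ((if p ∈ j.1 then cap (γ p) * w p else 0) +
              (if q ∈ j.1 then cap (γ p) * w q else 0))) ≤ 1 by
        have := mul_le_mul_of_nonneg_left hs hF.le
        linarith
      by_cases hpj : p ∈ j.1 <;> by_cases hqj : q ∈ j.1
      · simp only [hpj, hqj, if_true]
        have := two_point_mgf_le_one hwp hwq (x := 0) (by simp)
          (v := j.2 ^ 2 * (cap (γ p) * w p + cap (γ p) * w q))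
          (by have : 0 ≤ cap (γ p) := by linarith
              simp only [ne_eq, OfNat.ofNat_ne_zero, not_false_eq_true, zero_pow, mul_zero]
              positivity)
        convert this using 5 <;> ring
      · simp only [hpj, hqj, if_true, if_false]
        have hjp := hJ j hj p hp hpj
        have := two_point_mgf_le_one hwp hwq (x := j.2)
          (by nlinarith [abs_nonneg j.2])
          (v := j.2 ^ 2 * (cap (γ p) * w p + 0))
          (by nlinarith [mul_nonneg hv hwp.le])
        convert this using 5 <;> ring
      · simp only [hpj, hqj, if_true, if_false]
        have hjp := hJ j hj q hq hqj
        rw [← hγ] at hjp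
        have := two_point_mgf_le_one hwp hwq (x := -j.2)
          (by rw [abs_neg]; nlinarith [abs_nonneg j.2])
          (v := j.2 ^ 2 * (0 + cap (γ p) * w q))
          (by nlinarith [mul_nonneg hv hwq.le])
        convert this using 5 <;> ring
      · simp only [hpj, hqj, if_false]
        have := two_point_mgf_le_one hwp hwq (x := 0) (by simp) (v := 0) (by simp)
        convert this using 5 <;> ring
    rcases exists_le_of_weighted_avg hwp hwq avg with h | h
    · exact key _ _ (by positivity) le_rfl (by ring) (Or.inr rfl) h
    · exact key _ _ le_rfl (by positivity) (by ring) (Or.inl rfl) h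
  · push Not at hex
    refine ⟨w, fun p hp => ⟨(hw p hp).1.le, ?_⟩, fun _ => rfl, fun i => ?_, ?_⟩
    · have := hw p hp; linarith
    · have h1 : (A.filter fun p => γ p = i ∧ 0 < w p).card ≤ 1 := by
        rw [Finset.card_le_one]
        intro a ha b hb
        simp only [Finset.mem_filter] at ha hb
        by_contra hab
        exact hex a ha.1 b hb.1 hab (by rw [ha.2.1, hb.2.1])
      have h2 : (A.filter fun p => γ p = i ∧ 0 < w p).card ≤ (A.filter fun p => γ p = i).card := by
        apply Finset.card_le_card
        intro x; simp only [Finset.mem_filter]; tauto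
      omega
    · simp only [sub_self, Finset.sum_const_zero, mul_zero, zero_sub]
      calc _ ≤ ∑ j ∈ J, (1:ℝ) := by
            refine Finset.sum_le_sum fun j _ => Real.exp_le_one_iff.2 ?_
            rw [neg_nonpos]
            refine mul_nonneg (sq_nonneg _) (Finset.sum_nonneg fun p hp => ?_)
            have := hw p (Finset.mem_filter.1 hp).1
            exact mul_nonneg (by linarith) this.1.le
        _ = J.card := by simp

/-- Linear deviation bounds extracted from the potential of `exists_pair_merging`. -/
theorem exists_pair_merging_deviation {α ι : Type*} (γ : α → ι) (cap : ι → ℝ) (w : α → ℝ)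
    (J : Finset (Finset α × ℝ)) (A : Finset α)
    (hw : ∀ p ∈ A, 0 < w p ∧ w p ≤ cap (γ p))
    (hJ : ∀ j ∈ J, ∀ p ∈ A, p ∈ j.1 → |j.2| * (2 * cap (γ p)) ≤ 1) :
    ∃ w' : α → ℝ,
      (∀ p ∈ A, 0 ≤ w' p ∧ w' p ≤ 2 * cap (γ p)) ∧
      (∀ ψ : ι → ℝ, ∑ p ∈ A, w' p * ψ (γ p) = ∑ p ∈ A, w p * ψ (γ p)) ∧
      (∀ i, 2 * (A.filter fun p => γ p = i ∧ 0 < w' p).card ≤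
        (A.filter fun p => γ p = i).card + 1) ∧
      ∀ j ∈ J, j.2 * ∑ p ∈ A with p ∈ j.1, (w' p - w p) ≤
        j.2 ^ 2 * ∑ p ∈ A with p ∈ j.1, cap (γ p) * w p + Real.log J.card := by
  obtain ⟨w', h1, h2, h3, h4⟩ := exists_pair_merging γ cap w J A hw hJ
  refine ⟨w', h1, h2, h3, fun j hj => ?_⟩
  have hle := (Finset.single_le_sum (f := fun j : Finset α × ℝ =>
    Real.exp (j.2 * ∑ p ∈ A with p ∈ j.1, (w' p - w p)
        - j.2 ^ 2 * ∑ p ∈ A with p ∈ j.1, cap (γ p) * w p))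
    (fun j _ => (Real.exp_pos _).le) hj).trans h4
  have hc : (0:ℝ) < J.card := by exact_mod_cast Finset.card_pos.2 ⟨j, hj⟩
  have := (Real.le_log_iff_exp_le hc).2 hle
  linarith

theorem sum_range_choose_le_pow (M D : ℕ) :
    ∑ i ∈ Finset.range (D + 1), M.choose i ≤ (M + 1) ^ D := by
  rw [add_pow]
  refine Finset.sum_le_sum fun i hi => ?_
  have h1 := Nat.choose_le_pow M i
  have h2 : 0 < D.choose i := Nat.choose_pos (by simpa [Nat.lt_succ_iff] using hi)
  simp only [one_pow, mul_one]
  exact h1.trans (Nat.le_mul_of_pos_right _ h2)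

/-- The subsets of `S` cut out by positivity sets of linear functionals after the feature map `Φ`
are few (linear VC-dimension bound and Sauer–Shelah). -/
theorem card_linear_ranges_le {α V : Type*} [AddCommGroup V] [Module ℝ V]
    [FiniteDimensional ℝ V] (Φ : α → V) (S : Finset α) :
    (S.powerset.filter fun R => ∃ L : V →ₗ[ℝ] ℝ, R = S.filter fun p => 0 < L (Φ p)).card ≤
      (S.card + 1) ^ Module.finrank ℝ V := by
  set 𝒜 := S.powerset.filter fun R => ∃ L : V →ₗ[ℝ] ℝ, R = S.filter fun p => 0 < L (Φ p)
    with h𝒜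
  have hsub : 𝒜.shatterer ⊆ (Finset.range (Module.finrank ℝ V + 1)).biUnion
      fun i => S.powersetCard i := by
    intro T hT
    rw [Finset.mem_shatterer] at hT
    have hTS : T ⊆ S := by
      obtain ⟨u, hu, hTu⟩ := hT.exists_superset
      rw [h𝒜, Finset.mem_filter, Finset.mem_powerset] at hu
      exact hTu.trans hu.1
    have hcard : T.card ≤ Module.finrank ℝ V := by
      by_contra hlt
      push Not at hlt
      have hdep : ¬ LinearIndependent ℝ (fun p : T => Φ p) := by
        intro hli
        have := hli.fintype_card_le_finrank
        simp at this
        omega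
      rw [Fintype.not_linearIndependent_iff] at hdep
      obtain ⟨g, hg, i, hi⟩ := hdep
      -- a shattered set has no nontrivial relation with a positive coefficient
      have main : ∀ g : T → ℝ, ∑ i, g i • Φ i = 0 → ∀ i, ¬ 0 < g i := by
        intro g hg i hi
        have hsub : (T.attach.filter fun p => 0 < g p).image Subtype.val ⊆ T := by
          intro x hx
          obtain ⟨y, _, rfl⟩ := Finset.mem_image.1 hx
          exact y.2
        obtain ⟨u, hu, hTu⟩ := hT hsub
        rw [h𝒜, Finset.mem_filter] at hu
        obtain ⟨_, L, rfl⟩ := hu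
        have hiff : ∀ p : T, 0 < L (Φ p) ↔ 0 < g p := by
          intro p
          have h1 := Finset.ext_iff.1 hTu p
          simp only [Finset.mem_inter, Finset.mem_filter, Finset.mem_image, Finset.mem_attach,
            true_and, p.2, hTS p.2] at h1
          rw [h1]
          constructor
          · rintro ⟨q, hq, hqp⟩
            rwa [Subtype.ext hqp] at hq
          · intro h; exact ⟨p, h, rfl⟩
        have hz : ∑ j, g j * L (Φ j) = 0 := by
          have := congrArg L hg
          simpa [map_sum] using this
        have hnn : ∀ j ∈ Finset.univ, 0 ≤ g j * L (Φ j) := by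
          intro j _
          rcases lt_or_ge 0 (g j) with h | h
          · exact (mul_pos h ((hiff j).2 h)).le
          · have : L (Φ j) ≤ 0 := not_lt.1 fun h' => absurd ((hiff j).1 h') (not_lt.2 h)
            exact mul_nonneg_of_nonpos_of_nonpos h this
        have := (Finset.sum_eq_zero_iff_of_nonneg hnn).1 hz i (Finset.mem_univ _)
        exact absurd this (mul_pos hi ((hiff i).2 hi)).ne'
      rcases lt_or_gt_of_ne hi with h | h
      · refine main (fun j => - g j) ?_ i (by simpa using h)
        simp only [neg_smul, Finset.sum_neg_distrib, hg, neg_zero]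
      · exact main g hg i h
    rw [Finset.mem_biUnion]
    exact ⟨T.card, Finset.mem_range.2 (by omega), Finset.mem_powersetCard.2 ⟨hTS, rfl⟩⟩
  calc 𝒜.card ≤ 𝒜.shatterer.card := Finset.card_le_card_shatterer 𝒜
    _ ≤ _ := Finset.card_le_card hsub
    _ ≤ ∑ i ∈ Finset.range (Module.finrank ℝ V + 1), (S.powersetCard i).card :=
        Finset.card_biUnion_le
    _ = ∑ i ∈ Finset.range (Module.finrank ℝ V + 1), S.card.choose i := by simp
    _ ≤ _ := sum_range_choose_le_pow _ _

/-- Iterated sums of at most `t` moves from a finite set of vectors. -/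
noncomputable def iteratedSums {V : Type*} [AddCommGroup V] (moves : Finset V) : ℕ → Finset V
  | 0 => {0}
  | t + 1 => Finset.image₂ (· + ·) (iteratedSums moves t) moves

theorem card_iteratedSums_le {V : Type*} [AddCommGroup V] (moves : Finset V) (t : ℕ) :
    (iteratedSums moves t).card ≤ moves.card ^ t := by
  induction t with
  | zero => simp [iteratedSums]
  | succ t ih =>
    rw [iteratedSums, pow_succ]
    exact (Finset.card_image₂_le _ _ _).trans (Nat.mul_le_mul_right _ ih)

section Perceptron

variable {V : Type*} [NormedAddCommGroup V] [InnerProductSpace ℝ V]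

/-- The perceptron moves `0, ± η e` for `e` in `D`. -/
noncomputable def perceptronMoves (η : ℝ) (D : Finset V) : Finset V :=
  insert 0 ((D.image fun e => η • e) ∪ D.image fun e => (-η) • e)

theorem card_perceptronMoves_le (η : ℝ) (D : Finset V) :
    (perceptronMoves η D).card ≤ 2 * D.card + 1 := by
  refine (Finset.card_insert_le _ _).trans ?_
  have h1 := Finset.card_union_le (D.image fun e => η • e) (D.image fun e => (-η) • e)
  have h2 : (D.image fun e => η • e).card ≤ D.card := Finset.card_image_le
  have h3 : (D.image fun e => (-η) • e).card ≤ D.card := Finset.card_image_le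
  omega

/-- Perceptron covering: a vector of the unit ball is matched, up to `η`, on all unit directions of
`D` by an iterated sum of few moves. -/
theorem exists_mem_iteratedSums_abs_inner_le {η : ℝ} (hη : 0 < η) (D : Finset V)
    (hD : ∀ e ∈ D, ‖e‖ ≤ 1) {u : V} (hu : ‖u‖ ≤ 1) {T : ℕ} (hT : 1 < T * η ^ 2) :
    ∃ u' ∈ iteratedSums (perceptronMoves η D) T, ∀ e ∈ D, |inner ℝ e (u - u')| ≤ η := by
  have key : ∀ t : ℕ, ∃ u' ∈ iteratedSums (perceptronMoves η D) t,
      (∀ e ∈ D, |inner ℝ e (u - u')| ≤ η) ∨ ‖u - u'‖ ^ 2 ≤ 1 - t * η ^ 2 := by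
    intro t
    induction t with
    | zero =>
      refine ⟨0, by simp [iteratedSums], Or.inr ?_⟩
      have := norm_nonneg u
      simp only [sub_zero, Nat.cast_zero, zero_mul]
      nlinarith
    | succ t ih =>
      obtain ⟨u', hu', h⟩ := ih
      by_cases hgood : ∀ e ∈ D, |inner ℝ e (u - u')| ≤ η
      · refine ⟨u' + 0, ?_, Or.inl (by simpa using hgood)⟩
        exact Finset.mem_image₂_of_mem hu' (by simp [perceptronMoves])
      · have h' := h.resolve_left hgood
        push Not at hgood
        obtain ⟨e, he, hlt⟩ := hgood
        have hen := hD e he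
        have hen0 := norm_nonneg e
        have step : ∀ s : ℝ, s ^ 2 = η ^ 2 → η ^ 2 ≤ s * inner ℝ e (u - u') →
            ‖u - (u' + s • e)‖ ^ 2 ≤ 1 - (t + 1 : ℕ) * η ^ 2 := by
          intro s hs hs'
          have : u - (u' + s • e) = (u - u') - s • e := by abel
          rw [this, norm_sub_sq_real, inner_smul_right, norm_smul, real_inner_comm, mul_pow,
            Real.norm_eq_abs, sq_abs, hs]
          push_cast
          nlinarith [mul_nonneg (sq_nonneg η) (show 0 ≤ 1 - ‖e‖ ^ 2 by nlinarith)]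
        rcases lt_abs.1 hlt with h1 | h1
        · refine ⟨u' + η • e, Finset.mem_image₂_of_mem hu' ?_, Or.inr (step η rfl (by nlinarith))⟩
          simp only [perceptronMoves, Finset.mem_insert, Finset.mem_union, Finset.mem_image]
          exact Or.inr (Or.inl ⟨e, he, rfl⟩)
        · refine ⟨u' + (-η) • e, Finset.mem_image₂_of_mem hu' ?_,
            Or.inr (step (-η) (by ring) (by nlinarith))⟩
          simp only [perceptronMoves, Finset.mem_insert, Finset.mem_union, Finset.mem_image]
          exact Or.inr (Or.inr ⟨e, he, rfl⟩)
  obtain ⟨u', hu', h⟩ := key T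
  refine ⟨u', hu', h.resolve_right fun h => ?_⟩
  have := sq_nonneg ‖u - u'‖
  linarith

/-- Exact ranges: superlevel sets of squared distances to a point. -/
theorem exists_ball_ranges [FiniteDimensional ℝ V] (S : Finset V) :
    ∃ 𝓡 : Finset (Finset V), 𝓡.card ≤ (S.card + 1) ^ (Module.finrank ℝ V + 2) ∧
      ∀ c : V, ∀ t : ℝ, (S.filter fun p => t < dist p c ^ 2) ∈ 𝓡 := by
  refine ⟨S.powerset.filter fun R => ∃ L : V × ℝ × ℝ →ₗ[ℝ] ℝ, R = S.filter fun p =>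
    0 < L (p, ‖p‖ ^ 2, 1), ?_, ?_⟩
  · have := card_linear_ranges_le (V := V × ℝ × ℝ) (fun p : V => (p, ‖p‖ ^ 2, (1:ℝ))) S
    simpa [Module.finrank_prod] using this
  · intro c t
    rw [Finset.mem_filter]
    refine ⟨Finset.mem_powerset.2 (Finset.filter_subset _ _),
      (LinearMap.coprod ((-2 : ℝ) • (innerₛₗ ℝ c)) (LinearMap.coprod LinearMap.id
        ((‖c‖ ^ 2 - t) • LinearMap.id))), ?_⟩
    apply Finset.filter_congr
    intro p _
    rw [dist_eq_norm, norm_sub_sq_real, real_inner_comm]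
    simp
    constructor <;> intro h <;> linarith

/-- Approximate ranges of dimension-free complexity. -/
theorem exists_dimension_free_ranges (S : Finset V) {η : ℝ} (hη : 0 < η) {T : ℕ}
    (hT : 1 < T * η ^ 2) :
    ∃ 𝓡 : Finset (Finset V), 𝓡.card ≤ S.card * ((2 * S.card + 1) ^ T * (S.card + 1) ^ 3) ∧
      (S.Nonempty → ∀ c : V, ∃ q : V → ℝ,
        (∀ p ∈ S, |q p - dist p c ^ 2| ≤ 4 * η * dist p c ^ 2) ∧
        ∀ t : ℝ, (S.filter fun p => t < q p) ∈ 𝓡) := by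
  set D : V → Finset V := fun p₀ => S.image fun p => (‖p - p₀‖⁻¹ : ℝ) • (p - p₀) with hD
  set F : V → V → Finset (Finset V) := fun p₀ u' => S.powerset.filter fun R =>
    ∃ L : ℝ × ℝ × ℝ →ₗ[ℝ] ℝ, R = S.filter fun p =>
      0 < L (‖p - p₀‖ ^ 2, inner ℝ (p - p₀) u', 1) with hF
  refine ⟨S.biUnion fun p₀ => (iteratedSums (perceptronMoves η (D p₀)) T).biUnion (F p₀), ?_, ?_⟩
  · have hb : ∀ p₀ ∈ S, ((iteratedSums (perceptronMoves η (D p₀)) T).biUnion (F p₀)).card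
        ≤ (2 * S.card + 1) ^ T * (S.card + 1) ^ 3 := by
      intro p₀ _
      refine (Finset.card_biUnion_le_card_mul _ _ ((S.card + 1) ^ 3) ?_).trans ?_
      · intro u' _
        have := card_linear_ranges_le (V := ℝ × ℝ × ℝ)
          (fun p : V => (‖p - p₀‖ ^ 2, inner ℝ (p - p₀) u', (1:ℝ))) S
        simpa [Module.finrank_prod, hF] using this
      · refine Nat.mul_le_mul_right _ ((card_iteratedSums_le _ _).trans ?_)
        refine Nat.pow_le_pow_left ((card_perceptronMoves_le _ _).trans ?_) _
        have : (D p₀).card ≤ S.card := Finset.card_image_le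
        omega
    exact Finset.card_biUnion_le_card_mul _ _ _ hb
  · intro hS c
    obtain ⟨p₀, hp₀, hmin⟩ := S.exists_min_image (fun p => dist p c) hS
    have hDn : ∀ e ∈ D p₀, ‖e‖ ≤ 1 := by
      intro e he
      obtain ⟨p, _, rfl⟩ := Finset.mem_image.1 he
      rw [norm_smul, norm_inv, norm_norm]
      exact inv_mul_le_one
    have hun : ‖(‖c - p₀‖⁻¹ : ℝ) • (c - p₀)‖ ≤ 1 := by
      rw [norm_smul, norm_inv, norm_norm]
      exact inv_mul_le_one
    obtain ⟨u', hu', hin⟩ := exists_mem_iteratedSums_abs_inner_le hη (D p₀) hDn hun hT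
    set ρ := ‖c - p₀‖ with hρ
    refine ⟨fun p => ‖p - p₀‖ ^ 2 - 2 * ρ * inner ℝ (p - p₀) u' + ρ ^ 2, ?_, ?_⟩
    · intro p hp
      have hpc : ρ ≤ dist p c := by
        have := hmin p hp
        rwa [dist_comm p₀ c, dist_eq_norm c p₀] at this
      have hpp : ‖p - p₀‖ ≤ 2 * dist p c := by
        have := dist_triangle p c p₀
        rw [dist_eq_norm p p₀, dist_eq_norm c p₀] at this
        linarith
      have h1 := hin _ (Finset.mem_image_of_mem (fun p => (‖p - p₀‖⁻¹ : ℝ) • (p - p₀)) hp)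
      have hr0 : 0 ≤ ρ := norm_nonneg _
      have ha0 : 0 ≤ ‖p - p₀‖ := norm_nonneg _
      have h2 : |‖p - p₀‖ * ρ * inner ℝ ((‖p - p₀‖⁻¹ : ℝ) • (p - p₀)) (ρ⁻¹ • (c - p₀) - u')|
          ≤ ‖p - p₀‖ * ρ * η := by
        rw [abs_mul, abs_of_nonneg (mul_nonneg ha0 hr0)]
        gcongr
      have h3 : ‖p - p₀‖ * ρ * inner ℝ ((‖p - p₀‖⁻¹ : ℝ) • (p - p₀)) (ρ⁻¹ • (c - p₀) - u')
          = inner ℝ (p - p₀) (c - p₀) - ρ * inner ℝ (p - p₀) u' := by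
        rw [inner_smul_left, inner_sub_right, inner_smul_right]
        simp only [conj_trivial]
        rcases eq_or_ne ‖p - p₀‖ 0 with h0 | h0
        · have : p - p₀ = 0 := norm_eq_zero.1 h0
          simp [this]
        · rcases eq_or_ne ρ 0 with h0' | h0'
          · have : c - p₀ = 0 := norm_eq_zero.1 h0'
            simp [this, h0']
          · field_simp
      rw [h3] at h2
      have h4 : dist p c ^ 2 = ‖p - p₀‖ ^ 2 - 2 * inner ℝ (p - p₀) (c - p₀) + ρ ^ 2 := by
        have : p - c = (p - p₀) - (c - p₀) := by abel
        rw [dist_eq_norm, this, norm_sub_sq_real]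
      have h5 : ‖p - p₀‖ * ρ ≤ 2 * dist p c ^ 2 := by nlinarith
      have h6 : ‖p - p₀‖ ^ 2 - 2 * ρ * inner ℝ (p - p₀) u' + ρ ^ 2 - dist p c ^ 2
          = 2 * (inner ℝ (p - p₀) (c - p₀) - ρ * inner ℝ (p - p₀) u') := by
        rw [h4]; ring
      rw [h6, abs_mul, abs_of_pos (by norm_num : (0:ℝ) < 2)]
      nlinarith
    · intro t
      rw [Finset.mem_biUnion]
      refine ⟨p₀, hp₀, ?_⟩
      rw [Finset.mem_biUnion]
      refine ⟨u', hu', ?_⟩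
      rw [hF, Finset.mem_filter]
      refine ⟨Finset.mem_powerset.2 (Finset.filter_subset _ _),
        (LinearMap.coprod LinearMap.id (LinearMap.coprod ((-2 * ρ) • LinearMap.id)
          ((ρ ^ 2 - t) • LinearMap.id))), ?_⟩
      apply Finset.filter_congr
      intro p _
      simp
      constructor <;> intro h <;> linarith

end Perceptron

/-- Passing from one center to `k` centers by intersecting ranges. -/
theorem exists_multi_center_ranges {d k : ℕ} (hk : 1 ≤ k) (S : Finset (EuclideanSpace ℝ (Fin d)))
    {η : ℝ} (hη' : 4 * η ≤ 1)
    (𝓡₁ : Finset (Finset (EuclideanSpace ℝ (Fin d))))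
    (h₁ : ∀ c : EuclideanSpace ℝ (Fin d), ∃ q : EuclideanSpace ℝ (Fin d) → ℝ,
        (∀ p ∈ S, |q p - dist p c ^ 2| ≤ 4 * η * dist p c ^ 2) ∧
        ∀ t : ℝ, (S.filter fun p => t < q p) ∈ 𝓡₁) :
    ∃ 𝓡 : Finset (Finset (EuclideanSpace ℝ (Fin d))), 𝓡.card ≤ 𝓡₁.card ^ k ∧
      ∀ C : Finset (EuclideanSpace ℝ (Fin d)), C.card = k →
        ∃ q : EuclideanSpace ℝ (Fin d) → ℝ,
          (∀ p ∈ S, |q p - distC p C ^ 2| ≤ 4 * η * distC p C ^ 2) ∧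
          ∀ t : ℝ, (S.filter fun p => t < q p) ∈ 𝓡 := by
  choose Q hQ hQR using h₁
  refine ⟨(Fintype.piFinset fun _ : Fin k => 𝓡₁).image
    fun G => S.filter fun p => ∀ i, p ∈ G i, ?_, ?_⟩
  · refine Finset.card_image_le.trans ?_
    simp
  · intro C hC
    have hne : C.Nonempty := Finset.card_pos.1 (by omega)
    refine ⟨fun p => C.inf' hne fun c => Q c p, ?_, ?_⟩
    · intro p hp
      obtain ⟨c0, hc0, e0⟩ := Finset.exists_mem_eq_inf' hne fun c => Q c p
      obtain ⟨c1, hc1, e1⟩ := C.finite_toSet.isCompact.exists_infDist_eq_dist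
        (Finset.coe_nonempty.2 hne) p
      have hg0 : 0 ≤ distC p C := Metric.infDist_nonneg
      have hg1 : distC p C = dist p c1 := e1
      have hle : distC p C ≤ dist p c0 := Metric.infDist_le_dist_of_mem hc0
      have h0 := abs_le.1 (hQ c0 p hp)
      have h1 := abs_le.1 (hQ c1 p hp)
      have h2 : (C.inf' hne fun c => Q c p) ≤ Q c1 p := Finset.inf'_le _ hc1
      beta_reduce
      rw [abs_le]
      rw [← hg1] at h1
      constructor
      · rw [e0]
        have : distC p C ^ 2 ≤ dist p c0 ^ 2 := by gcongr
        nlinarith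
      · linarith
    · intro t
      rw [Finset.mem_image]
      set e := (Finset.equivFinOfCardEq hC).symm
      refine ⟨fun i => S.filter fun p => t < Q (e i) p, ?_, ?_⟩
      · rw [Fintype.mem_piFinset]
        intro i; exact hQR _ _
      · apply Finset.filter_congr
        intro p hp
        rw [Finset.lt_inf'_iff]
        constructor
        · intro h c hc
          have := (Finset.mem_filter.1 (h (e.symm ⟨c, hc⟩))).2
          simpa using this
        · intro h i
          exact Finset.mem_filter.2 ⟨hp, h _ (e i).2⟩

/-- The ranges of `k`-center distance functions have complexity `k · min(d, η⁻²)`. -/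
theorem exists_center_ranges {d k : ℕ} (hd : 1 ≤ d) (hk : 1 ≤ k)
    (S : Finset (EuclideanSpace ℝ (Fin d))) (hS : S.Nonempty)
    {η : ℝ} (hη : 0 < η) (hη' : 4 * η ≤ 1) :
    ∃ 𝓡 : Finset (Finset (EuclideanSpace ℝ (Fin d))),
      Real.log 𝓡.card ≤ k * (7 * min (η ^ 2)⁻¹ (d : ℝ) * Real.log (2 * S.card + 1)) ∧
      ∀ C : Finset (EuclideanSpace ℝ (Fin d)), C.card = k →
        ∃ q : EuclideanSpace ℝ (Fin d) → ℝ,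
          (∀ p ∈ S, |q p - distC p C ^ 2| ≤ 4 * η * distC p C ^ 2) ∧
          ∀ t : ℝ, (S.filter fun p => t < q p) ∈ 𝓡 := by
  have hM : 1 ≤ S.card := Finset.card_pos.2 hS
  have hlog : 0 ≤ Real.log (2 * S.card + 1) := Real.log_nonneg (by
    have : (0:ℝ) ≤ S.card := Nat.cast_nonneg _
    linarith)
  suffices h : ∃ 𝓡₁ : Finset (Finset (EuclideanSpace ℝ (Fin d))),
      Real.log 𝓡₁.card ≤ 7 * min (η ^ 2)⁻¹ (d : ℝ) * Real.log (2 * S.card + 1) ∧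
      ∀ c : EuclideanSpace ℝ (Fin d), ∃ q : EuclideanSpace ℝ (Fin d) → ℝ,
        (∀ p ∈ S, |q p - dist p c ^ 2| ≤ 4 * η * dist p c ^ 2) ∧
        ∀ t : ℝ, (S.filter fun p => t < q p) ∈ 𝓡₁ by
    obtain ⟨𝓡₁, hlog₁, h₁⟩ := h
    obtain ⟨𝓡, hc, h⟩ := exists_multi_center_ranges hk S hη' 𝓡₁ h₁
    refine ⟨𝓡, ?_, h⟩
    have h0 : 0 < 𝓡.card := by
      obtain ⟨C, hC⟩ : ∃ C : Finset (EuclideanSpace ℝ (Fin d)), C.card = k := by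
        have : Nonempty (Fin d) := ⟨⟨0, hd⟩⟩
        have : Infinite (EuclideanSpace ℝ (Fin d)) :=
          Module.Free.infinite ℝ (EuclideanSpace ℝ (Fin d))
        obtain ⟨C, hC⟩ := Infinite.exists_subset_card_eq (EuclideanSpace ℝ (Fin d)) k
        exact ⟨C, hC⟩
      obtain ⟨q, _, hq⟩ := h C hC
      exact Finset.card_pos.2 ⟨_, hq 0⟩
    calc Real.log 𝓡.card ≤ Real.log ((𝓡₁.card : ℝ) ^ k) := by
          apply Real.log_le_log
          · exact_mod_cast h0
          · exact_mod_cast hc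
      _ = k * Real.log 𝓡₁.card := Real.log_pow _ _
      _ ≤ _ := by gcongr
  rcases le_total (η ^ 2)⁻¹ (d : ℝ) with hmin | hmin
  · rw [min_eq_left hmin]
    set T := ⌊(η ^ 2)⁻¹⌋₊ + 1
    have hT1 : (η ^ 2)⁻¹ < (T : ℝ) := by
      have := Nat.lt_floor_add_one (η ^ 2)⁻¹
      push_cast [T]; exact this
    have hη2 : 0 < η ^ 2 := by positivity
    have hT : 1 < T * η ^ 2 := by
      rwa [inv_lt_iff_one_lt_mul₀ hη2] at hT1
    obtain ⟨𝓡₁, hc, h₁⟩ := exists_dimension_free_ranges S hη hT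
    refine ⟨𝓡₁, ?_, h₁ hS⟩
    have h0 : 0 < 𝓡₁.card := by
      obtain ⟨q, _, hq⟩ := h₁ hS 0
      exact Finset.card_pos.2 ⟨_, hq 0⟩
    have hc' : 𝓡₁.card ≤ (2 * S.card + 1) ^ (T + 4) := by
      refine hc.trans ?_
      calc S.card * ((2 * S.card + 1) ^ T * (S.card + 1) ^ 3)
          ≤ (2 * S.card + 1) * ((2 * S.card + 1) ^ T * (2 * S.card + 1) ^ 3) := by
            gcongr <;> omega
        _ = _ := by ring
    have hT2 : (T : ℝ) + 4 ≤ 7 * (η ^ 2)⁻¹ := by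
      have h1 : (T : ℝ) ≤ (η ^ 2)⁻¹ + 1 := by
        push_cast [T]
        have := Nat.floor_le (inv_nonneg.2 hη2.le)
        linarith
      have h2 : 1 ≤ (η ^ 2)⁻¹ := (one_le_inv₀ hη2).2 (by nlinarith)
      linarith
    calc Real.log 𝓡₁.card ≤ Real.log ((2 * S.card + 1 : ℝ) ^ (T + 4)) := by
          apply Real.log_le_log
          · exact_mod_cast h0
          · exact_mod_cast hc'
      _ = ((T : ℝ) + 4) * Real.log (2 * S.card + 1) := by rw [Real.log_pow]; push_cast; ring
      _ ≤ _ := by gcongr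
  · rw [min_eq_right hmin]
    obtain ⟨𝓡₁, hc, h₁⟩ := exists_ball_ranges S
    refine ⟨𝓡₁, ?_, fun c => ⟨fun p => dist p c ^ 2, fun p _ => ?_, h₁ c⟩⟩
    · have h0 : 0 < 𝓡₁.card := Finset.card_pos.2 ⟨_, h₁ 0 0⟩
      have hc' : 𝓡₁.card ≤ (2 * S.card + 1) ^ (d + 2) := by
        rw [finrank_euclideanSpace_fin] at hc
        refine hc.trans (Nat.pow_le_pow_left (by omega) _)
      have hd1 : (1:ℝ) ≤ d := by exact_mod_cast hd
      calc Real.log 𝓡₁.card ≤ Real.log ((2 * S.card + 1 : ℝ) ^ (d + 2)) := by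
            apply Real.log_le_log
            · exact_mod_cast h0
            · exact_mod_cast hc'
        _ = ((d : ℝ) + 2) * Real.log (2 * S.card + 1) := by rw [Real.log_pow]; push_cast; ring
        _ ≤ _ := by
          apply mul_le_mul_of_nonneg_right _ hlog
          linarith
    · simp only [sub_self, abs_zero]
      positivity

/-- A weighted upper quantile: some value `x p₀` has at most mass `m` strictly above it and more
than mass `m` weakly above it. -/
theorem exists_upper_quantile {α : Type*} (A : Finset α) (w x : α → ℝ) {m : ℝ} (hm : 0 ≤ m)
    (hW : m < ∑ p ∈ A, w p) :
    ∃ p₀ ∈ A, ∑ p ∈ A with x p₀ < x p, w p ≤ m ∧ m < ∑ p ∈ A with x p₀ ≤ x p, w p := by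
  have hA : A.Nonempty := by
    rw [Finset.nonempty_iff_ne_empty]
    rintro rfl
    simp at hW
    linarith
  set G := A.filter fun q => ∑ p ∈ A with x q < x p, w p ≤ m with hG
  have hGne : G.Nonempty := by
    obtain ⟨q, hq, hmax⟩ := A.exists_max_image x hA
    refine ⟨q, Finset.mem_filter.2 ⟨hq, ?_⟩⟩
    rw [Finset.filter_false_of_mem]
    · simpa
    · intro p hp
      exact not_lt.2 (hmax p hp)
  obtain ⟨p₀, hp₀, hmin⟩ := G.exists_min_image x hGne
  refine ⟨p₀, (Finset.mem_filter.1 hp₀).1, (Finset.mem_filter.1 hp₀).2, ?_⟩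
  rcases (A.filter fun p => x p < x p₀).eq_empty_or_nonempty with h | h
  · rw [Finset.filter_true_of_mem]
    · exact hW
    · intro p hp
      by_contra hc
      have : p ∈ A.filter fun p => x p < x p₀ := Finset.mem_filter.2 ⟨hp, not_le.1 hc⟩
      rw [h] at this
      simp at this
  · obtain ⟨q, hq, hqmax⟩ := Finset.exists_max_image _ x h
    obtain ⟨hqA, hqlt⟩ := Finset.mem_filter.1 hq
    have hqG : q ∉ G := fun hc => absurd (hmin q hc) (not_le.2 hqlt)
    have h1 : m < ∑ p ∈ A with x q < x p, w p := by
      by_contra hc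
      exact hqG (Finset.mem_filter.2 ⟨hqA, not_lt.1 hc⟩)
    have h2 : (A.filter fun p => x p₀ ≤ x p) = A.filter fun p => x q < x p := by
      apply Finset.filter_congr
      intro p hp
      constructor
      · intro h; linarith
      · intro h
        by_contra hc
        have := hqmax p (Finset.mem_filter.2 ⟨hp, not_le.1 hc⟩)
        linarith
    rw [h2]
    exact h1

theorem dual_le_of_feasible {α : Type*} {A : Finset α} {w x w' : α → ℝ} {m θ : ℝ}
    (hw' : ∀ p ∈ A, 0 ≤ w' p ∧ w' p ≤ w p)
    (hsum : ∑ p ∈ A, w' p = ∑ p ∈ A, w p - m) :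
    ∑ p ∈ A, w p * min (x p) θ - m * θ ≤ ∑ p ∈ A, w' p * x p := by
  have h : ∑ p ∈ A, w p * min (x p) θ ≤ ∑ p ∈ A, (w' p * x p + (w p - w' p) * θ) := by
    apply Finset.sum_le_sum
    intro p hp
    obtain ⟨h0, h1⟩ := hw' p hp
    nlinarith [min_le_left (x p) θ, min_le_right (x p) θ]
  rw [Finset.sum_add_distrib, ← Finset.sum_mul, Finset.sum_sub_distrib, hsum] at h
  linarith

theorem exists_feasible_eq_dual {α : Type*} {A : Finset α} {w : α → ℝ} (x : α → ℝ) {m : ℝ}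
    (hw : ∀ p ∈ A, 0 ≤ w p) (hm : 0 ≤ m) (hW : m < ∑ p ∈ A, w p) :
    ∃ p₀ ∈ A, m < ∑ p ∈ A with x p₀ ≤ x p, w p ∧
      ∃ w' : α → ℝ, (∀ p ∈ A, 0 ≤ w' p ∧ w' p ≤ w p) ∧ ∑ p ∈ A, w' p = ∑ p ∈ A, w p - m ∧
        ∑ p ∈ A, w' p * x p = ∑ p ∈ A, w p * min (x p) (x p₀) - m * x p₀ := by
  obtain ⟨p₀, hp₀, hle, hlt⟩ := exists_upper_quantile A w x hm hW
  refine ⟨p₀, hp₀, hlt, ?_⟩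
  set θ := x p₀
  set E := ∑ p ∈ A with x p = θ, w p with hE
  set G := ∑ p ∈ A with θ < x p, w p with hG
  set H := ∑ p ∈ A with θ ≤ x p, w p with hH
  have hHG : H = E + G := by
    rw [hH, hE, hG, Finset.sum_filter, Finset.sum_filter, Finset.sum_filter,
      ← Finset.sum_add_distrib]
    apply Finset.sum_congr rfl
    intro p _
    rcases lt_trichotomy (x p) θ with h | h | h
    · simp [h.not_ge, h.ne, h.not_gt]
    · simp [h]
    · simp [h.le, h.ne', h]
  have hE0 : 0 < E := by linarith
  set t := (H - m) / E with ht
  have ht0 : 0 ≤ t := div_nonneg (by linarith) hE0.le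
  have ht1 : t ≤ 1 := (div_le_one hE0).2 (by linarith)
  have htE : t * E = H - m := div_mul_cancel₀ _ hE0.ne'
  have key : ∀ v : α → ℝ, ∑ p ∈ A, (if x p < θ then w p else if x p = θ then t * w p else 0) * v p
      = ∑ p ∈ A with x p < θ, w p * v p + t * ∑ p ∈ A with x p = θ, w p * v p := by
    intro v
    rw [Finset.sum_filter, Finset.sum_filter, Finset.mul_sum, ← Finset.sum_add_distrib]
    apply Finset.sum_congr rfl
    intro p _
    rcases lt_trichotomy (x p) θ with h | h | h
    · simp [h, h.ne]
    · simp [h]; ring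
    · simp [h.not_gt, h.ne']
  have hsplit : ∀ v : α → ℝ, ∑ p ∈ A, v p
      = ∑ p ∈ A with x p < θ, v p + ∑ p ∈ A with θ ≤ x p, v p := by
    intro v
    rw [← Finset.sum_filter_add_sum_filter_not A fun p => x p < θ]
    simp only [not_lt]
  refine ⟨fun p => if x p < θ then w p else if x p = θ then t * w p else 0, ?_, ?_, ?_⟩
  · intro p hp
    have := hw p hp
    dsimp only
    split_ifs
    · exact ⟨this, le_rfl⟩
    · exact ⟨by positivity, by nlinarith⟩
    · exact ⟨le_rfl, this⟩
  · have := key fun _ => 1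
    simp only [mul_one] at this
    rw [this, hsplit w, ← hE, htE]
    ring
  · have h1 : ∑ p ∈ A with x p = θ, w p * x p = E * θ := by
      rw [hE, Finset.sum_mul]
      exact Finset.sum_congr rfl fun p hp => by rw [(Finset.mem_filter.1 hp).2]
    have h2 : ∑ p ∈ A with x p < θ, w p * min (x p) θ = ∑ p ∈ A with x p < θ, w p * x p :=
      Finset.sum_congr rfl fun p hp => by rw [min_eq_left (Finset.mem_filter.1 hp).2.le]
    have h3 : ∑ p ∈ A with θ ≤ x p, w p * min (x p) θ = H * θ := by
      rw [hH, Finset.sum_mul]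
      exact Finset.sum_congr rfl fun p hp => by rw [min_eq_right (Finset.mem_filter.1 hp).2]
    rw [key x, hsplit fun p => w p * min (x p) θ, h1, h2, h3, ← mul_assoc, htE]
    ring

section Duality

variable {d : ℕ} {z m : ℝ} {P : Finset (EuclideanSpace ℝ (Fin d))}
  {w : EuclideanSpace ℝ (Fin d) → ℝ}

theorem distC_rpow_nonneg (p : EuclideanSpace ℝ (Fin d)) (C : Finset (EuclideanSpace ℝ (Fin d))) :
    0 ≤ distC p C ^ z :=
  Real.rpow_nonneg Metric.infDist_nonneg _

/-- Weak duality for the weighted robust cost. -/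
theorem dual_le_wrcostZ (hw : ∀ p ∈ P, 0 ≤ w p) (hm : 0 ≤ m) (hW : m < ∑ p ∈ P, w p)
    (C : Finset (EuclideanSpace ℝ (Fin d))) (θ : ℝ) :
    ∑ p ∈ P, w p * min (distC p C ^ z) θ - m * θ ≤ wrcostZ z (∑ p ∈ P, w p - m) P w C := by
  obtain ⟨p₀, -, -, w', h1, h2, -⟩ := exists_feasible_eq_dual (fun p => distC p C ^ z) hw hm hW
  refine le_csInf ⟨_, w', h1, h2, rfl⟩ ?_
  rintro y ⟨w'', h1, h2, rfl⟩
  exact dual_le_of_feasible h1 h2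

/-- Strong duality for the weighted robust cost. -/
theorem exists_wrcostZ_eq_dual (hw : ∀ p ∈ P, 0 ≤ w p) (hm : 0 ≤ m) (hW : m < ∑ p ∈ P, w p)
    (C : Finset (EuclideanSpace ℝ (Fin d))) :
    ∃ θ : ℝ, 0 ≤ θ ∧ m < ∑ p ∈ P with θ ≤ distC p C ^ z, w p ∧
      wrcostZ z (∑ p ∈ P, w p - m) P w C = ∑ p ∈ P, w p * min (distC p C ^ z) θ - m * θ := by
  obtain ⟨p₀, -, h0, w', h1, h2, h3⟩ := exists_feasible_eq_dual (fun p => distC p C ^ z) hw hm hW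
  refine ⟨_, distC_rpow_nonneg p₀ C, h0, le_antisymm ?_ ?_⟩
  · rw [← h3]
    refine csInf_le ⟨0, ?_⟩ ⟨w', h1, h2, rfl⟩
    rintro y ⟨w'', h1, -, rfl⟩
    exact Finset.sum_nonneg fun p hp => mul_nonneg (h1 p hp).1 (distC_rpow_nonneg p C)
  · exact dual_le_wrcostZ hw hm hW C _

theorem wrcostZ_nonneg {t : ℝ} (C : Finset (EuclideanSpace ℝ (Fin d))) :
    0 ≤ wrcostZ z t P w C := by
  apply Real.sInf_nonneg
  rintro y ⟨w', h1, -, rfl⟩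
  exact Finset.sum_nonneg fun p hp => mul_nonneg (h1 p hp).1 (distC_rpow_nonneg p C)

/-- The unweighted robust cost is the weighted one with unit weights. -/
theorem rcostZ_eq_wrcostZ {m : ℕ} (hm : m < P.card) (C : Finset (EuclideanSpace ℝ (Fin d))) :
    rcostZ z m P C = wrcostZ z ((P.card : ℝ) - m) P (fun _ => 1) C := by
  have hsum : ∑ p ∈ P, (fun _ => 1 : EuclideanSpace ℝ (Fin d) → ℝ) p = P.card := by simp
  have hbdd : BddBelow {y : ℝ | ∃ L : Finset (EuclideanSpace ℝ (Fin d)),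
      L ⊆ P ∧ L.card = m ∧ y = ∑ p ∈ P \ L, distC p C ^ z} := by
    refine ⟨0, ?_⟩
    rintro y ⟨L, -, -, rfl⟩
    exact Finset.sum_nonneg fun p _ => distC_rpow_nonneg p C
  have hm' : (m : ℝ) < ∑ p ∈ P, (fun _ => 1 : EuclideanSpace ℝ (Fin d) → ℝ) p := by
    rw [hsum]; exact_mod_cast hm
  have hm0 : (0 : ℝ) ≤ m := Nat.cast_nonneg _
  apply le_antisymm
  · obtain ⟨p₀, hp₀, hle, hlt⟩ :=
      exists_upper_quantile P (fun _ => 1) (fun p => distC p C ^ z) hm0 hm'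
    rw [← hsum]
    set θ := distC p₀ C ^ z
    simp only [Finset.sum_const, nsmul_eq_mul, mul_one, Nat.cast_le, Nat.cast_lt] at hle hlt
    obtain ⟨L, hL1, hL2, hLm⟩ := Finset.exists_subsuperset_card_eq
      (s := P.filter fun p => θ < distC p C ^ z) (t := P.filter fun p => θ ≤ distC p C ^ z)
      (fun p hp => Finset.mem_filter.2
        ⟨(Finset.mem_filter.1 hp).1, (Finset.mem_filter.1 hp).2.le⟩) hle hlt.le
    have hLP : L ⊆ P := hL2.trans (Finset.filter_subset _ _)
    refine (csInf_le hbdd ⟨L, hLP, hLm, rfl⟩).trans ?_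
    refine le_trans (le_of_eq ?_)
      (dual_le_wrcostZ (w := fun _ => 1) (z := z) (fun _ _ => zero_le_one) hm0 hm' C θ)
    rw [← Finset.sum_sdiff hLP]
    have h1 : ∑ p ∈ L, 1 * min (distC p C ^ z) θ = m * θ := by
      rw [← hLm, ← nsmul_eq_mul, ← Finset.sum_const]
      exact Finset.sum_congr rfl fun p hp => by
        rw [one_mul, min_eq_right (Finset.mem_filter.1 (hL2 hp)).2]
    rw [h1, add_sub_cancel_right]
    apply Finset.sum_congr rfl
    intro p hp
    rw [one_mul, min_eq_left]
    by_contra hc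
    exact (Finset.mem_sdiff.1 hp).2
      (hL1 (Finset.mem_filter.2 ⟨(Finset.mem_sdiff.1 hp).1, not_le.1 hc⟩))
  · obtain ⟨L, hLP, hLm⟩ := Finset.exists_subset_card_eq hm.le
    refine le_csInf ⟨_, L, hLP, hLm, rfl⟩ ?_
    rintro y ⟨L, hLP, hLm, rfl⟩
    refine csInf_le ⟨0, ?_⟩ ⟨fun p => if p ∈ P \ L then 1 else 0, ?_, ?_, ?_⟩
    · rintro y ⟨w'', h1, -, rfl⟩
      exact Finset.sum_nonneg fun p hp => mul_nonneg (h1 p hp).1 (distC_rpow_nonneg p C)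
    · intro p _
      dsimp only
      split_ifs <;> norm_num
    · rw [Finset.sum_ite_mem, Finset.inter_eq_right.2 Finset.sdiff_subset]
      simp [Finset.card_sdiff_of_subset hLP, hLm, Nat.cast_sub hm.le]
    · simp only [ite_mul, one_mul, zero_mul]
      rw [Finset.sum_ite_mem, Finset.inter_eq_right.2 Finset.sdiff_subset]

/-- Points of weight zero do not matter for the weighted robust cost. -/
theorem wrcostZ_filter_pos (hw : ∀ p ∈ P, 0 ≤ w p) (hm : 0 ≤ m) (hW : m < ∑ p ∈ P, w p)
    (C : Finset (EuclideanSpace ℝ (Fin d))) :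
    wrcostZ z (∑ p ∈ P, w p - m) (P.filter fun p => 0 < w p) w C
      = wrcostZ z (∑ p ∈ P, w p - m) P w C := by
  have key : ∀ v : EuclideanSpace ℝ (Fin d) → ℝ,
      ∑ p ∈ P with 0 < w p, w p * v p = ∑ p ∈ P, w p * v p := by
    intro v
    refine Finset.sum_subset (Finset.filter_subset _ _) fun p hp hn => ?_
    have : w p = 0 := le_antisymm
      (not_lt.1 fun h => hn (Finset.mem_filter.2 ⟨hp, h⟩)) (hw p hp)
    rw [this, zero_mul]
  have hs : ∑ p ∈ P with 0 < w p, w p = ∑ p ∈ P, w p := by simpa using key fun _ => 1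
  have hw' : ∀ p ∈ P.filter fun p => 0 < w p, 0 ≤ w p := fun p hp => (Finset.mem_filter.1 hp).2.le
  apply le_antisymm
  · rw [← hs]
    rw [← hs] at hW
    obtain ⟨θ, h0, -, h⟩ := exists_wrcostZ_eq_dual (z := z) hw' hm hW C
    rw [h, key, hs]
    rw [hs] at hW
    exact dual_le_wrcostZ hw hm hW C θ
  · obtain ⟨θ, h0, -, h⟩ := exists_wrcostZ_eq_dual (z := z) hw hm hW C
    rw [h, ← key, ← hs]
    rw [← hs] at hW
    exact dual_le_wrcostZ hw' hm hW C θ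

end Duality

theorem abs_rpow_sub_rpow_le {z a g q : ℝ} (hz : 1 ≤ z) (hg : 0 ≤ g) (ha : 0 ≤ a)
    (haz : (z + 2) * a ≤ 1) (hq : |q - g ^ 2| ≤ a * g ^ 2) :
    |q ^ (z / 2) - g ^ z| ≤ (z + 2) * a * g ^ z := by
  have ha1 : a ≤ 1 / 3 := by nlinarith
  have hg2 : (g ^ 2) ^ (z / 2) = g ^ z := by
    rw [← Real.rpow_natCast, ← Real.rpow_mul hg]
    congr 1
    push_cast
    ring
  obtain ⟨h1, h2⟩ := abs_le.1 hq
  have hx : 0 ≤ g ^ z := Real.rpow_nonneg hg z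
  have hlow : 1 - (z / 2 + 1) * a ≤ (1 - a) ^ (z / 2) := by
    have h := one_add_mul_self_le_rpow_one_add (s := -a) (by linarith)
      (p := z / 2 + 1) (by linarith)
    have h' : (1 + -a) ^ (z / 2 + 1) ≤ (1 + -a) ^ (z / 2) :=
      Real.rpow_le_rpow_of_exponent_ge (by linarith) (by linarith) (by linarith)
    rw [← sub_eq_add_neg] at h h'
    linarith
  have hpos : 0 < 1 - (z / 2 + 1) * a := by linarith
  have hup : (1 + a) ^ (z / 2) ≤ 1 + (z + 2) * a := by
    have h3 : (1 + a) ^ (z / 2) * (1 - a) ^ (z / 2) ≤ 1 := by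
      rw [← Real.mul_rpow (by linarith) (by linarith)]
      exact Real.rpow_le_one (by nlinarith) (by nlinarith) (by linarith)
    have h4 : (0:ℝ) ≤ (1 + a) ^ (z / 2) := Real.rpow_nonneg (by linarith) _
    have h5 : (1 + a) ^ (z / 2) * (1 - (z / 2 + 1) * a) ≤ 1 :=
      (mul_le_mul_of_nonneg_left hlow h4).trans h3
    have h6 : 1 ≤ (1 + (z + 2) * a) * (1 - (z / 2 + 1) * a) := by
      have h7 : 0 ≤ (z + 2) * a := by positivity
      nlinarith [mul_nonneg h7 (sub_nonneg.2 haz)]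
    exact le_of_mul_le_mul_right (h5.trans h6) hpos
  have hq0 : (1 - a) * g ^ 2 ≤ q := by linarith
  have hq1 : q ≤ (1 + a) * g ^ 2 := by linarith
  have hqn : 0 ≤ q := le_trans (by nlinarith [sq_nonneg g]) hq0
  have e1 : (1 - a) ^ (z / 2) * g ^ z ≤ q ^ (z / 2) := by
    rw [← hg2, ← Real.mul_rpow (by linarith) (by positivity)]
    exact Real.rpow_le_rpow (by nlinarith [sq_nonneg g]) hq0 (by linarith)
  have e2 : q ^ (z / 2) ≤ (1 + a) ^ (z / 2) * g ^ z := by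
    rw [← hg2, ← Real.mul_rpow (by linarith) (by positivity)]
    exact Real.rpow_le_rpow hqn hq1 (by linarith)
  rw [abs_le]
  constructor
  · nlinarith
  · nlinarith

theorem abs_min_sub_min_le_mul {x y θ a : ℝ} (hθ : 0 ≤ θ) (ha : 0 ≤ a) (ha1 : a ≤ 1)
    (h : |y - x| ≤ a * x) : |min y θ - min x θ| ≤ a * min x θ := by
  obtain ⟨h1, h2⟩ := abs_le.1 h
  rw [abs_le]
  rcases le_total x θ with hxt | hxt <;> rcases le_total y θ with hyt | hyt
  · rw [min_eq_left hxt, min_eq_left hyt]; constructor <;> linarith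
  · rw [min_eq_left hxt, min_eq_right hyt]; constructor <;> nlinarith
  · rw [min_eq_right hxt, min_eq_left hyt]; constructor <;> nlinarith
  · rw [min_eq_right hxt, min_eq_right hyt]; constructor <;> nlinarith

theorem abs_sum_mul_min_le {α : Type*} (A : Finset α) (δ w y : α → ℝ) {a b V θ : ℝ}
    (hV : 0 ≤ V) (hVθ : V ≤ θ) (hy : ∀ p ∈ A, 0 ≤ y p) (hyV : ∀ p ∈ A, min (y p) θ ≤ V)
    (h : ∀ u, 0 ≤ u → |∑ p ∈ A with u < y p, δ p| ≤ a * ∑ p ∈ A with u < y p, w p + b) :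
    |∑ p ∈ A, δ p * min (y p) θ| ≤ a * ∑ p ∈ A, w p * min (y p) θ + b * V := by
  have key : ∀ e : ℝ, (∀ u, 0 ≤ u →
      e * ∑ p ∈ A with u < y p, δ p ≤ a * ∑ p ∈ A with u < y p, w p + b) →
      e * ∑ p ∈ A, δ p * min (y p) θ ≤ a * ∑ p ∈ A, w p * min (y p) θ + b * V := by
    intro e he
    have := sum_mul_le_of_superlevel A (fun p => e * δ p - a * w p) (fun p => min (y p) θ) b V hV
      (fun p hp => ⟨le_min (hy p hp) (hV.trans hVθ), hyV p hp⟩) (by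
        intro u hu huV
        have h1 : (A.filter fun p => u < min (y p) θ) = A.filter fun p => u < y p := by
          apply Finset.filter_congr
          intro p _
          rw [lt_min_iff]
          exact ⟨fun h => h.1, fun h => ⟨h, huV.trans_le hVθ⟩⟩
        rw [h1, Finset.sum_sub_distrib, ← Finset.mul_sum, ← Finset.mul_sum]
        linarith [he u hu])
    have h2 : ∑ p ∈ A, (e * δ p - a * w p) * min (y p) θ
        = e * ∑ p ∈ A, δ p * min (y p) θ - a * ∑ p ∈ A, w p * min (y p) θ := by
      rw [Finset.mul_sum, Finset.mul_sum, ← Finset.sum_sub_distrib]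
      exact Finset.sum_congr rfl fun p _ => by ring
    rw [h2] at this
    linarith
  have h1 := key 1 fun u hu => by linarith [(abs_le.1 (h u hu)).2]
  have h2 := key (-1) fun u hu => by linarith [(abs_le.1 (h u hu)).1]
  rw [abs_le]
  constructor <;> linarith

/-- The geometry of a clustered instance on `S`: `γ` labels outliers by `none` and inliers by a
center of `Cs` at distance at most `ρ`; the cluster masses `B` are at least `4m`. -/
structure ClusterGeometry {d : ℕ} (z ρ N O : ℝ) (k : ℕ) (m : ℝ)
    (S Cs : Finset (EuclideanSpace ℝ (Fin d)))
    (γ : EuclideanSpace ℝ (Fin d) → Option (EuclideanSpace ℝ (Fin d)))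
    (B : EuclideanSpace ℝ (Fin d) → ℝ) : Prop where
  one_le_z : 1 ≤ z
  radius_nonneg : 0 ≤ ρ
  cost_nonneg : 0 ≤ O
  one_le_k : 1 ≤ k
  m_pos : 0 < m
  label_mem : ∀ p ∈ S, γ p ∈ Finset.insertNone Cs
  dist_le : ∀ p ∈ S, ∀ c, γ p = some c → dist p c ≤ ρ
  four_mul_le : ∀ c ∈ Cs, 4 * m ≤ B c
  sum_mass : ∑ c ∈ Cs, B c = N
  mass_ge : 4 * m * k ≤ N
  radius_rpow_mul_le : ρ ^ z * N ≤ 4 * k * O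

/-- A weight function has the prescribed mass on every labelled part. -/
structure HasMasses {d : ℕ} (m : ℝ) (S Cs : Finset (EuclideanSpace ℝ (Fin d)))
    (γ : EuclideanSpace ℝ (Fin d) → Option (EuclideanSpace ℝ (Fin d)))
    (B w : EuclideanSpace ℝ (Fin d) → ℝ) : Prop where
  nonneg : ∀ p ∈ S, 0 ≤ w p
  outliers : ∑ p ∈ S with γ p = none, w p = m
  clusters : ∀ c ∈ Cs, ∑ p ∈ S with γ p = some c, w p = B c

section Geometry

variable {d : ℕ} {z ρ N O : ℝ} {k : ℕ} {m : ℝ} {S Cs : Finset (EuclideanSpace ℝ (Fin d))}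
  {γ : EuclideanSpace ℝ (Fin d) → Option (EuclideanSpace ℝ (Fin d))}
  {B w w' : EuclideanSpace ℝ (Fin d) → ℝ}

theorem ClusterGeometry.sum_eq (h : ClusterGeometry z ρ N O k m S Cs γ B)
    (v : EuclideanSpace ℝ (Fin d) → ℝ) :
    ∑ p ∈ S, v p = ∑ p ∈ S with γ p = none, v p + ∑ c ∈ Cs, ∑ p ∈ S with γ p = some c, v p := by
  rw [← Finset.sum_fiberwise_of_maps_to h.label_mem, Finset.sum_insertNone]

theorem ClusterGeometry.sum_weights (h : ClusterGeometry z ρ N O k m S Cs γ B)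
    (hw : HasMasses m S Cs γ B w) : ∑ p ∈ S, w p - m = N := by
  rw [h.sum_eq w, hw.outliers, Finset.sum_congr rfl hw.clusters, h.sum_mass]
  ring

theorem ClusterGeometry.N_pos (h : ClusterGeometry z ρ N O k m S Cs γ B) : 0 < N := by
  have := h.mass_ge
  have h1 := h.m_pos
  have h2 : (1:ℝ) ≤ k := by exact_mod_cast h.one_le_k
  nlinarith

theorem ClusterGeometry.m_lt (h : ClusterGeometry z ρ N O k m S Cs γ B)
    (hw : HasMasses m S Cs γ B w) : m < ∑ p ∈ S, w p := by
  have := h.sum_weights hw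
  have := h.N_pos
  linarith

theorem ClusterGeometry.dual_le (h : ClusterGeometry z ρ N O k m S Cs γ B)
    (hw : HasMasses m S Cs γ B w) (C : Finset (EuclideanSpace ℝ (Fin d))) (θ : ℝ) :
    ∑ p ∈ S, w p * min (distC p C ^ z) θ - m * θ ≤ wrcostZ z N S w C := by
  rw [← h.sum_weights hw]
  exact dual_le_wrcostZ hw.nonneg h.m_pos.le (h.m_lt hw) C θ

theorem ClusterGeometry.mul_radius_rpow_le (h : ClusterGeometry z ρ N O k m S Cs γ B) :
    m * ρ ^ z ≤ O := by
  have h1 := h.radius_rpow_mul_le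
  have h2 := h.mass_ge
  have hk : (0:ℝ) < k := by exact_mod_cast h.one_le_k
  have h3 : 0 ≤ ρ ^ z := Real.rpow_nonneg h.radius_nonneg z
  have h4 : ρ ^ z * (4 * m * k) ≤ 4 * k * O := (mul_le_mul_of_nonneg_left h2 h3).trans h1
  have h5 : (4 * k) * (m * ρ ^ z) ≤ (4 * k) * O := by linarith
  exact le_of_mul_le_mul_left h5 (by positivity)

theorem abs_distC_sub_distC_le (p c : EuclideanSpace ℝ (Fin d))
    (C : Finset (EuclideanSpace ℝ (Fin d))) : |distC p C - distC c C| ≤ dist p c := by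
  have h1 : distC p C ≤ distC c C + dist p c := Metric.infDist_le_infDist_add_dist
  have h2 : distC c C ≤ distC p C + dist c p := Metric.infDist_le_infDist_add_dist
  rw [dist_comm] at h2
  rw [abs_le]
  constructor <;> linarith

/-- Near clusters: all their points have cost at most `3^z ρ^z`. -/
theorem ClusterGeometry.rpow_le_of_near (h : ClusterGeometry z ρ N O k m S Cs γ B)
    {C : Finset (EuclideanSpace ℝ (Fin d))} {p c : EuclideanSpace ℝ (Fin d)} (hp : p ∈ S)
    (hc : γ p = some c) (hD : distC c C < 2 * ρ) : distC p C ^ z ≤ 3 ^ z * ρ ^ z := by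
  have h1 := (abs_le.1 ((abs_distC_sub_distC_le p c C).trans (h.dist_le p hp c hc))).2
  have h0 : 0 ≤ distC p C := Metric.infDist_nonneg
  rw [← Real.mul_rpow (by norm_num) h.radius_nonneg]
  exact Real.rpow_le_rpow h0 (by linarith) (by linarith [h.one_le_z])

/-- Far clusters: the costs of any two of their points differ by a factor at most `3^z`. -/
theorem ClusterGeometry.rpow_le_of_far (h : ClusterGeometry z ρ N O k m S Cs γ B)
    {C : Finset (EuclideanSpace ℝ (Fin d))} {p p' c : EuclideanSpace ℝ (Fin d)} (hp : p ∈ S)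
    (hp' : p' ∈ S) (hc : γ p = some c) (hc' : γ p' = some c) (hD : 2 * ρ ≤ distC c C) :
    distC p C ^ z ≤ 3 ^ z * distC p' C ^ z := by
  have h1 := (abs_le.1 ((abs_distC_sub_distC_le p c C).trans (h.dist_le p hp c hc))).2
  have h2 := (abs_le.1 ((abs_distC_sub_distC_le p' c C).trans (h.dist_le p' hp' c hc'))).1
  have h0 : 0 ≤ distC p C := Metric.infDist_nonneg
  have h0' : 0 ≤ distC p' C := Metric.infDist_nonneg
  rw [← Real.mul_rpow (by norm_num) h0']
  exact Real.rpow_le_rpow h0 (by linarith) (by linarith [h.one_le_z])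

/-- The optimal truncation level is controlled by the robust costs. -/
theorem ClusterGeometry.mul_threshold_le (h : ClusterGeometry z ρ N O k m S Cs γ B)
    (hw : HasMasses m S Cs γ B w) {C : Finset (EuclideanSpace ℝ (Fin d))} {θ : ℝ} (hθ : 0 ≤ θ)
    (hmθ : m < ∑ p ∈ S with θ ≤ distC p C ^ z, w p) :
    m * θ ≤ 3 ^ z * (wrcostZ z N S w C + O) := by
  have h3 : (0:ℝ) < 3 ^ z := by positivity
  have hK : 0 ≤ wrcostZ z N S w C := wrcostZ_nonneg C
  have hO := h.cost_nonneg
  have hm := h.m_pos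
  obtain ⟨p, hp, hpθ, c, hc⟩ : ∃ p ∈ S, θ ≤ distC p C ^ z ∧ ∃ c, γ p = some c := by
    by_contra! hcon
    apply hmθ.not_ge
    rw [← hw.outliers]
    refine Finset.sum_le_sum_of_subset_of_nonneg (fun p hp => ?_) fun p hp _ =>
      hw.nonneg p (Finset.mem_filter.1 hp).1
    obtain ⟨hpS, hpt⟩ := Finset.mem_filter.1 hp
    exact Finset.mem_filter.2 ⟨hpS, Option.eq_none_iff_forall_ne_some.2 (hcon p hpS hpt)⟩
  rcases lt_or_ge (distC c C) (2 * ρ) with hD | hD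
  · have h1 := h.rpow_le_of_near hp hc hD
    have h2 := h.mul_radius_rpow_le
    calc m * θ ≤ m * (3 ^ z * ρ ^ z) := by gcongr; linarith
      _ = 3 ^ z * (m * ρ ^ z) := by ring
      _ ≤ 3 ^ z * (wrcostZ z N S w C + O) := by gcongr; linarith
  · have hcC : c ∈ Cs := by
      have := h.label_mem p hp
      rwa [hc, Finset.some_mem_insertNone] at this
    have hdual := h.dual_le hw C (θ / 3 ^ z)
    have hge : 4 * m * (θ / 3 ^ z) ≤ ∑ p ∈ S, w p * min (distC p C ^ z) (θ / 3 ^ z) := by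
      calc 4 * m * (θ / 3 ^ z) ≤ B c * (θ / 3 ^ z) := by gcongr; exact h.four_mul_le c hcC
        _ = ∑ p ∈ S with γ p = some c, w p * (θ / 3 ^ z) := by
            rw [← hw.clusters c hcC, Finset.sum_mul]
        _ = ∑ p ∈ S with γ p = some c, w p * min (distC p C ^ z) (θ / 3 ^ z) := by
            refine Finset.sum_congr rfl fun p' hp' => ?_
            obtain ⟨hp'S, hp'c⟩ := Finset.mem_filter.1 hp'
            have := h.rpow_le_of_far hp hp'S hc hp'c hD
            rw [min_eq_right]
            rw [div_le_iff₀ h3]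
            linarith
        _ ≤ _ := Finset.sum_le_sum_of_subset_of_nonneg (Finset.filter_subset _ _) fun p hp _ =>
            mul_nonneg (hw.nonneg p hp) (le_min (distC_rpow_nonneg p C) (by positivity))
    have h4 : 3 * (m * (θ / 3 ^ z)) ≤ wrcostZ z N S w C := by linarith
    have h5 : m * θ = 3 ^ z * (m * (θ / 3 ^ z)) := by field_simp
    rw [h5]
    gcongr
    have : 0 ≤ m * (θ / 3 ^ z) := by positivity
    linarith

end Geometry

section Deviation

variable {d : ℕ} {z ρ N O : ℝ} {k : ℕ} {m : ℝ} {S Cs : Finset (EuclideanSpace ℝ (Fin d))}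
  {γ : EuclideanSpace ℝ (Fin d) → Option (EuclideanSpace ℝ (Fin d))}
  {B w w' : EuclideanSpace ℝ (Fin d) → ℝ}

/-- Small deviation of `w' - w` on the superlevel sets of `y`, both on unions of parts (relative to
`w` and the average cluster mass) and on single parts. -/
structure SmallDeviation (a N : ℝ) (k : ℕ) (m : ℝ) (S Cs : Finset (EuclideanSpace ℝ (Fin d)))
    (γ : EuclideanSpace ℝ (Fin d) → Option (EuclideanSpace ℝ (Fin d)))
    (B w w' y : EuclideanSpace ℝ (Fin d) → ℝ) : Prop where
  union : ∀ U ⊆ Finset.insertNone Cs, ∀ u,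
    |∑ p ∈ S with γ p ∈ U ∧ u < y p, (w' p - w p)|
      ≤ a * ∑ p ∈ S with γ p ∈ U ∧ u < y p, w p + a * (N / k)
  part : ∀ i ∈ Finset.insertNone Cs, ∀ u,
    |∑ p ∈ S with γ p = i ∧ u < y p, (w' p - w p)| ≤ 2 * a * i.elim m B

theorem ClusterGeometry.abs_sum_near_le (h : ClusterGeometry z ρ N O k m S Cs γ B)
    (hw : HasMasses m S Cs γ B w) {C : Finset (EuclideanSpace ℝ (Fin d))} {a : ℝ} (ha : 0 ≤ a)
    {y : EuclideanSpace ℝ (Fin d) → ℝ} (hy0 : ∀ p ∈ S, 0 ≤ y p)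
    (hy2 : ∀ p ∈ S, y p ≤ 2 * distC p C ^ z)
    (hdev : SmallDeviation a N k m S Cs γ B w w' y) {θ : ℝ} (hθ : 0 ≤ θ)
    {U : Finset (Option (EuclideanSpace ℝ (Fin d)))} (hU : U ⊆ Finset.insertNone Cs)
    (hUnear : ∀ i ∈ U, ∃ c, i = some c ∧ distC c C < 2 * ρ) :
    |∑ p ∈ S with γ p ∈ U, (w' p - w p) * min (y p) θ|
      ≤ a * (2 * ∑ p ∈ S, w p * min (distC p C ^ z) θ + 8 * 3 ^ z * O) := by
  have h3 : (0:ℝ) < 3 ^ z := by positivity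
  have hρ : 0 ≤ ρ ^ z := Real.rpow_nonneg h.radius_nonneg z
  have hk : (0:ℝ) < k := by exact_mod_cast h.one_le_k
  have hN := h.N_pos
  have h1 := abs_sum_mul_min_le (S.filter fun p => γ p ∈ U) (fun p => w' p - w p) w y
    (a := a) (b := a * (N / k)) (V := min (2 * (3 ^ z * ρ ^ z)) θ) (θ := θ)
    (le_min (by positivity) hθ) (min_le_right _ _)
    (fun p hp => hy0 p (Finset.mem_filter.1 hp).1)
    (fun p hp => by
      obtain ⟨hpS, hpU⟩ := Finset.mem_filter.1 hp
      obtain ⟨c, hc, hD⟩ := hUnear _ hpU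
      have := h.rpow_le_of_near hpS hc hD
      exact min_le_min_right _ ((hy2 p hpS).trans (by linarith)))
    (fun u _ => by
      rw [Finset.filter_filter]
      exact hdev.union U hU u)
  refine h1.trans ?_
  rw [mul_add]
  apply add_le_add
  · gcongr
    rw [Finset.mul_sum]
    calc ∑ p ∈ S with γ p ∈ U, w p * min (y p) θ ≤ ∑ p ∈ S, w p * min (y p) θ :=
          Finset.sum_le_sum_of_subset_of_nonneg (Finset.filter_subset _ _) fun p hp _ =>
            mul_nonneg (hw.nonneg p hp) (le_min (hy0 p hp) hθ)
      _ ≤ _ := by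
          refine Finset.sum_le_sum fun p hp => ?_
          have := hw.nonneg p hp
          have hx : 0 ≤ distC p C ^ z := distC_rpow_nonneg p C
          have : min (y p) θ ≤ 2 * min (distC p C ^ z) θ := by
            rw [mul_min_of_nonneg _ _ (by norm_num)]
            exact min_le_min (hy2 p hp) (by linarith)
          nlinarith
  · have h4 := h.radius_rpow_mul_le
    calc a * (N / k) * min (2 * (3 ^ z * ρ ^ z)) θ ≤ a * (N / k) * (2 * (3 ^ z * ρ ^ z)) := by
          gcongr
          exact min_le_left _ _
      _ = a * (2 * 3 ^ z * ((ρ ^ z * N) / k)) := by ring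
      _ ≤ a * (2 * 3 ^ z * (4 * O)) := by
          gcongr
          rw [div_le_iff₀ hk]
          linarith
      _ = _ := by ring

theorem ClusterGeometry.abs_sum_far_le (h : ClusterGeometry z ρ N O k m S Cs γ B)
    (hw : HasMasses m S Cs γ B w) {C : Finset (EuclideanSpace ℝ (Fin d))} {a : ℝ} (ha : 0 ≤ a)
    {y : EuclideanSpace ℝ (Fin d) → ℝ} (hy0 : ∀ p ∈ S, 0 ≤ y p)
    (hy2 : ∀ p ∈ S, y p ≤ 2 * distC p C ^ z)
    (hdev : SmallDeviation a N k m S Cs γ B w w' y) {θ : ℝ} (hθ : 0 ≤ θ)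
    {c : EuclideanSpace ℝ (Fin d)} (hc : c ∈ Cs) (hD : 2 * ρ ≤ distC c C) :
    |∑ p ∈ S with γ p = some c, (w' p - w p) * min (y p) θ|
      ≤ a * (4 * 3 ^ z * ∑ p ∈ S with γ p = some c, w p * min (distC p C ^ z) θ) := by
  have h3 : (1:ℝ) ≤ 3 ^ z := Real.one_le_rpow (by norm_num) (by linarith [h.one_le_z])
  have hB : B c = ∑ p ∈ S with γ p = some c, w p := (hw.clusters c hc).symm
  have hBpos : 0 < B c := by linarith [h.four_mul_le c hc, h.m_pos]
  have hne : (S.filter fun p => γ p = some c).Nonempty := by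
    rw [Finset.nonempty_iff_ne_empty]
    intro he
    rw [he, Finset.sum_empty] at hB
    linarith
  obtain ⟨p₀, hp₀, hmin⟩ := Finset.exists_min_image _ (fun p => distC p C ^ z) hne
  obtain ⟨hp₀S, hp₀c⟩ := Finset.mem_filter.1 hp₀
  set X := distC p₀ C ^ z
  have hX : 0 ≤ X := distC_rpow_nonneg p₀ C
  have h1 := abs_sum_mul_min_le (S.filter fun p => γ p = some c) (fun p => w' p - w p)
    (fun _ => 0) y (a := 0) (b := 2 * a * B c) (V := min (2 * (3 ^ z * X)) θ) (θ := θ)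
    (le_min (by positivity) hθ) (min_le_right _ _)
    (fun p hp => hy0 p (Finset.mem_filter.1 hp).1)
    (fun p hp => by
      obtain ⟨hpS, hpc⟩ := Finset.mem_filter.1 hp
      have := h.rpow_le_of_far hpS hp₀S hpc hp₀c hD
      exact min_le_min_right _ ((hy2 p hpS).trans (by linarith)))
    (fun u _ => by
      rw [Finset.filter_filter, zero_mul, zero_add]
      exact hdev.part (some c) (Finset.some_mem_insertNone.2 hc) u)
  refine h1.trans ?_
  rw [zero_mul, zero_add]
  calc 2 * a * B c * min (2 * (3 ^ z * X)) θ ≤ 2 * a * B c * (2 * 3 ^ z * min X θ) := by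
        gcongr
        rw [mul_min_of_nonneg _ _ (by positivity)]
        exact min_le_min (by linarith) (by nlinarith)
    _ = a * (4 * 3 ^ z * (B c * min X θ)) := by ring
    _ ≤ _ := by
        gcongr
        rw [hB, Finset.sum_mul]
        refine Finset.sum_le_sum fun p hp => ?_
        have := hw.nonneg p (Finset.mem_filter.1 hp).1
        gcongr
        exact hmin p hp

theorem ClusterGeometry.abs_sum_outliers_le {a : ℝ} {y : EuclideanSpace ℝ (Fin d) → ℝ}
    (hy0 : ∀ p ∈ S, 0 ≤ y p) (hdev : SmallDeviation a N k m S Cs γ B w w' y) {θ : ℝ}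
    (hθ : 0 ≤ θ) :
    |∑ p ∈ S with γ p = none, (w' p - w p) * min (y p) θ| ≤ a * (2 * (m * θ)) := by
  have h1 := abs_sum_mul_min_le (S.filter fun p => γ p = none) (fun p => w' p - w p)
    (fun _ => 0) y (a := 0) (b := 2 * a * m) (V := θ) (θ := θ) hθ le_rfl
    (fun p hp => hy0 p (Finset.mem_filter.1 hp).1)
    (fun p _ => min_le_right _ _)
    (fun u _ => by
      rw [Finset.filter_filter, zero_mul, zero_add]
      exact hdev.part none (by simp) u)
  refine h1.trans (le_of_eq ?_)
  ring

/-- Small deviation on superlevel sets controls truncated costs. -/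
theorem ClusterGeometry.abs_sum_min_le (h : ClusterGeometry z ρ N O k m S Cs γ B)
    (hw : HasMasses m S Cs γ B w) (hw' : HasMasses m S Cs γ B w')
    {C : Finset (EuclideanSpace ℝ (Fin d))} {a : ℝ} (ha : 0 ≤ a) (ha1 : a ≤ 1)
    {y : EuclideanSpace ℝ (Fin d) → ℝ}
    (hy : ∀ p ∈ S, |y p - distC p C ^ z| ≤ a * distC p C ^ z)
    (hdev : SmallDeviation a N k m S Cs γ B w w' y) {θ : ℝ} (hθ : 0 ≤ θ) :
    |∑ p ∈ S, (w' p - w p) * min (distC p C ^ z) θ|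
      ≤ a * (8 * 3 ^ z * (∑ p ∈ S, w p * min (distC p C ^ z) θ
          + ∑ p ∈ S, w' p * min (distC p C ^ z) θ + O + m * θ)) := by
  have h3 : (3:ℝ) ≤ 3 ^ z := Real.self_le_rpow_of_one_le (by norm_num) h.one_le_z
  have hx : ∀ p, 0 ≤ distC p C ^ z := fun p => distC_rpow_nonneg p C
  have hy0 : ∀ p ∈ S, 0 ≤ y p := fun p hp => by
    nlinarith [(abs_le.1 (hy p hp)).1, hx p]
  have hy2 : ∀ p ∈ S, y p ≤ 2 * distC p C ^ z := fun p hp => by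
    nlinarith [(abs_le.1 (hy p hp)).2, hx p]
  have hTw : 0 ≤ ∑ p ∈ S, w p * min (distC p C ^ z) θ :=
    Finset.sum_nonneg fun p hp => mul_nonneg (hw.nonneg p hp) (le_min (hx p) hθ)
  have hTw' : 0 ≤ ∑ p ∈ S, w' p * min (distC p C ^ z) θ :=
    Finset.sum_nonneg fun p hp => mul_nonneg (hw'.nonneg p hp) (le_min (hx p) hθ)
  have hmθ : 0 ≤ m * θ := mul_nonneg h.m_pos.le hθ
  have hO := h.cost_nonneg
  set Tw := ∑ p ∈ S, w p * min (distC p C ^ z) θ with hTwdef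
  set Tw' := ∑ p ∈ S, w' p * min (distC p C ^ z) θ with hTwdef'
  have happrox : |∑ p ∈ S, (w' p - w p) * min (y p) θ
      - ∑ p ∈ S, (w' p - w p) * min (distC p C ^ z) θ| ≤ a * (Tw + Tw') := by
    rw [← Finset.sum_sub_distrib]
    refine (Finset.abs_sum_le_sum_abs _ _).trans ?_
    rw [hTwdef, hTwdef', ← Finset.sum_add_distrib, Finset.mul_sum]
    refine Finset.sum_le_sum fun p hp => ?_
    rw [← mul_sub, abs_mul]
    have e1 := abs_min_sub_min_le_mul hθ ha ha1 (hy p hp)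
    have e2 : |w' p - w p| ≤ w p + w' p := by
      rw [abs_le]
      constructor <;> linarith [hw.nonneg p hp, hw'.nonneg p hp]
    calc _ ≤ (w p + w' p) * (a * min (distC p C ^ z) θ) :=
          mul_le_mul e2 e1 (abs_nonneg _) ((abs_nonneg _).trans e2)
      _ = _ := by ring
  set U := (Finset.insertNone Cs).filter fun i => ∃ c, i = some c ∧ distC c C < 2 * ρ with hUdef
  have hnear := h.abs_sum_near_le hw ha hy0 hy2 hdev hθ (U := U) (Finset.filter_subset _ _)
    fun i hi => (Finset.mem_filter.1 hi).2
  have hrest : |∑ p ∈ S with γ p ∉ U, (w' p - w p) * min (y p) θ|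
      ≤ a * (4 * 3 ^ z * Tw + 2 * (m * θ)) := by
    have e1 : ∑ p ∈ S with γ p ∉ U, (w' p - w p) * min (y p) θ
        = ∑ i ∈ Finset.insertNone Cs,
          if i ∈ U then 0 else ∑ p ∈ S with γ p = i, (w' p - w p) * min (y p) θ := by
      rw [Finset.sum_filter, ← Finset.sum_fiberwise_of_maps_to h.label_mem]
      refine Finset.sum_congr rfl fun i _ => ?_
      split_ifs with hi
      · refine Finset.sum_eq_zero fun p hp => ?_
        rw [(Finset.mem_filter.1 hp).2, if_neg (not_not.2 hi)]
      · refine Finset.sum_congr rfl fun p hp => ?_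
        rw [(Finset.mem_filter.1 hp).2, if_pos hi]
    have e2 : ∀ i ∈ Finset.insertNone Cs,
        |if i ∈ U then 0 else ∑ p ∈ S with γ p = i, (w' p - w p) * min (y p) θ|
        ≤ i.elim (a * (2 * (m * θ))) fun c => a * (4 * 3 ^ z *
          ∑ p ∈ S with γ p = some c, w p * min (distC p C ^ z) θ) := by
      intro i hi
      rcases i with _ | c
      · have : (none : Option (EuclideanSpace ℝ (Fin d))) ∉ U := by simp [hUdef]
        rw [if_neg this]
        exact ClusterGeometry.abs_sum_outliers_le hy0 hdev hθ
      · have hc := Finset.some_mem_insertNone.1 hi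
        split_ifs with hcU
        · rw [abs_zero]
          have : 0 ≤ ∑ p ∈ S with γ p = some c, w p * min (distC p C ^ z) θ :=
            Finset.sum_nonneg fun p hp =>
              mul_nonneg (hw.nonneg p (Finset.mem_filter.1 hp).1) (le_min (hx p) hθ)
          simp only [Option.elim_some]
          positivity
        · refine h.abs_sum_far_le hw ha hy0 hy2 hdev hθ hc ?_
          by_contra hcon
          exact hcU (Finset.mem_filter.2 ⟨hi, c, rfl, not_le.1 hcon⟩)
    rw [e1]
    refine (Finset.abs_sum_le_sum_abs _ _).trans ((Finset.sum_le_sum e2).trans ?_)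
    rw [Finset.sum_insertNone]
    simp only [Option.elim_none, Option.elim_some]
    rw [← Finset.mul_sum, ← Finset.mul_sum]
    have e3 : ∑ c ∈ Cs, ∑ p ∈ S with γ p = some c, w p * min (distC p C ^ z) θ ≤ Tw := by
      rw [hTwdef, h.sum_eq]
      have : 0 ≤ ∑ p ∈ S with γ p = none, w p * min (distC p C ^ z) θ :=
        Finset.sum_nonneg fun p hp =>
          mul_nonneg (hw.nonneg p (Finset.mem_filter.1 hp).1) (le_min (hx p) hθ)
      linarith
    rw [← mul_add]
    gcongr a * ?_
    have : 4 * (3:ℝ) ^ z * ∑ c ∈ Cs, ∑ p ∈ S with γ p = some c, w p * min (distC p C ^ z) θ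
        ≤ 4 * 3 ^ z * Tw := by gcongr
    linarith
  have hsplit : ∑ p ∈ S, (w' p - w p) * min (y p) θ
      = ∑ p ∈ S with γ p ∈ U, (w' p - w p) * min (y p) θ
        + ∑ p ∈ S with γ p ∉ U, (w' p - w p) * min (y p) θ :=
    (Finset.sum_filter_add_sum_filter_not S _ _).symm
  have hfin : Tw + Tw' + (2 * Tw + 8 * 3 ^ z * O) + (4 * 3 ^ z * Tw + 2 * (m * θ))
      ≤ 8 * 3 ^ z * (Tw + Tw' + O + m * θ) := by nlinarith
  have hfin' := mul_le_mul_of_nonneg_left hfin ha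
  rw [abs_le] at happrox hnear hrest ⊢
  constructor <;> linarith

/-- Small deviation on superlevel sets controls the robust costs. -/
theorem ClusterGeometry.abs_wrcostZ_sub_le (h : ClusterGeometry z ρ N O k m S Cs γ B)
    (hw : HasMasses m S Cs γ B w) (hw' : HasMasses m S Cs γ B w')
    {C : Finset (EuclideanSpace ℝ (Fin d))} {a : ℝ} (ha : 0 ≤ a)
    (ha1 : a * (32 * 9 ^ z) ≤ 1 / 2)
    {y : EuclideanSpace ℝ (Fin d) → ℝ}
    (hy : ∀ p ∈ S, |y p - distC p C ^ z| ≤ a * distC p C ^ z)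
    (hdev : SmallDeviation a N k m S Cs γ B w w' y)
    (hO : O ≤ 2 * wrcostZ z N S w C) :
    |wrcostZ z N S w' C - wrcostZ z N S w C| ≤ a * (256 * 9 ^ z) * wrcostZ z N S w C := by
  have h3 : (3:ℝ) ≤ 3 ^ z := Real.self_le_rpow_of_one_le (by norm_num) h.one_le_z
  have h9 : (9:ℝ) ^ z = 3 ^ z * 3 ^ z := by
    rw [← Real.mul_rpow (by norm_num) (by norm_num)]; norm_num
  have hO0 := h.cost_nonneg
  have hK : 0 ≤ wrcostZ z N S w C := wrcostZ_nonneg C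
  have hK' : 0 ≤ wrcostZ z N S w' C := wrcostZ_nonneg C
  have ha2 : a ≤ 1 := by nlinarith
  have hdiff : ∀ θ : ℝ, ∑ p ∈ S, (w' p - w p) * min (distC p C ^ z) θ
      = ∑ p ∈ S, w' p * min (distC p C ^ z) θ - ∑ p ∈ S, w p * min (distC p C ^ z) θ := by
    intro θ
    rw [← Finset.sum_sub_distrib]
    exact Finset.sum_congr rfl fun p _ => by ring
  have hdual := h.dual_le hw C
  have hdual' := h.dual_le hw' C
  obtain ⟨θ, hθ, hmθ, hθK⟩ := exists_wrcostZ_eq_dual (z := z) hw.nonneg h.m_pos.le (h.m_lt hw) C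
  obtain ⟨θ', hθ', hmθ', hθK'⟩ :=
    exists_wrcostZ_eq_dual (z := z) hw'.nonneg h.m_pos.le (h.m_lt hw') C
  rw [h.sum_weights hw] at hθK
  rw [h.sum_weights hw'] at hθK'
  have hb := h.mul_threshold_le hw hθ hmθ
  have hb' := h.mul_threshold_le hw' hθ' hmθ'
  have hd := h.abs_sum_min_le hw hw' ha ha2 hy hdev hθ
  have hd' := h.abs_sum_min_le hw hw' ha ha2 hy hdev hθ'
  have hdθ := hdual θ
  have hdθ' := hdual θ'
  have hdθw := hdual' θ
  have hdθw' := hdual' θ'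
  rw [hdiff] at hd hd'
  set K := wrcostZ z N S w C
  set K' := wrcostZ z N S w' C
  set c : ℝ := 3 ^ z
  have key : ∀ T T' t : ℝ, T ≤ K + t → T' ≤ K' + t → t ≤ c * (K + K' + O) →
      a * (8 * c * (T + T' + O + t)) ≤ a * (32 * (c * c)) * (K + K' + O) := by
    intro T T' t h1 h2 h5
    have e1 : T + T' + O + t ≤ K + K' + O + 3 * (c * (K + K' + O)) := by linarith
    have e2 : K + K' + O ≤ c * (K + K' + O) := by nlinarith
    calc a * (8 * c * (T + T' + O + t)) ≤ a * (8 * c * (4 * (c * (K + K' + O)))) := by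
          gcongr; linarith
      _ = _ := by ring
  have e1 := key (t := m * θ) (T := ∑ p ∈ S, w p * min (distC p C ^ z) θ)
    (T' := ∑ p ∈ S, w' p * min (distC p C ^ z) θ) (by linarith) (by linarith [hdθw])
    (hb.trans (by gcongr; linarith))
  have e2 := key (t := m * θ') (T := ∑ p ∈ S, w p * min (distC p C ^ z) θ')
    (T' := ∑ p ∈ S, w' p * min (distC p C ^ z) θ') (by linarith [hdθ']) (by linarith)
    (hb'.trans (by gcongr; linarith))
  rw [← h9] at e1 e2
  set b := a * (32 * 9 ^ z) with hbdef
  have hb0 : 0 ≤ b := by positivity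
  have f1 : K' - K ≤ b * (K + K' + O) := by linarith [(abs_le.1 hd').2]
  have f2 : K - K' ≤ b * (K + K' + O) := by linarith [(abs_le.1 hd).1]
  have f3 : K' ≤ 5 * K := by nlinarith
  have f4 : b * (K + K' + O) ≤ b * (8 * K) := by gcongr; linarith
  have f5 : a * (256 * 9 ^ z) * K = b * (8 * K) := by rw [hbdef]; ring
  rw [f5, abs_le]
  constructor <;> linarith

end Deviation

/-- Pair merging with two-sided deviation bounds on a family of ranges `R ∩ γ⁻¹ U`. -/
theorem exists_merging_small_deviation {α ι : Type*} (γ : α → ι) (cap : ι → ℝ) (w : α → ℝ)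
    (𝓡 : Finset (Finset α)) (T : Finset (Finset ι × ℝ)) (A : Finset α)
    (hw : ∀ p ∈ A, 0 < w p ∧ w p ≤ cap (γ p)) {a : ℝ} (ha : 0 < a) (ha1 : 2 * a ≤ 1)
    (hT : ∀ x ∈ T, 0 < x.2 ∧ ∀ p ∈ A, γ p ∈ x.1 → cap (γ p) ≤ x.2) {L : ℝ}
    (hL : Real.log (𝓡.card * (T.card * 2)) ≤ L) :
    ∃ w' : α → ℝ, (∀ p ∈ A, 0 ≤ w' p ∧ w' p ≤ 2 * cap (γ p)) ∧
      (∀ ψ : ι → ℝ, ∑ p ∈ A, w' p * ψ (γ p) = ∑ p ∈ A, w p * ψ (γ p)) ∧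
      (∀ i, 2 * (A.filter fun p => γ p = i ∧ 0 < w' p).card
        ≤ (A.filter fun p => γ p = i).card + 1) ∧
      ∀ R ∈ 𝓡, ∀ x ∈ T, |∑ p ∈ A with p ∈ R ∧ γ p ∈ x.1, (w' p - w p)|
        ≤ a * ∑ p ∈ A with p ∈ R ∧ γ p ∈ x.1, w p + x.2 * L / a := by
  set sgn : Finset ℝ := {1, -1} with hsgn
  set F : Finset α × (Finset ι × ℝ) × ℝ → Finset α × ℝ :=
    fun x => (x.1.filter fun p => γ p ∈ x.2.1.1, x.2.2 * (a / x.2.1.2)) with hF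
  set J := (𝓡 ×ˢ T ×ˢ sgn).image F with hJ
  have hJcard : J.card ≤ 𝓡.card * (T.card * 2) := by
    refine Finset.card_image_le.trans ?_
    rw [Finset.card_product, Finset.card_product]
    gcongr
    exact Finset.card_le_two
  have habs : ∀ e ∈ sgn, |e| = 1 := by
    intro e he
    simp only [hsgn, Finset.mem_insert, Finset.mem_singleton] at he
    rcases he with rfl | rfl <;> simp
  obtain ⟨w', h1, h2, h3, h4⟩ := exists_pair_merging_deviation γ cap w J A hw (by
    intro j hj p hp hpj
    obtain ⟨⟨R, ⟨U, c⟩, e⟩, hx, rfl⟩ := Finset.mem_image.1 hj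
    rw [Finset.mem_product, Finset.mem_product] at hx
    obtain ⟨hc, hcap⟩ := hT _ hx.2.1
    have := hcap p hp (Finset.mem_filter.1 hpj).2
    have hc' : 0 < c := hc
    change |e * (a / c)| * _ ≤ 1
    rw [abs_mul, habs e hx.2.2, one_mul, abs_of_pos (by positivity)]
    calc a / c * (2 * cap (γ p)) ≤ a / c * (2 * c) := by gcongr
      _ = 2 * a := by field_simp
      _ ≤ 1 := ha1)
  refine ⟨w', h1, h2, h3, ?_⟩
  rintro R hR ⟨U, c⟩ hx
  obtain ⟨hc, hcap⟩ := hT _ hx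
  dsimp only at hc hcap ⊢
  have key : ∀ e ∈ sgn, e * ∑ p ∈ A with p ∈ R ∧ γ p ∈ U, (w' p - w p)
      ≤ a * ∑ p ∈ A with p ∈ R ∧ γ p ∈ U, w p + c * L / a := by
    intro e he
    have hj : F (R, (U, c), e) ∈ J := Finset.mem_image_of_mem _
      (Finset.mem_product.2 ⟨hR, Finset.mem_product.2 ⟨hx, he⟩⟩)
    have h5 := h4 _ hj
    have hlog : Real.log J.card ≤ L := by
      refine le_trans (Real.log_le_log ?_ ?_) hL
      · exact_mod_cast Finset.card_pos.2 ⟨_, hj⟩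
      · exact_mod_cast hJcard
    have hset : (A.filter fun p => p ∈ (F (R, (U, c), e)).1)
        = A.filter fun p => p ∈ R ∧ γ p ∈ U := by
      apply Finset.filter_congr
      intro p _
      simp [hF]
    rw [hset] at h5
    change e * (a / c) * _ ≤ (e * (a / c)) ^ 2 * _ + _ at h5
    have he2 : e ^ 2 = 1 := by rw [← sq_abs, habs e he]; norm_num
    have h6 : ∑ p ∈ A with p ∈ R ∧ γ p ∈ U, cap (γ p) * w p
        ≤ c * ∑ p ∈ A with p ∈ R ∧ γ p ∈ U, w p := by
      rw [Finset.mul_sum]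
      refine Finset.sum_le_sum fun p hp => ?_
      obtain ⟨hpA, -, hpU⟩ := Finset.mem_filter.1 hp
      exact mul_le_mul_of_nonneg_right (hcap p hpA hpU) (hw p hpA).1.le
    rw [mul_pow, he2, one_mul] at h5
    have h7 : (a / c) ^ 2 * ∑ p ∈ A with p ∈ R ∧ γ p ∈ U, cap (γ p) * w p
        ≤ (a / c) * (a * ∑ p ∈ A with p ∈ R ∧ γ p ∈ U, w p) := by
      calc _ ≤ (a / c) ^ 2 * (c * ∑ p ∈ A with p ∈ R ∧ γ p ∈ U, w p) := by gcongr
        _ = _ := by field_simp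
    have h8 : (a / c) * (c * L / a) = L := by field_simp
    have hac : 0 < a / c := by positivity
    refine le_of_mul_le_mul_left ?_ hac
    rw [mul_add, h8]
    linarith
  have k1 := key 1 (by simp [hsgn])
  have k2 := key (-1) (by simp [hsgn])
  rw [abs_le]
  constructor <;> linarith

theorem exists_lt_rpow_iff {z : ℝ} (hz : 0 < z) (u : ℝ) :
    ∃ t : ℝ, ∀ q : ℝ, 0 ≤ q → (u < q ^ z ↔ t < q) := by
  rcases lt_or_ge u 0 with hu | hu
  · refine ⟨-1, fun q hq => ⟨fun _ => by linarith, fun _ => ?_⟩⟩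
    exact hu.trans_le (Real.rpow_nonneg hq z)
  · refine ⟨u ^ z⁻¹, fun q hq => ?_⟩
    rw [Real.rpow_inv_lt_iff_of_pos hu hq hz]

/-- Rounding scales: part `i` of the instance is handled at scale `2 ^ a i`. -/
structure AdmissibleScales {d : ℕ} (s N : ℝ) (k : ℕ) (m : ℝ)
    (Cs : Finset (EuclideanSpace ℝ (Fin d))) (B : EuclideanSpace ℝ (Fin d) → ℝ)
    (a : Option (EuclideanSpace ℝ (Fin d)) → ℕ) : Prop where
  pos : 0 < s
  le_average : ∀ i ∈ Finset.insertNone Cs, a i ≠ 0 → 2 ^ a i * s ≤ N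
  le_mass : ∀ i ∈ Finset.insertNone Cs, a i ≠ 0 → 2 ^ a i * s ≤ k * i.elim m B

/-- The state of the iterated merging at level `τ`: a weighted set `(S, w)` with prescribed part
masses, bounded weights, few points per part, approximating the cost `K₁` up to a factor `1 ± e`. -/
structure MergingState {d : ℕ} (z N : ℝ) (k : ℕ) (m : ℝ)
    (Cs : Finset (EuclideanSpace ℝ (Fin d)))
    (γ : EuclideanSpace ℝ (Fin d) → Option (EuclideanSpace ℝ (Fin d)))
    (B : EuclideanSpace ℝ (Fin d) → ℝ) (a : Option (EuclideanSpace ℝ (Fin d)) → ℕ)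
    (K₁ : Finset (EuclideanSpace ℝ (Fin d)) → ℝ) (τ : ℕ) (e : ℝ)
    (S : Finset (EuclideanSpace ℝ (Fin d))) (w : EuclideanSpace ℝ (Fin d) → ℝ) : Prop where
  masses : HasMasses m S Cs γ B w
  pos : ∀ p ∈ S, 0 < w p
  le : ∀ p ∈ S, w p ≤ 2 ^ (a (γ p) - τ)
  card_le : ∀ i ∈ Finset.insertNone Cs,
    ((S.filter fun p => γ p = i).card : ℝ) ≤ i.elim m B / 2 ^ (a i - τ) + 1
  cost : ∀ C : Finset (EuclideanSpace ℝ (Fin d)), C.card = k →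
    |wrcostZ z N S w C - K₁ C| ≤ e * K₁ C

section Stage

variable {d : ℕ} {z ρ N O : ℝ} {k : ℕ} {m s : ℝ} {S Cs : Finset (EuclideanSpace ℝ (Fin d))}
  {γ : EuclideanSpace ℝ (Fin d) → Option (EuclideanSpace ℝ (Fin d))}
  {B w : EuclideanSpace ℝ (Fin d) → ℝ} {a : Option (EuclideanSpace ℝ (Fin d)) → ℕ}
  {K₁ : Finset (EuclideanSpace ℝ (Fin d)) → ℝ}

theorem ClusterGeometry.mono (h : ClusterGeometry z ρ N O k m S Cs γ B)
    {S' : Finset (EuclideanSpace ℝ (Fin d))} (hS : S' ⊆ S) :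
    ClusterGeometry z ρ N O k m S' Cs γ B :=
  { h with
    label_mem := fun p hp => h.label_mem p (hS hp)
    dist_le := fun p hp => h.dist_le p (hS hp) }

theorem ClusterGeometry.elim_pos (h : ClusterGeometry z ρ N O k m S Cs γ B)
    {i : Option (EuclideanSpace ℝ (Fin d))} (hi : i ∈ Finset.insertNone Cs) :
    0 < i.elim m B := by
  rcases i with _ | c
  · exact h.m_pos
  · have := h.four_mul_le c (Finset.some_mem_insertNone.1 hi)
    have := h.m_pos
    simp only [Option.elim_some]
    linarith

theorem HasMasses.sum_part (hw : HasMasses m S Cs γ B w)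
    {i : Option (EuclideanSpace ℝ (Fin d))} (hi : i ∈ Finset.insertNone Cs) :
    ∑ p ∈ S with γ p = i, w p = i.elim m B := by
  rcases i with _ | c
  · exact hw.outliers
  · exact hw.clusters c (Finset.some_mem_insertNone.1 hi)

theorem hasMasses_of_sum_part (h0 : ∀ p ∈ S, 0 ≤ w p)
    (h : ∀ i ∈ Finset.insertNone Cs, ∑ p ∈ S with γ p = i, w p = i.elim m B) :
    HasMasses m S Cs γ B w :=
  ⟨h0, h none (by simp), fun c hc => h (some c) (Finset.some_mem_insertNone.2 hc)⟩

/-- The merging step for the parts above level `τ`. -/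
theorem ClusterGeometry.exists_merged_weights (h : ClusterGeometry z ρ N O k m S Cs γ B)
    (hCs : Cs.card = k) {τ : ℕ} (ha : AdmissibleScales s N k m Cs B a)
    (hmass : HasMasses m S Cs γ B w) (hpos : ∀ p ∈ S, 0 < w p)
    (hle : ∀ p ∈ S, w p ≤ 2 ^ (a (γ p) - (τ + 1)))
    (hcard : ∀ i ∈ Finset.insertNone Cs,
      ((S.filter fun p => γ p = i).card : ℝ) ≤ i.elim m B / 2 ^ (a i - (τ + 1)) + 1)
    {δ : ℝ} (hδ : 0 < δ) (hδ1 : 2 * δ ≤ 1) (𝓡 : Finset (Finset (EuclideanSpace ℝ (Fin d))))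
    {L : ℝ} (hL0 : 0 ≤ L) (hL : Real.log 𝓡.card + (k + 3) * Real.log 2 ≤ L)
    (hreq : k * L ≤ δ ^ 2 * (2 ^ (τ + 1) * s)) :
    ∃ w' : EuclideanSpace ℝ (Fin d) → ℝ, HasMasses m S Cs γ B w' ∧
      (∀ p ∈ S, w' p ≤ 2 ^ (a (γ p) - τ)) ∧
      (∀ i ∈ Finset.insertNone Cs, ((S.filter fun p => γ p = i ∧ 0 < w' p).card : ℝ)
        ≤ i.elim m B / 2 ^ (a i - τ) + 1) ∧
      ∀ y : EuclideanSpace ℝ (Fin d) → ℝ, (∀ u, (S.filter fun p => u < y p) ∈ 𝓡) →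
        SmallDeviation δ N k m S Cs γ B w w' y := by
  have hk : (0:ℝ) < k := by exact_mod_cast h.one_le_k
  have hN := h.N_pos
  have hs := ha.pos
  set A := S.filter fun p => τ < a (γ p) with hA
  set cap : Option (EuclideanSpace ℝ (Fin d)) → ℝ := fun i => 2 ^ (a i - (τ + 1)) with hcap
  set M : ℝ := 2 ^ (τ + 1) * s with hM
  have hMpos : 0 < M := by positivity
  set T : Finset (Finset (Option (EuclideanSpace ℝ (Fin d))) × ℝ) :=
    (Finset.insertNone Cs).powerset.image (fun U => (U, N / M)) ∪
    (Finset.insertNone Cs).image (fun i => ({i}, k * i.elim m B / M)) with hT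
  have hcap2 : ∀ i, τ < a i → cap i * M = 2 ^ a i * s := by
    intro i hi
    rw [hcap, hM, ← mul_assoc, ← pow_add, Nat.sub_add_cancel hi]
  have hTprop : ∀ x ∈ T, 0 < x.2 ∧ ∀ p ∈ A, γ p ∈ x.1 → cap (γ p) ≤ x.2 := by
    intro x hx
    rcases Finset.mem_union.1 hx with hx | hx
    · obtain ⟨U, hU, rfl⟩ := Finset.mem_image.1 hx
      refine ⟨by positivity, fun p hp _ => ?_⟩
      obtain ⟨hpS, hpa⟩ := Finset.mem_filter.1 hp
      rw [le_div_iff₀ hMpos, hcap2 _ hpa]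
      exact ha.le_average _ (h.label_mem p hpS) (by omega)
    · obtain ⟨i, hi, rfl⟩ := Finset.mem_image.1 hx
      have := h.elim_pos hi
      refine ⟨by positivity, fun p hp hpi => ?_⟩
      obtain ⟨hpS, hpa⟩ := Finset.mem_filter.1 hp
      have hpi := Finset.mem_singleton.1 hpi
      rw [le_div_iff₀ hMpos, hcap2 _ hpa, ← hpi]
      exact ha.le_mass _ (h.label_mem p hpS) (by omega)
  have hTcard : T.card ≤ 2 ^ (k + 2) := by
    have h1 : T.card ≤ 2 ^ (k + 1) + (k + 1) := by
      refine (Finset.card_union_le _ _).trans ?_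
      refine add_le_add (Finset.card_image_le.trans ?_) (Finset.card_image_le.trans ?_)
      · rw [Finset.card_powerset, Finset.card_insertNone, hCs]
      · rw [Finset.card_insertNone, hCs]
    have h2 : k + 1 < 2 ^ (k + 1) := Nat.lt_two_pow_self
    rw [pow_succ 2 (k + 1)]
    omega
  have hlog : Real.log (𝓡.card * (T.card * 2)) ≤ L := by
    rcases Nat.eq_zero_or_pos 𝓡.card with h0 | h0
    · simpa [h0] using hL0
    have hT0 : 0 < T.card := Finset.card_pos.2
      ⟨_, Finset.mem_union_left _ (Finset.mem_image_of_mem _ (Finset.empty_mem_powerset _))⟩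
    have h1 : (0:ℝ) < 𝓡.card := by exact_mod_cast h0
    have h2 : (0:ℝ) < T.card := by exact_mod_cast hT0
    rw [Real.log_mul h1.ne' (by positivity)]
    refine le_trans ?_ hL
    gcongr
    have h3 : (T.card : ℝ) * 2 ≤ 2 ^ (k + 3) := by
      rw [pow_succ]
      gcongr
      exact_mod_cast hTcard
    calc Real.log (T.card * 2) ≤ Real.log (2 ^ (k + 3)) := by gcongr
      _ = _ := by rw [Real.log_pow]; push_cast; ring
  obtain ⟨w', h1, h2, h3, h4⟩ := exists_merging_small_deviation γ cap w 𝓡 T A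
    (fun p hp => ⟨hpos p (Finset.mem_filter.1 hp).1, hle p (Finset.mem_filter.1 hp).1⟩) hδ hδ1
    hTprop hlog
  set w'' : EuclideanSpace ℝ (Fin d) → ℝ := fun p => if p ∈ A then w' p else w p with hw''
  have hdiff : ∀ (Q : EuclideanSpace ℝ (Fin d) → Prop) [DecidablePred Q],
      ∑ p ∈ S with Q p, (w'' p - w p) = ∑ p ∈ A with Q p, (w' p - w p) := by
    intro Q _
    rw [hA, Finset.filter_filter, Finset.sum_filter, Finset.sum_filter]
    refine Finset.sum_congr rfl fun p hp => ?_
    by_cases hpA : p ∈ A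
    · have := (Finset.mem_filter.1 hpA).2
      simp [hw'', hpA, this]
    · have : ¬ τ < a (γ p) := fun hc => hpA (Finset.mem_filter.2 ⟨hp, hc⟩)
      simp [hw'', hpA, this]
  have hpart0 : ∀ i, ∑ p ∈ A with γ p = i, (w' p - w p) = 0 := by
    intro i
    have := h2 fun j => if j = i then 1 else 0
    simp only [mul_ite, mul_one, mul_zero] at this
    rw [← Finset.sum_filter, ← Finset.sum_filter] at this
    rw [Finset.sum_sub_distrib, this, sub_self]
  have hw0 : ∀ p ∈ S, 0 ≤ w'' p := by
    intro p hp
    by_cases hpA : p ∈ A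
    · simpa [hw'', hpA] using (h1 p hpA).1
    · simpa [hw'', hpA] using (hpos p hp).le
  have hrange : ∀ x ∈ T, ∀ y : EuclideanSpace ℝ (Fin d) → ℝ, ∀ u,
      (S.filter fun p => u < y p) ∈ 𝓡 →
      |∑ p ∈ S with γ p ∈ x.1 ∧ u < y p, (w'' p - w p)|
        ≤ δ * ∑ p ∈ S with γ p ∈ x.1 ∧ u < y p, w p + x.2 * L / δ := by
    intro x hx y u hR
    have hset : ∀ D : DecidablePred fun p => p ∈ S.filter (fun p => u < y p) ∧ γ p ∈ x.1,
        @Finset.filter _ _ D A = A.filter fun p => γ p ∈ x.1 ∧ u < y p := by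
      intro D
      ext p
      simp only [hA, Finset.mem_filter]
      tauto
    have := h4 _ hR x hx
    rw [hset] at this
    rw [hdiff]
    refine this.trans ?_
    gcongr
    · intro p hp _
      exact (hpos p (Finset.mem_filter.1 hp).1).le
    · exact Finset.filter_subset _ _
  have hLM : k * L ≤ δ * δ * M := by rw [← pow_two]; exact hreq
  refine ⟨w'', ?_, ?_, ?_, ?_⟩
  · refine hasMasses_of_sum_part hw0 fun i hi => ?_
    have := hdiff fun p => γ p = i
    rw [hpart0, Finset.sum_sub_distrib, hmass.sum_part hi] at this
    linarith
  · intro p hp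
    by_cases hpA : p ∈ A
    · have h5 := (h1 p hpA).2
      have h6 := (Finset.mem_filter.1 hpA).2
      have h7 : a (γ p) - τ = (a (γ p) - (τ + 1)) + 1 := by omega
      rw [h7, pow_succ]
      simp only [hw'', hpA, if_true]
      linarith
    · simp only [hw'', hpA, if_false]
      refine (hle p hp).trans (pow_le_pow_right₀ (by norm_num) (by omega))
  · intro i hi
    rcases lt_or_ge τ (a i) with hai | hai
    · have h5 : (S.filter fun p => γ p = i ∧ 0 < w'' p) = A.filter fun p => γ p = i ∧ 0 < w' p := by
        ext p
        simp only [Finset.mem_filter, hA, hw'']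
        constructor
        · rintro ⟨hpS, rfl, hp⟩
          simp only [hpS, hai, and_self, if_true] at hp
          exact ⟨⟨hpS, hai⟩, rfl, hp⟩
        · rintro ⟨⟨hpS, hpa⟩, rfl, hp⟩
          simp [hpS, hai, hp]
      have h6 : (A.filter fun p => γ p = i).card ≤ (S.filter fun p => γ p = i).card :=
        Finset.card_le_card (Finset.filter_subset_filter _ (Finset.filter_subset _ _))
      have h3i : 2 * (A.filter fun p => γ p = i ∧ 0 < w' p).card
          ≤ (A.filter fun p => γ p = i).card + 1 := by convert h3 i
      have h7 : (2 * (A.filter fun p => γ p = i ∧ 0 < w' p).card : ℝ)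
          ≤ (S.filter fun p => γ p = i).card + 1 := by exact_mod_cast h3i.trans (by omega)
      have h8 := hcard i hi
      have h9 : a i - τ = (a i - (τ + 1)) + 1 := by omega
      rw [h5, h9, pow_succ]
      have h10 : i.elim m B / (2 ^ (a i - (τ + 1)) * 2)
          = i.elim m B / 2 ^ (a i - (τ + 1)) / 2 := by rw [div_div]
      rw [h10]
      linarith
    · have h5 : (S.filter fun p => γ p = i ∧ 0 < w'' p).card
          ≤ (S.filter fun p => γ p = i).card := by
        refine Finset.card_le_card fun p hp => ?_
        simp only [Finset.mem_filter] at hp ⊢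
        exact ⟨hp.1, hp.2.1⟩
      have h6 := hcard i hi
      have h7 : a i - τ = a i - (τ + 1) := by omega
      rw [h7]
      have h8 : ((S.filter fun p => γ p = i ∧ 0 < w'' p).card : ℝ)
          ≤ (S.filter fun p => γ p = i).card := by exact_mod_cast h5
      linarith
  · intro y hy
    constructor
    · intro U hU u
      refine (hrange (U, N / M) ?_ y u (hy u)).trans ?_
      · exact Finset.mem_union_left _ (Finset.mem_image_of_mem _ (Finset.mem_powerset.2 hU))
      · gcongr
        dsimp only
        rw [div_mul_eq_mul_div, div_div, mul_div_assoc', div_le_div_iff₀ (by positivity) hk]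
        calc N * L * k = N * (k * L) := by ring
          _ ≤ N * (δ * δ * M) := by gcongr
          _ = _ := by ring
    · intro i hi u
      have hB := h.elim_pos hi
      have h5 := hrange ({i}, k * i.elim m B / M) (Finset.mem_union_right _
        (Finset.mem_image.2 ⟨i, hi, rfl⟩)) y u (hy u)
      simp only [Finset.mem_singleton] at h5
      refine h5.trans ?_
      have h6 : ∑ p ∈ S with γ p = i ∧ u < y p, w p ≤ i.elim m B := by
        rw [← hmass.sum_part hi]
        refine Finset.sum_le_sum_of_subset_of_nonneg (fun p hp => ?_) fun p hp _ =>
          (hpos p (Finset.mem_filter.1 hp).1).le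
        simp only [Finset.mem_filter] at hp ⊢
        exact ⟨hp.1, hp.2.1⟩
      have h7 : k * i.elim m B / M * L / δ ≤ δ * i.elim m B := by
        rw [div_mul_eq_mul_div, div_div, div_le_iff₀ (by positivity)]
        calc k * i.elim m B * L = i.elim m B * (k * L) := by ring
          _ ≤ i.elim m B * (δ * δ * M) := by gcongr
          _ = _ := by ring
      have h8 : δ * ∑ p ∈ S with γ p = i ∧ u < y p, w p ≤ δ * i.elim m B := by gcongr
      linarith

end Stage

section NextState

variable {d : ℕ} {z ρ N O : ℝ} {k : ℕ} {m s : ℝ} {S Cs : Finset (EuclideanSpace ℝ (Fin d))}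
  {γ : EuclideanSpace ℝ (Fin d) → Option (EuclideanSpace ℝ (Fin d))}
  {B w : EuclideanSpace ℝ (Fin d) → ℝ} {a : Option (EuclideanSpace ℝ (Fin d)) → ℕ}
  {K₁ : Finset (EuclideanSpace ℝ (Fin d)) → ℝ}

/-- Discarding points of weight zero. -/
theorem HasMasses.filter_pos (hw : HasMasses m S Cs γ B w) :
    HasMasses m (S.filter fun p => 0 < w p) Cs γ B w := by
  refine hasMasses_of_sum_part (fun p hp => (Finset.mem_filter.1 hp).2.le) fun i hi => ?_
  rw [← hw.sum_part hi]
  refine Finset.sum_subset (Finset.filter_subset_filter _ (Finset.filter_subset _ _))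
    fun p hp hn => ?_
  obtain ⟨hpS, hpi⟩ := Finset.mem_filter.1 hp
  refine le_antisymm (not_lt.1 fun hc => hn ?_) (hw.nonneg p hpS)
  exact Finset.mem_filter.2 ⟨Finset.mem_filter.2 ⟨hpS, hc⟩, hpi⟩

theorem ClusterGeometry.exists_next_state (h : ClusterGeometry z ρ N O k m S Cs γ B)
    (hd : 1 ≤ d) (hCs : Cs.card = k) (ha : AdmissibleScales s N k m Cs B a) {τ : ℕ} {e : ℝ}
    (st : MergingState z N k m Cs γ B a K₁ (τ + 1) e S w) (he : e ≤ 1 / 2)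
    (hO : ∀ C : Finset (EuclideanSpace ℝ (Fin d)), C.card = k → O ≤ K₁ C)
    {δ : ℝ} (hδ : 0 < δ) (hδ1 : δ * (32 * 9 ^ z) ≤ 1 / 2)
    (hreq : k * (k * (7 * min ((δ / (4 * (z + 2))) ^ 2)⁻¹ (d : ℝ) * Real.log (2 * S.card + 1))
      + (k + 3) * Real.log 2) ≤ δ ^ 2 * (2 ^ (τ + 1) * s)) :
    ∃ S' ⊆ S, ∃ w', MergingState z N k m Cs γ B a K₁ τ (e + 2 * (δ * (256 * 9 ^ z))) S' w' := by
  have hz := h.one_le_z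
  have h9 : (1:ℝ) ≤ 9 ^ z := Real.one_le_rpow (by norm_num) (by linarith)
  have hδ2 : 2 * δ ≤ 1 := by nlinarith
  have hz2 : 0 < 4 * (z + 2) := by linarith
  set η := δ / (4 * (z + 2)) with hη
  have hηpos : 0 < η := div_pos hδ hz2
  have hηz : (z + 2) * (4 * η) = δ := by rw [hη]; field_simp
  have hη1 : 4 * η ≤ 1 := by nlinarith
  have hS : S.Nonempty := by
    rw [Finset.nonempty_iff_ne_empty]
    rintro rfl
    have := h.m_lt st.masses
    rw [Finset.sum_empty] at this
    linarith [h.m_pos]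
  obtain ⟨𝓡, hlog, h𝓡⟩ := exists_center_ranges hd h.one_le_k S hS hηpos hη1
  have hlogS : 0 ≤ Real.log (2 * S.card + 1) := Real.log_nonneg (by
    have : (0:ℝ) ≤ S.card := Nat.cast_nonneg _
    linarith)
  have hlog2 : 0 ≤ Real.log 2 := Real.log_nonneg (by norm_num)
  obtain ⟨w', hm', hle', hcard', hdev⟩ := h.exists_merged_weights hCs ha st.masses st.pos st.le
    st.card_le hδ hδ2 𝓡 (by positivity) (by gcongr) hreq
  refine ⟨S.filter fun p => 0 < w' p, Finset.filter_subset _ _, w', ?_⟩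
  refine ⟨hm'.filter_pos, fun p hp => (Finset.mem_filter.1 hp).2,
    fun p hp => hle' p (Finset.mem_filter.1 hp).1, ?_, ?_⟩
  · intro i hi
    refine le_trans ?_ (hcard' i hi)
    rw [Finset.filter_filter]
    refine Nat.cast_le.2 (Finset.card_le_card fun p hp => ?_)
    simp only [Finset.mem_filter] at hp ⊢
    tauto
  · intro C hC
    have hN := h.sum_weights hm'
    have hS' : wrcostZ z N (S.filter fun p => 0 < w' p) w' C = wrcostZ z N S w' C := by
      have := wrcostZ_filter_pos (z := z) hm'.nonneg h.m_pos.le (h.m_lt hm') C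
      rwa [hN] at this
    rw [hS']
    obtain ⟨q, hq, hqR⟩ := h𝓡 C hC
    have hq0 : ∀ p ∈ S, 0 ≤ q p := fun p hp => by
      nlinarith [(abs_le.1 (hq p hp)).1, sq_nonneg (distC p C)]
    have hdev' := hdev (fun p => q p ^ (z / 2)) fun u => by
      obtain ⟨t, ht⟩ := exists_lt_rpow_iff (z := z / 2) (by linarith) u
      have : (S.filter fun p => u < q p ^ (z / 2)) = S.filter fun p => t < q p :=
        Finset.filter_congr fun p hp => ht _ (hq0 p hp)
      rw [this]
      exact hqR t
    have hy : ∀ p ∈ S, |q p ^ (z / 2) - distC p C ^ z| ≤ δ * distC p C ^ z := by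
      intro p hp
      rw [← hηz]
      exact abs_rpow_sub_rpow_le hz Metric.infDist_nonneg (by positivity)
        (by rw [hηz]; linarith) (hq p hp)
    have hcost := st.cost C hC
    have hOC := hO C hC
    have hO0 := h.cost_nonneg
    have hK1 : 0 ≤ K₁ C := hO0.trans hOC
    obtain ⟨c1, c2⟩ := abs_le.1 hcost
    have c3 : e * K₁ C ≤ 1 / 2 * K₁ C := by gcongr
    have hdiff := h.abs_wrcostZ_sub_le st.masses hm' hδ.le hδ1 hy hdev' (by linarith)
    have c4 : δ * (256 * 9 ^ z) * wrcostZ z N S w C ≤ δ * (256 * 9 ^ z) * (2 * K₁ C) := by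
      gcongr
      linarith
    obtain ⟨c5, c6⟩ := abs_le.1 hdiff
    rw [abs_le]
    constructor <;> linarith

end NextState

section Iteration

variable {d : ℕ} {z ρ N O : ℝ} {k : ℕ} {m s : ℝ} {S P Cs : Finset (EuclideanSpace ℝ (Fin d))}
  {γ : EuclideanSpace ℝ (Fin d) → Option (EuclideanSpace ℝ (Fin d))}
  {B w : EuclideanSpace ℝ (Fin d) → ℝ} {a : Option (EuclideanSpace ℝ (Fin d)) → ℕ}
  {K₁ : Finset (EuclideanSpace ℝ (Fin d)) → ℝ}

theorem exists_nat_log_scale (W : ℝ) : ∃ n : ℕ, (n ≠ 0 → 2 ^ n ≤ W) ∧ W ≤ 2 ^ (n + 1) := by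
  refine ⟨Nat.log 2 ⌊W⌋₊, fun h => ?_, ?_⟩
  · have h0 : ⌊W⌋₊ ≠ 0 := fun h0 => h (by rw [h0, Nat.log_zero_right])
    have h1 : ((2 ^ Nat.log 2 ⌊W⌋₊ : ℕ) : ℝ) ≤ ⌊W⌋₊ := Nat.cast_le.2 (Nat.pow_log_le_self 2 h0)
    push_cast at h1
    exact h1.trans (Nat.floor_le (Nat.pos_of_floor_pos (Nat.pos_of_ne_zero h0)).le)
  · have h1 : ⌊W⌋₊ + 1 ≤ 2 ^ (Nat.log 2 ⌊W⌋₊ + 1) := Nat.lt_pow_succ_log_self one_lt_two _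
    have h2 : ((⌊W⌋₊ + 1 : ℕ) : ℝ) ≤ ((2 ^ (Nat.log 2 ⌊W⌋₊ + 1) : ℕ) : ℝ) := Nat.cast_le.2 h1
    push_cast at h2
    exact (Nat.lt_floor_add_one W).le.trans h2

theorem exists_admissible_scales (hs : 0 < s) (N : ℝ) (k : ℕ) (m : ℝ)
    (Cs : Finset (EuclideanSpace ℝ (Fin d))) (B : EuclideanSpace ℝ (Fin d) → ℝ) :
    ∃ a : Option (EuclideanSpace ℝ (Fin d)) → ℕ, AdmissibleScales s N k m Cs B a ∧
      ∀ i, min N (k * i.elim m B) ≤ 2 ^ (a i + 1) * s := by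
  choose a ha1 ha2 using fun i : Option (EuclideanSpace ℝ (Fin d)) =>
    exists_nat_log_scale (min N (k * i.elim m B) / s)
  have h1 : ∀ i, a i ≠ 0 → 2 ^ a i * s ≤ min N (k * i.elim m B) := fun i hi =>
    (le_div_iff₀ hs).1 (ha1 i hi)
  exact ⟨a, ⟨hs, fun i _ hi => (h1 i hi).trans (min_le_left _ _),
    fun i _ hi => (h1 i hi).trans (min_le_right _ _)⟩, fun i => (div_le_iff₀ hs).1 (ha2 i)⟩

theorem ClusterGeometry.card_le (h : ClusterGeometry z ρ N O k m P Cs γ B) (hCs : Cs.card = k)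
    (hks : (k : ℝ) ≤ s) (ha : ∀ i, min N (k * i.elim m B) ≤ 2 ^ (a i + 1) * s) (hS : S ⊆ P)
    {τ : ℕ} {e : ℝ} (st : MergingState z N k m Cs γ B a K₁ τ e S w) :
    (S.card : ℝ) ≤ 10 * (2 ^ τ * s) := by
  have hk : (1:ℝ) ≤ k := by exact_mod_cast h.one_le_k
  have hN := h.N_pos
  have hs : 0 < s := by linarith
  have hpart : ∀ i ∈ Finset.insertNone Cs, ((S.filter fun p => γ p = i).card : ℝ)
      ≤ 2 ^ τ * (2 * s) * (i.elim m B / N + 1 / k) + 1 := by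
    intro i hi
    refine (st.card_le i hi).trans ?_
    have hB := h.elim_pos hi
    gcongr
    have hpow : (2:ℝ) ^ a i ≤ 2 ^ (a i - τ) * 2 ^ τ := by
      rw [← pow_add]
      exact pow_le_pow_right₀ one_le_two (by omega)
    have hmin : i.elim m B ≤ min N (k * i.elim m B) * (i.elim m B / N + 1 / k) := by
      rcases min_cases N (k * i.elim m B) with ⟨hm, -⟩ | ⟨hm, -⟩ <;> rw [hm]
      · have : N * (i.elim m B / N + 1 / k) = i.elim m B + N / k := by field_simp
        rw [this]
        have : 0 ≤ N / k := by positivity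
        linarith
      · have : k * i.elim m B * (i.elim m B / N + 1 / k)
            = i.elim m B + k * i.elim m B * (i.elim m B / N) := by field_simp; ring
        rw [this]
        have : 0 ≤ k * i.elim m B * (i.elim m B / N) := by positivity
        linarith
    rw [div_le_iff₀ (by positivity)]
    calc i.elim m B ≤ min N (k * i.elim m B) * (i.elim m B / N + 1 / k) := hmin
      _ ≤ (2 ^ (a i + 1) * s) * (i.elim m B / N + 1 / k) := by
        gcongr
        exact ha i
      _ = 2 ^ a i * (2 * s * (i.elim m B / N + 1 / k)) := by ring
      _ ≤ 2 ^ (a i - τ) * 2 ^ τ * (2 * s * (i.elim m B / N + 1 / k)) := by gcongr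
      _ = _ := by ring
  have hcard : (S.card : ℝ)
      = ∑ i ∈ Finset.insertNone Cs, ((S.filter fun p => γ p = i).card : ℝ) := by
    rw [Finset.card_eq_sum_card_fiberwise fun p hp => h.label_mem p (hS hp)]
    push_cast
    rfl
  have hsum : ∑ i ∈ Finset.insertNone Cs, i.elim m B = N + m := by
    rw [Finset.sum_insertNone]
    simp only [Option.elim_none, Option.elim_some]
    rw [h.sum_mass, add_comm]
  have hmN : m ≤ N := by nlinarith [h.mass_ge, h.m_pos]
  have h2 : (1:ℝ) ≤ 2 ^ τ := one_le_pow₀ one_le_two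
  calc (S.card : ℝ)
      ≤ ∑ i ∈ Finset.insertNone Cs, (2 ^ τ * (2 * s) * (i.elim m B / N + 1 / k) + 1) := by
        rw [hcard]
        exact Finset.sum_le_sum hpart
    _ = 2 ^ τ * (2 * s) * ((N + m) / N + (k + 1) / k) + (k + 1) := by
        rw [Finset.sum_add_distrib, ← Finset.mul_sum, Finset.sum_add_distrib, ← Finset.sum_div,
          hsum, Finset.sum_const, Finset.sum_const, Finset.card_insertNone, hCs]
        simp only [nsmul_eq_mul]
        push_cast
        ring
    _ ≤ 2 ^ τ * (2 * s) * (2 + 2) + 2 * (2 ^ τ * s) := by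
        have e1 : (N + m) / N ≤ 2 := by rw [div_le_iff₀ hN]; linarith
        have e2 : ((k : ℝ) + 1) / k ≤ 2 := by rw [div_le_iff₀ (by linarith)]; linarith
        have e3 : (k : ℝ) + 1 ≤ 2 * (2 ^ τ * s) := by nlinarith
        gcongr
    _ = 10 * (2 ^ τ * s) := by ring

theorem MergingState.mono {τ : ℕ} {e e' : ℝ} (st : MergingState z N k m Cs γ B a K₁ τ e S w)
    (he : e ≤ e') (hK : ∀ C : Finset (EuclideanSpace ℝ (Fin d)), C.card = k → 0 ≤ K₁ C) :
    MergingState z N k m Cs γ B a K₁ τ e' S w :=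
  { st with
    cost := fun C hC => (st.cost C hC).trans (mul_le_mul_of_nonneg_right he (hK C hC)) }

/-- Iterating the merging step down to level zero. -/
theorem ClusterGeometry.exists_final_state (h : ClusterGeometry z ρ N O k m P Cs γ B)
    (hd : 1 ≤ d) (hCs : Cs.card = k) (ha : AdmissibleScales s N k m Cs B a) (hks : (k : ℝ) ≤ s)
    (ha' : ∀ i, min N (k * i.elim m B) ≤ 2 ^ (a i + 1) * s)
    (hO : ∀ C : Finset (EuclideanSpace ℝ (Fin d)), C.card = k → O ≤ K₁ C)
    {δ E : ℕ → ℝ} (hδ : ∀ τ, 0 < δ τ) (hδ1 : ∀ τ, δ τ * (32 * 9 ^ z) ≤ 1 / 2)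
    (hE : ∀ τ, E τ ≤ 1 / 2) (hEδ : ∀ τ, E (τ + 1) + 2 * (δ τ * (256 * 9 ^ z)) ≤ E τ)
    (hreq : ∀ τ : ℕ, k * (k * (7 * min ((δ τ / (4 * (z + 2))) ^ 2)⁻¹ (d : ℝ)
      * Real.log (2 * (10 * (2 ^ (τ + 1) * s)) + 1))
      + (k + 3) * Real.log 2) ≤ δ τ ^ 2 * (2 ^ (τ + 1) * s))
    (τ : ℕ) : ∀ S ⊆ P, ∀ w, MergingState z N k m Cs γ B a K₁ τ (E τ) S w →
      ∃ S' ⊆ P, ∃ w', MergingState z N k m Cs γ B a K₁ 0 (E 0) S' w' := by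
  induction τ with
  | zero => exact fun S hS w st => ⟨S, hS, w, st⟩
  | succ τ ih =>
    intro S hS w st
    have hcard := h.card_le hCs hks ha' hS st
    obtain ⟨S', hS', w', st'⟩ := (h.mono hS).exists_next_state hd hCs ha st (hE _) hO (hδ τ)
      (hδ1 τ) (le_trans (by
        have : 0 ≤ min ((δ τ / (4 * (z + 2))) ^ 2)⁻¹ (d : ℝ) := by positivity
        gcongr) (hreq τ))
    exact ih S' (hS'.trans hS) w' (st'.mono (hEδ τ) fun C hC => h.cost_nonneg.trans (hO C hC))

end Iteration

section Parameters

theorem one_add_natCast_le_mul_pow (τ : ℕ) : (1 + τ : ℝ) ≤ 4 * (2 * (9 / 10) ^ 4) ^ τ := by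
  have h := one_add_mul_le_pow (a := (3 / 10 : ℝ)) (by norm_num) τ
  have h2 : (1 + 3 / 10 : ℝ) ^ τ ≤ (2 * (9 / 10) ^ 4) ^ τ := by gcongr; norm_num
  have h3 : (0:ℝ) ≤ τ := Nat.cast_nonneg _
  linarith

theorem log_twenty_mul_add_one_le {s : ℝ} (hs : 1 ≤ s) (τ : ℕ) :
    Real.log (2 * (10 * (2 ^ (τ + 1) * s)) + 1) ≤ 6 * ((1 + τ) * (1 + Real.log s)) := by
  have h2 : (1:ℝ) ≤ 2 ^ τ := one_le_pow₀ one_le_two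
  have hs2 : 1 ≤ 2 ^ τ * s := by nlinarith
  have hlog2 : Real.log 2 ≤ 1 := by
    have := Real.log_le_sub_one_of_pos (x := 2) (by norm_num)
    linarith
  have hlogs : 0 ≤ Real.log s := Real.log_nonneg hs
  have hτ : (0:ℝ) ≤ τ := Nat.cast_nonneg _
  calc Real.log (2 * (10 * (2 ^ (τ + 1) * s)) + 1) ≤ Real.log (2 ^ (6 + τ) * s) := by
        apply Real.log_le_log (by positivity)
        rw [pow_succ, pow_add]
        linarith
    _ = (6 + τ) * Real.log 2 + Real.log s := by
        rw [Real.log_mul (by positivity) (by positivity), Real.log_pow]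
        push_cast
        ring
    _ ≤ (6 + τ) * 1 + Real.log s := by gcongr
    _ ≤ _ := by nlinarith [mul_nonneg hτ hlogs]

/-- The size requirement of every level follows from a single self-referential bound on `s`. -/
theorem level_requirement {c Λ ε D s : ℝ} {k : ℕ} (hc : 0 < c) (hΛ : 1 ≤ Λ) (hε : 0 < ε)
    (hε1 : ε < 1) (hD : 1 ≤ D) (hk : 1 ≤ k) (hs : 1 ≤ s)
    (hsize : 92 * Λ / c ^ 2 * (k ^ 2 * (ε ^ 2)⁻¹ * min (ε ^ 2)⁻¹ D) * (1 + Real.log s) ≤ s)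
    (τ : ℕ) {q : ℝ} (hq : q ≤ Λ * (((9 / 10 : ℝ) ^ τ) ^ 2)⁻¹ * min (ε ^ 2)⁻¹ D) :
    k * (k * (7 * q * Real.log (2 * (10 * (2 ^ (τ + 1) * s)) + 1)) + (k + 3) * Real.log 2)
      ≤ (c * ε * (9 / 10) ^ τ) ^ 2 * (2 ^ (τ + 1) * s) := by
  have hk1 : (1:ℝ) ≤ k := by exact_mod_cast hk
  have hlogs : 0 ≤ Real.log s := Real.log_nonneg hs
  have hlog2 : Real.log 2 ≤ 1 := by
    have := Real.log_le_sub_one_of_pos (x := 2) (by norm_num)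
    linarith
  have hτ : (0:ℝ) ≤ τ := Nat.cast_nonneg _
  set b : ℝ := (9 / 10) ^ τ with hb
  have hb0 : 0 < b := by positivity
  have hb1 : b ≤ 1 := pow_le_one₀ (by norm_num) (by norm_num)
  have hbi : 1 ≤ (b ^ 2)⁻¹ := (one_le_inv₀ (by positivity)).2 (pow_le_one₀ hb0.le hb1)
  set M := min (ε ^ 2)⁻¹ D with hM
  have hM1 : 1 ≤ M := le_min ((one_le_inv₀ (by positivity)).2 (pow_le_one₀ hε.le hε1.le)) hD
  set l := (1 + τ) * (1 + Real.log s) with hl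
  have hl1 : 1 ≤ l := by rw [hl]; nlinarith [mul_nonneg hτ hlogs]
  have hΛb : 1 ≤ Λ * (b ^ 2)⁻¹ := one_le_mul_of_one_le_of_one_le hΛ hbi
  have hX : 1 ≤ Λ * (b ^ 2)⁻¹ * M := one_le_mul_of_one_le_of_one_le hΛb hM1
  have hXl : 1 ≤ Λ * (b ^ 2)⁻¹ * M * l := one_le_mul_of_one_le_of_one_le hX hl1
  have hlogarg : 0 ≤ Real.log (2 * (10 * (2 ^ (τ + 1) * s)) + 1) := Real.log_nonneg (by
    have : (0:ℝ) ≤ 2 * (10 * (2 ^ (τ + 1) * s)) := by positivity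
    linarith)
  have hpow := one_add_natCast_le_mul_pow τ
  have hpow' : (2 * (9 / 10 : ℝ) ^ 4) ^ τ = 2 ^ τ * b ^ 4 := by
    rw [mul_pow, hb, ← pow_mul, ← pow_mul, mul_comm 4 τ]
  rw [hpow'] at hpow
  calc k * (k * (7 * q * Real.log (2 * (10 * (2 ^ (τ + 1) * s)) + 1)) + (k + 3) * Real.log 2)
      ≤ k * (k * (7 * (Λ * (b ^ 2)⁻¹ * M) * (6 * l)) + (k + 3 * k) * 1) := by
        have h6 := log_twenty_mul_add_one_le hs τ
        gcongr
        linarith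
    _ = k ^ 2 * (42 * (Λ * (b ^ 2)⁻¹ * M * l) + 4) := by ring
    _ ≤ k ^ 2 * (46 * (Λ * (b ^ 2)⁻¹ * M * l)) := by gcongr; linarith
    _ = 46 * k ^ 2 * Λ * (b ^ 2)⁻¹ * M * (1 + Real.log s) * (1 + τ) := by rw [hl]; ring
    _ ≤ 46 * k ^ 2 * Λ * (b ^ 2)⁻¹ * M * (1 + Real.log s) * (4 * (2 ^ τ * b ^ 4)) := by
        gcongr
    _ = (c * ε * b) ^ 2 * 2 ^ (τ + 1)
          * (92 * Λ / c ^ 2 * (k ^ 2 * (ε ^ 2)⁻¹ * M) * (1 + Real.log s)) := by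
        field_simp
        ring
    _ ≤ (c * ε * b) ^ 2 * 2 ^ (τ + 1) * s := by gcongr
    _ = _ := by ring

/-- A solution of the self-referential size bound. -/
theorem self_referential_bound {A Q x : ℝ} (hA : 1 ≤ A) (hQ : 1 ≤ Q) (hx : 1 ≤ x)
    (hQx : Q ≤ x ^ 4) :
    A * Q * (1 + Real.log ((7 * A) ^ 2 * Q * (1 + Real.log x)))
      ≤ (7 * A) ^ 2 * Q * (1 + Real.log x) := by
  have hl : 0 ≤ Real.log x := Real.log_nonneg hx
  have h1 : Real.log Q ≤ 4 * Real.log x := by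
    have := Real.log_le_log (by linarith) hQx
    rwa [Real.log_pow] at this
  have h2 : Real.log (1 + Real.log x) ≤ Real.log x := by
    have := Real.log_le_sub_one_of_pos (x := 1 + Real.log x) (by linarith)
    linarith
  have h3 : Real.log (7 * A) ≤ 7 * A := by
    have := Real.log_le_sub_one_of_pos (x := 7 * A) (by linarith)
    linarith
  have h4 : Real.log ((7 * A) ^ 2 * Q * (1 + Real.log x))
      = 2 * Real.log (7 * A) + Real.log Q + Real.log (1 + Real.log x) := by
    rw [Real.log_mul (by positivity) (by positivity), Real.log_mul (by positivity) (by positivity),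
      Real.log_pow]
    push_cast
    ring
  rw [h4]
  calc A * Q * (1 + (2 * Real.log (7 * A) + Real.log Q + Real.log (1 + Real.log x)))
      ≤ A * Q * (49 * A * (1 + Real.log x)) := by
        gcongr
        nlinarith [mul_nonneg (sub_nonneg.2 hA) hl]
    _ = _ := by ring

end Parameters

section Coreset

variable {d : ℕ} {z ρ N O : ℝ} {k : ℕ} {m : ℝ} {P Cs : Finset (EuclideanSpace ℝ (Fin d))}
  {γ : EuclideanSpace ℝ (Fin d) → Option (EuclideanSpace ℝ (Fin d))}
  {B : EuclideanSpace ℝ (Fin d) → ℝ}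

/-- The accuracy of the merging step at level zero, relative to `ε`. -/
noncomputable def stepAccuracy (z : ℝ) : ℝ := 1 / (40 * (256 * 9 ^ z))

/-- The overhead of the range-counting bound caused by `stepAccuracy`. -/
noncomputable def rangeOverhead (z : ℝ) : ℝ := (4 * (z + 2) / stepAccuracy z) ^ 2

/-- The constant of the self-referential size bound. -/
noncomputable def sizeConstant (z : ℝ) : ℝ := 92 * rangeOverhead z / stepAccuracy z ^ 2

theorem stepAccuracy_pos (z : ℝ) : 0 < stepAccuracy z := by
  unfold stepAccuracy
  positivity

theorem stepAccuracy_mul (z : ℝ) : stepAccuracy z * (256 * 9 ^ z) = 1 / 40 := by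
  have : (0:ℝ) < 9 ^ z := by positivity
  unfold stepAccuracy
  field_simp

theorem stepAccuracy_le_one {z : ℝ} (hz : 1 ≤ z) : stepAccuracy z ≤ 1 := by
  have h9 : (1:ℝ) ≤ 9 ^ z := Real.one_le_rpow (by norm_num) (by linarith)
  nlinarith [stepAccuracy_mul z, stepAccuracy_pos z]

theorem one_le_rangeOverhead {z : ℝ} (hz : 1 ≤ z) : 1 ≤ rangeOverhead z := by
  refine one_le_pow₀ ((one_le_div₀ (stepAccuracy_pos z)).2 ?_)
  linarith [stepAccuracy_le_one hz]

theorem one_le_sizeConstant {z : ℝ} (hz : 1 ≤ z) : 1 ≤ sizeConstant z := by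
  have h := stepAccuracy_pos z
  refine (one_le_div₀ (by positivity)).2 ?_
  linarith [one_le_rangeOverhead hz, pow_le_one₀ h.le (stepAccuracy_le_one hz) (n := 2)]

theorem ClusterGeometry.exists_coreset (h : ClusterGeometry z ρ N O k m P Cs γ B) (hd : 1 ≤ d)
    (hCs : Cs.card = k) (hP : HasMasses m P Cs γ B fun _ => 1)
    (hO : ∀ C : Finset (EuclideanSpace ℝ (Fin d)), C.card = k → O ≤ wrcostZ z N P (fun _ => 1) C)
    {ε : ℝ} (hε : 0 < ε) (hε1 : ε < 1) :
    ∃ S ⊆ P, ∃ w, HasMasses m S Cs γ B w ∧ (∀ p ∈ S, 0 < w p) ∧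
      (∀ C : Finset (EuclideanSpace ℝ (Fin d)), C.card = k →
        |wrcostZ z N S w C - wrcostZ z N P (fun _ => 1) C| ≤ ε * wrcostZ z N P (fun _ => 1) C) ∧
      (S.card : ℝ) ≤ 10 * ((7 * sizeConstant z) ^ 2 * (k ^ 2 * (ε ^ 2)⁻¹ * min (ε ^ 2)⁻¹ d)
        * (1 + Real.log (k / ε))) := by
  have hz := h.one_le_z
  have hk : (1:ℝ) ≤ k := by exact_mod_cast h.one_le_k
  have hd1 : (1:ℝ) ≤ d := by exact_mod_cast hd
  have hcpos := stepAccuracy_pos z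
  have hcmul := stepAccuracy_mul z
  have hΛ := one_le_rangeOverhead hz
  have hA := one_le_sizeConstant hz
  set c := stepAccuracy z with hc
  set A := sizeConstant z with hAdef
  have h9 : (1:ℝ) ≤ 9 ^ z := Real.one_le_rpow (by norm_num) (by linarith)
  have hε2 : 1 ≤ (ε ^ 2)⁻¹ := (one_le_inv₀ (by positivity)).2 (pow_le_one₀ hε.le hε1.le)
  set M := min (ε ^ 2)⁻¹ (d : ℝ) with hM
  have hM1 : 1 ≤ M := le_min hε2 hd1
  set Q := (k : ℝ) ^ 2 * (ε ^ 2)⁻¹ * M with hQ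
  have hk2 : (k : ℝ) ≤ k ^ 2 := by nlinarith
  have hkQ : (k : ℝ) ≤ Q := by
    have h1 : 1 ≤ (ε ^ 2)⁻¹ * M := one_le_mul_of_one_le_of_one_le hε2 hM1
    rw [hQ, mul_assoc]
    nlinarith
  set x := (k : ℝ) / ε with hx
  have hx1 : 1 ≤ x := (one_le_div₀ hε).2 (by linarith)
  have hlx : 0 ≤ Real.log x := Real.log_nonneg hx1
  have hQx : Q ≤ x ^ 4 := by
    have e1 : x ^ 4 = k ^ 4 * ((ε ^ 2)⁻¹ * (ε ^ 2)⁻¹) := by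
      rw [hx]
      field_simp
    have e2 : (k : ℝ) ^ 2 ≤ k ^ 4 := pow_le_pow_right₀ hk (by norm_num)
    rw [e1, hQ, mul_assoc]
    gcongr
    exact min_le_left _ _
  set s := (7 * A) ^ 2 * Q * (1 + Real.log x) with hs
  have hQs : Q ≤ s := by
    have h1 : 1 ≤ (7 * A) ^ 2 := one_le_pow₀ (by linarith)
    have h2 : 1 ≤ (7 * A) ^ 2 * (1 + Real.log x) :=
      one_le_mul_of_one_le_of_one_le h1 (by linarith)
    rw [hs]
    nlinarith
  have hks : (k : ℝ) ≤ s := hkQ.trans hQs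
  have hs1 : 1 ≤ s := hk.trans hks
  have hsize : A * Q * (1 + Real.log s) ≤ s :=
    self_referential_bound hA (hk.trans hkQ) hx1 hQx
  obtain ⟨a, ha, ha'⟩ := exists_admissible_scales (s := s) (by linarith) N k m Cs B
  have hβ0 : ∀ τ : ℕ, (0:ℝ) < (9 / 10) ^ τ := fun τ => by positivity
  have hβ1 : ∀ τ : ℕ, (9 / 10 : ℝ) ^ τ ≤ 1 := fun τ => pow_le_one₀ (by norm_num) (by norm_num)
  have hεβ : ∀ τ : ℕ, ε * (9 / 10) ^ τ ≤ 1 := fun τ =>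
    mul_le_one₀ hε1.le (hβ0 τ).le (hβ1 τ)
  have hεβ0 : ∀ τ : ℕ, 0 < ε * (9 / 10) ^ τ := fun τ => mul_pos hε (hβ0 τ)
  have hK : ∀ C : Finset (EuclideanSpace ℝ (Fin d)), C.card = k →
      0 ≤ wrcostZ z N P (fun _ => 1) C := fun C hC => h.cost_nonneg.trans (hO C hC)
  have hstart : MergingState z N k m Cs γ B a (wrcostZ z N P fun _ => 1)
      ((Finset.insertNone Cs).sup a) (ε * (9 / 10) ^ ((Finset.insertNone Cs).sup a) / 2) P
      (fun _ => 1) := by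
    refine ⟨hP, fun _ _ => one_pos, fun _ _ => one_le_pow₀ one_le_two, fun i hi => ?_,
      fun C hC => ?_⟩
    · have h1 := hP.sum_part hi
      rw [Finset.sum_const, nsmul_eq_mul, mul_one] at h1
      rw [h1, Nat.sub_eq_zero_of_le (Finset.le_sup hi), pow_zero, div_one]
      linarith
    · rw [sub_self, abs_zero]
      exact mul_nonneg (half_pos (hεβ0 _)).le (hK C hC)
  obtain ⟨S, hS, w, st⟩ := h.exists_final_state (δ := fun τ => c * ε * (9 / 10) ^ τ)
    (E := fun τ => ε * (9 / 10) ^ τ / 2) hd hCs ha hks ha' hO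
    (fun τ => mul_pos (mul_pos hcpos hε) (hβ0 τ))
    (fun τ => by nlinarith [hεβ τ, hεβ0 τ])
    (fun τ => by linarith [hεβ τ])
    (fun τ => by
      have : c * ε * (9 / 10) ^ τ * (256 * 9 ^ z) = 1 / 40 * (ε * (9 / 10) ^ τ) := by
        rw [← hcmul]
        ring
      rw [this, pow_succ]
      linarith)
    (fun τ => level_requirement hcpos hΛ hε hε1 hd1 h.one_le_k hs1 hsize τ (by
      have e1 : ((c * ε * (9 / 10) ^ τ / (4 * (z + 2))) ^ 2)⁻¹
          = rangeOverhead z * (((9 / 10 : ℝ) ^ τ) ^ 2)⁻¹ * (ε ^ 2)⁻¹ := by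
        have := hβ0 τ
        have : 0 < z + 2 := by linarith
        rw [rangeOverhead, ← hc]
        field_simp
      have e2 : 1 ≤ rangeOverhead z * (((9 / 10 : ℝ) ^ τ) ^ 2)⁻¹ :=
        one_le_mul_of_one_le_of_one_le hΛ
          ((one_le_inv₀ (by have := hβ0 τ; positivity)).2 (pow_le_one₀ (hβ0 τ).le (hβ1 τ)))
      rw [e1, mul_min_of_nonneg _ _ (by linarith)]
      exact min_le_min le_rfl (by nlinarith)))
    _ P subset_rfl _ hstart
  refine ⟨S, hS, w, st.masses, st.pos, fun C hC => (st.cost C hC).trans ?_, ?_⟩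
  · have := hK C hC
    gcongr
    simp only [pow_zero]
    linarith
  · have := h.card_le hCs hks ha' hS st
    rwa [pow_zero, one_mul] at this

end Coreset

/-- **Coreset for robust `(k,z)`-clustering under the data assumptions.**
For every `z ≥ 1` there is a constant `C_z > 0` such that: whenever `P` is a set
of `n` points in `ℝ^d`, `ε ∈ (0,1)`, and there are an optimal `k`-point center
set `Cs`, an `m`-subset `Ls ⊆ P` of outliers attaining the optimal cost with
inlier set `P ∖ Ls`, and a nearest-center assignment `f` of the inliers such
that (i) each inlier cluster has at least `4m` points and (ii) the maximal
`z`-th power inlier distance is at most `4k` times the average, then `P` admits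
an `ε`-coreset for robust `(k,z)`-clustering with `m` outliers of size at most
`C_z · k² · ε^{-2z} · min(ε^{-2}, d) · (1 + log(k/ε))^{C_z}`. -/
theorem robust_kz_clustering_coreset :
    ∀ z : ℝ, 1 ≤ z →
    ∃ Cz : ℝ, 0 < Cz ∧
      ∀ (n m k d : ℕ) (ε : ℝ) (P : Finset (EuclideanSpace ℝ (Fin d)))
        (Cs Ls : Finset (EuclideanSpace ℝ (Fin d)))
        (f : EuclideanSpace ℝ (Fin d) → EuclideanSpace ℝ (Fin d)),
        1 ≤ n → 1 ≤ m → 1 ≤ k → 1 ≤ d → m < n → 0 < ε → ε < 1 → P.card = n →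
        -- `Cs` is an optimal center set of size `k`
        Cs.card = k →
        (∀ C : Finset (EuclideanSpace ℝ (Fin d)), C.card = k →
          rcostZ z m P Cs ≤ rcostZ z m P C) →
        -- `Ls` is an outlier set attaining `cost_z^(m)(P, Cs)`
        Ls ⊆ P → Ls.card = m →
        (∑ p ∈ P \ Ls, distC p Cs ^ z) = rcostZ z m P Cs →
        -- `f` assigns each inlier to a nearest center in `Cs`
        (∀ p ∈ P \ Ls, f p ∈ Cs ∧ dist p (f p) = distC p Cs) →
        -- (i) every inlier cluster has at least 4m points
        (∀ c ∈ Cs, 4 * m ≤ ((P \ Ls).filter (fun p => f p = c)).card) →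
        -- (ii) no remote inliers
        (∀ p ∈ P \ Ls,
          distC p Cs ^ z ≤ 4 * k * (∑ q ∈ P \ Ls, distC q Cs ^ z) / ((n : ℝ) - m)) →
        -- conclusion: existence of an ε-coreset of the claimed size
        ∃ (S : Finset (EuclideanSpace ℝ (Fin d))) (w : EuclideanSpace ℝ (Fin d) → ℝ),
          S ⊆ P ∧
          (∀ p ∈ S, 0 < w p) ∧
          (∑ p ∈ S, w p) = (n : ℝ) ∧
          (∀ C : Finset (EuclideanSpace ℝ (Fin d)), C.card = k →
            (1 - ε) * rcostZ z m P C ≤ wrcostZ z ((n : ℝ) - m) S w C ∧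
            wrcostZ z ((n : ℝ) - m) S w C ≤ (1 + ε) * rcostZ z m P C) ∧
          (S.card : ℝ) ≤
            Cz * (k : ℝ) ^ 2 * ε ^ (-(2 * z)) * min (ε ^ (-(2 : ℝ))) (d : ℝ) *
              (1 + Real.log ((k : ℝ) / ε)) ^ Cz := by
  intro z hz
  have hA := one_le_sizeConstant hz
  refine ⟨max (10 * (7 * sizeConstant z) ^ 2) 1, by positivity, ?_⟩
  intro n m k d ε P Cs Ls f hn hm hk hd hmn hε hε1 hPn hCs hopt hLs hLm hcost hf hmass hfar
  have hmn' : (m : ℝ) < n := by exact_mod_cast hmn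
  have hm' : (1:ℝ) ≤ m := by exact_mod_cast hm
  have hk' : (1:ℝ) ≤ k := by exact_mod_cast hk
  have hN : 0 < (n : ℝ) - m := by linarith
  set O := rcostZ z m P Cs with hO
  have hO0 : 0 ≤ O := hcost ▸ Finset.sum_nonneg fun p _ => distC_rpow_nonneg p Cs
  set γ : EuclideanSpace ℝ (Fin d) → Option (EuclideanSpace ℝ (Fin d)) :=
    fun p => if p ∈ Ls then none else some (f p) with hγ
  set B : EuclideanSpace ℝ (Fin d) → ℝ :=
    fun c => (((P \ Ls).filter fun p => f p = c).card : ℝ) with hB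
  have hinlier : ∀ p, ∀ c, γ p = some c ↔ p ∉ Ls ∧ f p = c := by
    intro p c
    by_cases hp : p ∈ Ls <;> simp [hγ, hp]
  have houtlier : ∀ p, γ p = none ↔ p ∈ Ls := by
    intro p
    by_cases hp : p ∈ Ls <;> simp [hγ, hp]
  have hP : HasMasses m P Cs γ B fun _ => 1 := by
    refine ⟨fun _ _ => zero_le_one, ?_, fun c _ => ?_⟩
    · rw [Finset.sum_const, nsmul_eq_mul, mul_one, Finset.filter_congr fun p _ => houtlier p,
        Finset.filter_mem_eq_inter, Finset.inter_eq_right.2 hLs, hLm]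
    · rw [Finset.sum_const, nsmul_eq_mul, mul_one, hB]
      congr 2
      ext p
      simp only [Finset.mem_filter, Finset.mem_sdiff, hinlier]
      tauto
  have hsumB : ∑ c ∈ Cs, B c = (n : ℝ) - m := by
    rw [hB, ← Nat.cast_sum, ← Finset.card_eq_sum_card_fiberwise fun p hp => (hf p hp).1,
      Finset.card_sdiff_of_subset hLs, hPn, hLm, Nat.cast_sub hmn.le]
  have hB4 : ∀ c ∈ Cs, 4 * (m : ℝ) ≤ B c := fun c hc => by
    simp only [hB]
    exact_mod_cast hmass c hc
  have hr0 : 0 ≤ 4 * k * O / ((n : ℝ) - m) := by positivity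
  have hgeo : ClusterGeometry z ((4 * k * O / ((n : ℝ) - m)) ^ z⁻¹) ((n : ℝ) - m) O k m P Cs γ B := by
    refine ⟨hz, by positivity, hO0, hk, by linarith, fun p hp => ?_, fun p hp c hc => ?_, hB4,
      hsumB, ?_, ?_⟩
    · by_cases hpL : p ∈ Ls
      · rw [(houtlier p).2 hpL]
        exact Finset.none_mem_insertNone
      · rw [(hinlier p (f p)).2 ⟨hpL, rfl⟩]
        exact Finset.some_mem_insertNone.2 (hf p (Finset.mem_sdiff.2 ⟨hp, hpL⟩)).1
    · obtain ⟨hpL, rfl⟩ := (hinlier p c).1 hc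
      have hpI := Finset.mem_sdiff.2 ⟨hp, hpL⟩
      rw [(hf p hpI).2]
      refine (Real.le_rpow_inv_iff_of_pos Metric.infDist_nonneg hr0 (by linarith)).2 ?_
      have := hfar p hpI
      rwa [hcost] at this
    · rw [← hsumB]
      calc 4 * (m : ℝ) * k = ∑ c ∈ Cs, 4 * (m : ℝ) := by
            rw [Finset.sum_const, hCs, nsmul_eq_mul]
            ring
        _ ≤ _ := Finset.sum_le_sum hB4
    · rw [Real.rpow_inv_rpow hr0 (by linarith), div_mul_cancel₀ _ hN.ne']
  have hK : ∀ C, rcostZ z m P C = wrcostZ z ((n : ℝ) - m) P (fun _ => 1) C := fun C => by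
    rw [rcostZ_eq_wrcostZ (by omega), hPn]
  obtain ⟨S, hS, w, hw, hpos, happ, hcard⟩ := hgeo.exists_coreset hd hCs hP
    (fun C hC => (hopt C hC).trans_eq (hK C)) hε hε1
  refine ⟨S, w, hS, hpos, ?_, fun C hC => ?_, ?_⟩
  · have := (hgeo.mono hS).sum_weights hw
    linarith
  · obtain ⟨h1, h2⟩ := abs_le.1 (happ C hC)
    rw [hK C]
    constructor <;> linarith
  · have hlog : 0 ≤ Real.log (k / ε) :=
      Real.log_nonneg ((one_le_div₀ hε).2 (by linarith))
    have hεz : (ε ^ 2)⁻¹ ≤ ε ^ (-(2 * z)) := by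
      rw [← Real.rpow_natCast, ← Real.rpow_neg hε.le]
      exact Real.rpow_le_rpow_of_exponent_ge hε hε1.le (by push_cast; linarith)
    have hε2 : (ε ^ 2)⁻¹ = ε ^ (-(2 : ℝ)) := by
      rw [Real.rpow_neg hε.le, Real.rpow_two]
    refine hcard.trans ?_
    calc 10 * ((7 * sizeConstant z) ^ 2 * (k ^ 2 * (ε ^ 2)⁻¹ * min (ε ^ 2)⁻¹ (d : ℝ))
          * (1 + Real.log (k / ε)))
        = 10 * (7 * sizeConstant z) ^ 2 * k ^ 2 * (ε ^ 2)⁻¹ * min (ε ^ 2)⁻¹ (d : ℝ)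
          * (1 + Real.log (k / ε)) ^ (1 : ℝ) := by
          rw [Real.rpow_one]
          ring
      _ ≤ max (10 * (7 * sizeConstant z) ^ 2) 1 * k ^ 2 * ε ^ (-(2 * z))
          * min (ε ^ 2)⁻¹ (d : ℝ)
          * (1 + Real.log (k / ε)) ^ max (10 * (7 * sizeConstant z) ^ 2) 1 := by
          gcongr
          · exact le_max_left _ _
          · linarith
          · exact le_max_right _ _
      _ = _ := by rw [hε2]
end

section
/- Let P = {p_1 < p_2 < ⋯ < p_n} ⊂ ℝ with integers m ≥ 1 and n ≥ 2m + 1. Let c* ∈ ℝ minimize cost^(m)(P,·) over ℝ, let P_I^* ⊆ P with |P_I^*| = n − m be a set attaining cost^(m)(P,c*) (i.e. Σ_{p∈P_I^*}|p − c*| = cost^(m)(P,c*)), and set r_max := max_{p∈P_I^*} |p − c*| and c_L := c* − r_max. Let c ∈ [p_{m+1}, p_{n−m}] with c < c*, let P_I^{(c)} ⊆ P with |P_I^{(c)}| = n − m attain cost^(m)(P,c), assume P_I^{(c)} ≠ P_I^*, and let p_l := min P_I^{(c)}; assume p_l ∉ P_I^*. Then |p_l − c_L| ≤ 2·|c − c*|.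 -/
open Finset
open scoped Classical

/-- Robust cost with `m` outliers of a center `c` for a dataset `p : Fin n → ℝ`:
minimum over index sets `L` of size `m` of the sum of distances of the remaining
points to `c`. -/
noncomputable def rcostIdx {n : ℕ} (m : ℕ) (p : Fin n → ℝ) (c : ℝ) : ℝ :=
  sInf {y : ℝ | ∃ L : Finset (Fin n), L.card = m ∧ y = ∑ i ∈ Lᶜ, |p i - c|}

/-- Every inlier of a set attaining the robust cost at `c` is at least as close to `c`
as every outlier. -/
lemma abs_sub_le_of_attains_rcostIdx {n m : ℕ} (hmn : m ≤ n) (p : Fin n → ℝ) (c : ℝ)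
    {S : Finset (Fin n)} (hcard : S.card = n - m)
    (hS : (∑ k ∈ S, |p k - c|) = rcostIdx m p c) {i j : Fin n} (hi : i ∈ S) (hj : j ∉ S) :
    |p i - c| ≤ |p j - c| := by
  have hj' : j ∉ S.erase i := fun h => hj (Finset.mem_of_mem_erase h)
  have hpos : 0 < S.card := Finset.card_pos.mpr ⟨i, hi⟩
  have hle : rcostIdx m p c ≤ ∑ k ∈ insert j (S.erase i), |p k - c| := by
    refine csInf_le ⟨0, ?_⟩ ⟨(insert j (S.erase i))ᶜ, ?_, by rw [compl_compl]⟩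
    · rintro y ⟨L, -, rfl⟩
      exact Finset.sum_nonneg fun _ _ => abs_nonneg _
    · rw [Finset.card_compl, Fintype.card_fin, Finset.card_insert_of_notMem hj',
        Finset.card_erase_of_mem hi]
      omega
  rw [Finset.sum_insert hj', ← hS, ← Finset.add_sum_erase S _ hi] at hle
  linarith

/-- **Location of the inlier set (Lemma `location`).**
Let `P = {p_1 < ⋯ < p_n}`, let `c*` be an optimal center for the robust
geometric median with `m` outliers, let `P_I^*` attain the optimal cost with
`r_max = max_{p ∈ P_I^*} |p - c*|` and `c_L = c* - r_max`. If
`c ∈ [p_{m+1}, p_{n-m}]`, `c < c*`, the inlier set `P_I^{(c)}` at `c` differs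
from `P_I^*`, and its leftmost point `p_l` is not in `P_I^*`, then
`|p_l - c_L| ≤ 2·|c - c*|`. -/
theorem inlier_location
    (n m : ℕ) (hm : 1 ≤ m) (hn : 2 * m + 1 ≤ n)
    (p : Fin n → ℝ) (hp : StrictMono p)
    (cstar : ℝ) (hopt : ∀ c : ℝ, rcostIdx m p cstar ≤ rcostIdx m p c)
    (PIs : Finset (Fin n)) (hPIscard : PIs.card = n - m)
    (hPIsattain : (∑ i ∈ PIs, |p i - cstar|) = rcostIdx m p cstar)
    (rmax : ℝ)
    (hrmax_ub : ∀ i ∈ PIs, |p i - cstar| ≤ rmax)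
    (hrmax_mem : ∃ i ∈ PIs, |p i - cstar| = rmax)
    (c : ℝ)
    (hc_left : p ⟨m, by omega⟩ ≤ c) (hc_right : c ≤ p ⟨n - m - 1, by omega⟩)
    (hc_lt : c < cstar)
    (PIc : Finset (Fin n)) (hPIccard : PIc.card = n - m)
    (hPIcattain : (∑ i ∈ PIc, |p i - c|) = rcostIdx m p c)
    (hne : PIc ≠ PIs)
    (l : Fin n) (hl_mem : l ∈ PIc) (hl_min : ∀ i ∈ PIc, l ≤ i)
    (hl_not : l ∉ PIs) :
    |p l - (cstar - rmax)| ≤ 2 * |c - cstar| := by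
  have hmn : m ≤ n := by omega
  have hlm : l ≤ ⟨m, by omega⟩ := by
    have hsub : PIc ⊆ Finset.Ici l := fun i hi => Finset.mem_Ici.mpr (hl_min i hi)
    have hcard := Finset.card_le_card hsub
    rw [Fin.card_Ici, hPIccard] at hcard
    rw [Fin.le_def]
    have := l.isLt
    simp only
    omega
  have hlc : p l ≤ c := (hp.monotone hlm).trans hc_left
  obtain ⟨k, hk, hkr⟩ := hrmax_mem
  have hlr := abs_sub_le_of_attains_rcostIdx hmn p cstar hPIscard hPIsattain hk hl_not
  obtain ⟨j, hj, hj_not⟩ : ∃ j ∈ PIs, j ∉ PIc := by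
    by_contra! h
    exact hne (Finset.eq_of_subset_of_card_le h (by omega)).symm
  have hlj := abs_sub_le_of_attains_rcostIdx hmn p c hPIccard hPIcattain hl_mem hj_not
  have hjr := hrmax_ub j hj
  have htri := abs_sub_le (p j) cstar c
  rw [hkr, abs_of_nonpos (by linarith)] at hlr
  rw [abs_of_nonpos (by linarith : p l - c ≤ 0)] at hlj
  rw [abs_of_pos (by linarith : 0 < cstar - c)] at htri
  rw [abs_of_nonpos (by linarith), abs_of_neg (by linarith : c - cstar < 0)]
  linarith
end

section
/- Let B be a finite set of N ≥ 2 real numbers with minimum a and maximum b, and let Δ > 0. Suppose B is partitioned into t ≥ 2 nonempty blocks B_1, …, B_t that are consecutive in sorted order (every element of B_j is less than every element of B_{j+1}) and that satisfy δ(B_j ∪ B_{j+1}) > Δ for every 1 ≤ j ≤ t − 1. Then ⌊t/2⌋² · Δ < N · (b − a). -/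
open Finset

/-- Mean of a finite set of reals. -/
noncomputable def meanB (X : Finset ℝ) : ℝ := (∑ x ∈ X, x) / X.card

/-- Cumulative error of a finite set of reals: `δ(X) = ∑_{x ∈ X} |x - μ(X)|`. -/
noncomputable def cumErr (X : Finset ℝ) : ℝ := ∑ x ∈ X, |x - meanB X|

/-- The cumulative error of a set contained in `[a, b]` is at most its cardinality times `b - a`. -/
theorem cumErr_le_card_mul {X : Finset ℝ} (hX : X.Nonempty) {a b : ℝ}
    (ha : ∀ x ∈ X, a ≤ x) (hb : ∀ x ∈ X, x ≤ b) :
    cumErr X ≤ X.card * (b - a) := by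
  have hc : (0 : ℝ) < X.card := by exact_mod_cast hX.card_pos
  have hlo : a ≤ meanB X := by
    rw [meanB, le_div_iff₀ hc, mul_comm, ← nsmul_eq_mul]
    exact X.card_nsmul_le_sum _ _ ha
  have hhi : meanB X ≤ b := by
    rw [meanB, div_le_iff₀ hc, mul_comm, ← nsmul_eq_mul]
    exact X.sum_le_card_nsmul _ _ hb
  rw [cumErr, ← nsmul_eq_mul]
  refine X.sum_le_card_nsmul _ _ fun x hx => ?_
  have := ha x hx
  have := hb x hx
  rw [abs_le]
  constructor <;> linarith

/-- The total length of consecutive intervals inside `[a, b]` is at most `b - a`. -/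
theorem sum_length_le_of_consecutive {ι : Type*} [LinearOrder ι] (s : Finset ι)
    (lo hi : ι → ℝ) (hsep : ∀ i j, i < j → hi i ≤ lo j) {a b : ℝ} (hab : a ≤ b)
    (ha : ∀ i, a ≤ lo i) (hb : ∀ i ∈ s, hi i ≤ b) :
    ∑ i ∈ s, (hi i - lo i) ≤ b - a := by
  induction s using Finset.induction_on_max generalizing b with
  | empty => simpa using hab
  | insert i s hs ih =>
    rw [Finset.sum_insert fun h => lt_irrefl i (hs i h)]
    have h₁ := ih (ha i) fun j hj => hsep j i (hs j hj)
    have h₂ := hb i (Finset.mem_insert_self i s)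
    linarith

/-- Counting inequality for a family of separated subsets of `B` with large cumulative error. -/
theorem card_sq_mul_lt_of_lt_cumErr {ι : Type*} [Fintype ι] [Nonempty ι] [LinearOrder ι]
    {B : Finset ℝ} (hB : B.Nonempty) {Δ : ℝ} (hΔ : 0 ≤ Δ) (P : ι → Finset ℝ)
    (hne : ∀ i, (P i).Nonempty) (hPB : ∀ i, P i ⊆ B)
    (hsep : ∀ i j, i < j → ∀ x ∈ P i, ∀ y ∈ P j, x < y) (hδ : ∀ i, Δ < cumErr (P i)) :
    (Fintype.card ι : ℝ) ^ 2 * Δ < B.card * (B.max' hB - B.min' hB) := by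
  let len : ι → ℝ := fun i => (P i).max' (hne i) - (P i).min' (hne i)
  have hlen_nonneg : ∀ i, 0 ≤ len i := fun i =>
    sub_nonneg.2 ((P i).min'_le _ ((P i).max'_mem (hne i)))
  have hprod : ∀ i, Δ < (P i).card * len i := fun i =>
    (hδ i).trans_le (cumErr_le_card_mul (hne i) (fun x hx => (P i).min'_le x hx)
      fun x hx => (P i).le_max' x hx)
  have hsum_len : ∑ i, len i ≤ B.max' hB - B.min' hB :=
    sum_length_le_of_consecutive Finset.univ (fun i => (P i).min' (hne i))
      (fun i => (P i).max' (hne i))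
      (fun i j hij => (hsep i j hij _ ((P i).max'_mem _) _ ((P j).min'_mem _)).le)
      (B.min'_le _ (B.max'_mem hB)) (fun i => B.min'_le _ (hPB i ((P i).min'_mem _)))
      fun i _ => B.le_max' _ (hPB i ((P i).max'_mem _))
  have hdisj : ∀ i j, i ≠ j → Disjoint (P i) (P j) := fun i j hij =>
    Finset.disjoint_left.2 fun x hi hj => hij.lt_or_gt.elim
      (fun h => lt_irrefl x (hsep i j h x hi x hj)) fun h => lt_irrefl x (hsep j i h x hj x hi)
  have hsum_card : ∑ i, ((P i).card : ℝ) ≤ B.card := by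
    have h : ∑ i, (P i).card ≤ B.card := by
      rw [← Finset.card_biUnion fun i _ j _ => hdisj i j]
      exact Finset.card_le_card (Finset.biUnion_subset.2 fun i _ => hPB i)
    exact_mod_cast h
  calc (Fintype.card ι : ℝ) ^ 2 * Δ = (∑ _i : ι, √Δ) ^ 2 := by
        simp [mul_pow, Real.sq_sqrt hΔ]
    _ < (∑ i, √((P i).card * len i)) ^ 2 := by
        refine pow_lt_pow_left₀ ?_ (Finset.sum_nonneg fun i _ => Real.sqrt_nonneg _) two_ne_zero
        exact Finset.sum_lt_sum_of_nonempty Finset.univ_nonempty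
          fun i _ => Real.sqrt_lt_sqrt hΔ (hprod i)
    _ ≤ (∑ i, ((P i).card : ℝ)) * ∑ i, len i :=
        Finset.sum_sq_le_sum_mul_sum_of_sq_le_mul _ (fun i _ => Nat.cast_nonneg _)
          (fun i _ => hlen_nonneg i) fun i _ => (Real.sq_sqrt (hΔ.trans (hprod i).le)).le
    _ ≤ B.card * (B.max' hB - B.min' hB) :=
        mul_le_mul hsum_card hsum_len (Finset.sum_nonneg fun i _ => hlen_nonneg i)
          (Nat.cast_nonneg _)

/-- **Key counting inequality for the greedy bucket partition.**
Let `B` be a finite set of `N ≥ 2` reals with minimum `a` and maximum `b`, and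
`Δ > 0`. If `B` is partitioned into `t ≥ 2` nonempty consecutive blocks
`B_1, …, B_t` (every element of `B_j` is below every element of `B_{j+1}`)
with `δ(B_j ∪ B_{j+1}) > Δ` for all `1 ≤ j ≤ t-1`, then
`⌊t/2⌋² · Δ < N · (b - a)`. -/
theorem bucket_partition_counting
    (B : Finset ℝ) (hN : 2 ≤ B.card) (Δ : ℝ) (hΔ : 0 < Δ)
    (t : ℕ) (ht : 2 ≤ t) (Bl : Fin t → Finset ℝ)
    (hne : ∀ j, (Bl j).Nonempty)
    (hord : ∀ i j : Fin t, i < j → ∀ x ∈ Bl i, ∀ y ∈ Bl j, x < y)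
    (hpart : ∀ x : ℝ, x ∈ B ↔ ∃ j, x ∈ Bl j)
    (hδ : ∀ j : ℕ, (h : j + 1 < t) →
      Δ < cumErr (Bl ⟨j, by omega⟩ ∪ Bl ⟨j + 1, h⟩)) :
    ((t / 2 : ℕ) : ℝ) ^ 2 * Δ <
      (B.card : ℝ) *
        (B.max' (Finset.card_pos.mp (by omega)) -
          B.min' (Finset.card_pos.mp (by omega))) := by
  have : Nonempty (Fin (t / 2)) := ⟨⟨0, by omega⟩⟩
  let P : Fin (t / 2) → Finset ℝ := fun k =>
    Bl ⟨2 * k, by omega⟩ ∪ Bl ⟨2 * k + 1, by omega⟩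
  have key := card_sq_mul_lt_of_lt_cumErr (B := B) (Finset.card_pos.mp (by omega)) hΔ.le P
    (fun k => (hne _).mono Finset.subset_union_left)
    (fun k x hx => (hpart x).2 ((Finset.mem_union.1 hx).elim (⟨_, ·⟩) (⟨_, ·⟩)))
    (fun k l hkl x hx y hy => by
      have hkl' : (k : ℕ) < l := hkl
      rcases Finset.mem_union.1 hx with hx | hx <;> rcases Finset.mem_union.1 hy with hy | hy <;>
        exact hord _ _ (Fin.mk_lt_mk.2 (by omega)) x hx y hy)
    (fun k => hδ (2 * k) (by omega))
  simpa only [Fintype.card_fin] using key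
end

section
/- Let p_1 < p_2 < ⋯ < p_n be real numbers, let m ≥ 1 be an integer with n ≥ 2m, and let c ∈ ℝ be such that the distances |p_i − c| are pairwise distinct. Let P_I^{(c)} be the set of the n − m points of P closest to c (this set is consecutive in sorted order). Suppose P is partitioned into nonempty consecutive buckets B_1, …, B_q (every element of B_i is less than every element of B_{i+1}); for each index i let B^{(i)} denote the bucket containing p_i and μ(B) the mean of a bucket B, and let B_L and B_R be the buckets containing the smallest and the largest point of P_I^{(c)}, respectively. Then #{j ∈ {1,…,m} : p_j ∈ P_I^{(c)} and |μ(B^{(j)}) − c| > |μ(B^{(j+n−m)}) − c|} + #{j ∈ {1,…,m} : p_j ∉ P_I^{(c)} and |μ(B^{(j)}) − c| < |μ(B^{(j+n−m)}) − c|} ≤ |B_L| + |B_R|. -/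
open Finset
open scoped Classical

/-- Mean of the points of `p` indexed by a finite index set `B`. -/
noncomputable def meanIdx {n : ℕ} (p : Fin n → ℝ) (B : Finset (Fin n)) : ℝ :=
  (∑ i ∈ B, p i) / B.card

theorem le_meanIdx {n : ℕ} {p : Fin n → ℝ} {B : Finset (Fin n)} (hB : B.Nonempty) {a : ℝ}
    (h : ∀ i ∈ B, a ≤ p i) : a ≤ meanIdx p B := by
  have hpos : (0 : ℝ) < B.card := by exact_mod_cast hB.card_pos
  rw [meanIdx, le_div_iff₀ hpos, mul_comm, ← nsmul_eq_mul]
  exact Finset.card_nsmul_le_sum B p a h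

theorem meanIdx_le {n : ℕ} {p : Fin n → ℝ} {B : Finset (Fin n)} (hB : B.Nonempty) {a : ℝ}
    (h : ∀ i ∈ B, p i ≤ a) : meanIdx p B ≤ a := by
  have hpos : (0 : ℝ) < B.card := by exact_mod_cast hB.card_pos
  rw [meanIdx, div_le_iff₀ hpos, mul_comm, ← nsmul_eq_mul]
  exact Finset.sum_le_card_nsmul B p a h

theorem meanIdx_le_meanIdx {n : ℕ} {p : Fin n → ℝ} (hp : StrictMono p) {X Y : Finset (Fin n)}
    (hX : X.Nonempty) (hY : Y.Nonempty) (h : ∀ x ∈ X, ∀ y ∈ Y, x < y) :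
    meanIdx p X ≤ meanIdx p Y :=
  meanIdx_le hX fun x hx => le_meanIdx hY fun y hy => (hp (h x hx y hy)).le

/-- If `Y` lies to the right of every inlier and `X < Y` lies to the right of some inlier, then the
mean of `X` is at least as close to `c` as the mean of `Y`. -/
theorem abs_meanIdx_sub_le_of_right {n : ℕ} {p : Fin n → ℝ} (hp : StrictMono p) {c : ℝ}
    {I : Finset (Fin n)} (hI : ∀ i ∈ I, ∀ j, j ∉ I → |p i - c| < |p j - c|)
    {X Y : Finset (Fin n)} (hX : X.Nonempty) (hY : Y.Nonempty) (hXY : ∀ x ∈ X, ∀ y ∈ Y, x < y)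
    {l : Fin n} (hl : l ∈ I) (hlX : ∀ x ∈ X, l < x) (hIY : ∀ y ∈ Y, ∀ i ∈ I, i < y) :
    |meanIdx p X - c| ≤ |meanIdx p Y - c| := by
  have hXY' := meanIdx_le_meanIdx hp hX hY hXY
  have hYl : c + |p l - c| ≤ meanIdx p Y := le_meanIdx hY fun y hy => by
    have h := hI l hl y fun hyI => lt_irrefl _ (hIY y hy y hyI)
    have hly := hp (hIY y hy l hl)
    rcases abs_cases (p l - c) with h' | h' <;> rcases abs_cases (p y - c) with h'' | h'' <;>
      linarith
  have hXl : c - |p l - c| ≤ meanIdx p X := le_meanIdx hX fun x hx => by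
    linarith [hp (hlX x hx), neg_abs_le (p l - c)]
  exact (abs_le.2 ⟨by linarith, by linarith⟩).trans (le_abs_self _)

/-- If `X` lies to the left of every inlier and `Y > X` lies to the left of some inlier, then the
mean of `Y` is at least as close to `c` as the mean of `X`. -/
theorem abs_meanIdx_sub_le_of_left {n : ℕ} {p : Fin n → ℝ} (hp : StrictMono p) {c : ℝ}
    {I : Finset (Fin n)} (hI : ∀ i ∈ I, ∀ j, j ∉ I → |p i - c| < |p j - c|)
    {X Y : Finset (Fin n)} (hX : X.Nonempty) (hY : Y.Nonempty) (hXY : ∀ x ∈ X, ∀ y ∈ Y, x < y)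
    {r : Fin n} (hr : r ∈ I) (hYr : ∀ y ∈ Y, y < r) (hXI : ∀ x ∈ X, ∀ i ∈ I, x < i) :
    |meanIdx p Y - c| ≤ |meanIdx p X - c| := by
  have hXY' := meanIdx_le_meanIdx hp hX hY hXY
  have hXr : meanIdx p X ≤ c - |p r - c| := meanIdx_le hX fun x hx => by
    have h := hI r hr x fun hxI => lt_irrefl _ (hXI x hx x hxI)
    have hxr := hp (hXI x hx r hr)
    rcases abs_cases (p r - c) with h' | h' <;> rcases abs_cases (p x - c) with h'' | h'' <;>
      linarith
  have hYr' : meanIdx p Y ≤ c + |p r - c| := meanIdx_le hY fun y hy => by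
    linarith [hp (hYr y hy), le_abs_self (p r - c)]
  rw [abs_sub_comm (meanIdx p X)]
  exact (abs_le.2 ⟨by linarith, by linarith⟩).trans (le_abs_self _)

theorem mem_of_lt_of_lt_of_closest {n : ℕ} {p : Fin n → ℝ} (hp : StrictMono p) {c : ℝ}
    {I : Finset (Fin n)} (hI : ∀ i ∈ I, ∀ j, j ∉ I → |p i - c| < |p j - c|)
    {i j k : Fin n} (hi : i ∈ I) (hk : k ∈ I) (hij : i < j) (hjk : j < k) : j ∈ I := by
  by_contra hj
  have h₁ := hI i hi j hj
  have h₂ := hI k hk j hj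
  have h₃ := hp hij
  have h₄ := hp hjk
  rcases abs_cases (p i - c) with h | h <;> rcases abs_cases (p j - c) with h' | h' <;>
    rcases abs_cases (p k - c) with h'' | h'' <;> linarith

theorem card_filter_le_of_injective {α β : Type*} [Fintype α] [DecidableEq β] {f : α → β}
    (hf : Function.Injective f) (s : Finset β) :
    (Finset.univ.filter fun a => f a ∈ s).card ≤ s.card :=
  Finset.card_le_card_of_injOn f (fun a ha => by simpa using ha) hf.injOn

/-- **Total misalignment bound (Lemma `misaligned outliers`, key counting step).**
Let `p_1 < ⋯ < p_n`, `n ≥ 2m`, `m ≥ 1`, and let `c` have pairwise distinct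
distances to the points. Let `P_I^{(c)}` be the set of the `n - m` indices of
points closest to `c`. Suppose the index set is partitioned into nonempty
consecutive buckets `B_1, …, B_q`, with `bIdx i` the bucket containing `i`,
and let `B_L`, `B_R` be the buckets of the smallest and largest inliers. Then
the number of `j ∈ {1,…,m}` with `p_j` an inlier whose bucket-mean is farther
from `c` than the bucket-mean of `p_{j+n-m}`, plus the number of `j ∈ {1,…,m}`
with `p_j` an outlier whose bucket-mean is closer to `c` than that of
`p_{j+n-m}`, is at most `|B_L| + |B_R|`. -/
theorem misalignment_counting
    (n m q : ℕ) (hm : 1 ≤ m) (hn : 2 * m ≤ n)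
    (p : Fin n → ℝ) (hp : StrictMono p)
    (c : ℝ)
    (hdist : ∀ i j : Fin n, i ≠ j → |p i - c| ≠ |p j - c|)
    (PIc : Finset (Fin n)) (hPIccard : PIc.card = n - m)
    (hPIcclosest : ∀ i ∈ PIc, ∀ j : Fin n, j ∉ PIc → |p i - c| < |p j - c|)
    (Bl : Fin q → Finset (Fin n))
    (hBne : ∀ j, (Bl j).Nonempty)
    (hBord : ∀ j₁ j₂ : Fin q, j₁ < j₂ → ∀ i₁ ∈ Bl j₁, ∀ i₂ ∈ Bl j₂, i₁ < i₂)
    (bIdx : Fin n → Fin q)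
    (hbIdx : ∀ i : Fin n, i ∈ Bl (bIdx i)) :
    ((Finset.univ.filter (fun j : Fin m =>
        (⟨j.1, by have := j.2; omega⟩ : Fin n) ∈ PIc ∧
        |meanIdx p (Bl (bIdx ⟨j.1 + (n - m), by have := j.2; omega⟩)) - c| <
          |meanIdx p (Bl (bIdx ⟨j.1, by have := j.2; omega⟩)) - c|)).card : ℕ) +
      ((Finset.univ.filter (fun j : Fin m =>
        (⟨j.1, by have := j.2; omega⟩ : Fin n) ∉ PIc ∧
        |meanIdx p (Bl (bIdx ⟨j.1, by have := j.2; omega⟩)) - c| <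
          |meanIdx p (Bl (bIdx ⟨j.1 + (n - m), by have := j.2; omega⟩)) - c|)).card : ℕ) ≤
      (Bl (bIdx (PIc.min' (by rw [← Finset.card_pos, hPIccard]; omega)))).card +
        (Bl (bIdx (PIc.max' (by rw [← Finset.card_pos, hPIccard]; omega)))).card := by
  have hne : PIc.Nonempty := by rw [← Finset.card_pos, hPIccard]; omega
  set L := PIc.min' hne
  set R := PIc.max' hne
  have hLmem : L ∈ PIc := PIc.min'_mem hne
  have hRmem : R ∈ PIc := PIc.max'_mem hne
  have hmono : ∀ {i k : Fin n}, i ≤ k → bIdx i ≤ bIdx k := fun {i k} hik => by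
    by_contra! h
    exact absurd (hBord _ _ h k (hbIdx k) i (hbIdx i)) hik.not_gt
  have hlt : ∀ {i k : Fin n}, i ≤ k → bIdx i ≠ bIdx k → bIdx i < bIdx k :=
    fun hik h => lt_of_le_of_ne (hmono hik) h
  have hright : ∀ (j k : Fin n), j ∈ PIc → k.1 = j.1 + (n - m) → R < k := fun j k hj hk => by
    by_contra! hkR
    have hsub : Finset.Icc j k ⊆ PIc := fun x hx => by
      rw [Finset.mem_Icc] at hx
      rcases hx.1.eq_or_lt with rfl | h₁
      · exact hj
      · rcases (hx.2.trans hkR).eq_or_lt with h₂ | h₂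
        · exact h₂ ▸ hRmem
        · exact mem_of_lt_of_lt_of_closest hp hPIcclosest hj hRmem h₁ h₂
    have := Finset.card_le_card hsub
    rw [Fin.card_Icc] at this
    omega
  have hleft : ∀ j : Fin n, j.1 < m → j ∉ PIc → ∀ i ∈ PIc, j < i := fun j hjm hj i hi => by
    by_contra! hij
    have hij' : i < j := lt_of_le_of_ne hij fun h => hj (h ▸ hi)
    have hsub : PIc ⊆ Finset.Iio j := fun x hx => by
      rw [Finset.mem_Iio]
      by_contra! hjx
      exact hj (mem_of_lt_of_lt_of_closest hp hPIcclosest hi hx hij'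
        (lt_of_le_of_ne hjx fun h => hj (h ▸ hx)))
    have := Finset.card_le_card hsub
    rw [Fin.card_Iio] at this
    omega
  have hleft' : ∀ j k : Fin n, j.1 < m → j ∉ PIc → k.1 = j.1 + (n - m) → k ≤ R :=
    fun j k hjm hj hk => by
    have hsub : PIc ⊆ Finset.Ioc j R := fun x hx =>
      Finset.mem_Ioc.2 ⟨hleft j hjm hj x hx, PIc.le_max' x hx⟩
    have := Finset.card_le_card hsub
    rw [Fin.card_Ioc] at this
    rw [Fin.le_def]
    omega
  let lo : Fin m → Fin n := fun j => ⟨j.1, by have := j.2; omega⟩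
  let hi : Fin m → Fin n := fun j => ⟨j.1 + (n - m), by have := j.2; omega⟩
  have hloinj : Function.Injective lo := fun a b h => by
    simpa [lo, Fin.ext_iff] using h
  have hhiinj : Function.Injective hi := fun a b h => by
    simpa [hi, Fin.ext_iff] using h
  rw [← Finset.card_union_of_disjoint (Finset.disjoint_left.2 fun j h₁ h₂ =>
    (Finset.mem_filter.1 h₂).2.1 (Finset.mem_filter.1 h₁).2.1)]
  refine le_trans (Finset.card_le_card (t := (Finset.univ.filter fun j => lo j ∈ Bl (bIdx L)) ∪
      Finset.univ.filter fun j => hi j ∈ Bl (bIdx R)) fun j hj => ?_)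
    ((Finset.card_union_le _ _).trans (add_le_add (card_filter_le_of_injective hloinj _)
      (card_filter_le_of_injective hhiinj _)))
  by_contra hcon
  simp only [Finset.mem_union, Finset.mem_filter, Finset.mem_univ, true_and, not_or] at hcon hj
  have hloL : bIdx (lo j) ≠ bIdx L := fun h => hcon.1 (h ▸ hbIdx (lo j))
  have hhiR : bIdx (hi j) ≠ bIdx R := fun h => hcon.2 (h ▸ hbIdx (hi j))
  rcases hj with ⟨hmem, hbad⟩ | ⟨hmem, hbad⟩
  · have hR' : bIdx R < bIdx (hi j) := hlt (hright (lo j) (hi j) hmem rfl).le hhiR.symm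
    have hL' : bIdx L < bIdx (lo j) := hlt (PIc.min'_le _ hmem) hloL.symm
    have hlh : bIdx (lo j) < bIdx (hi j) := (hmono (PIc.le_max' _ hmem)).trans_lt hR'
    exact hbad.not_ge (abs_meanIdx_sub_le_of_right hp hPIcclosest (hBne _) (hBne _)
      (hBord _ _ hlh) hLmem (hBord _ _ hL' L (hbIdx L))
      fun y hy i hiI => (PIc.le_max' i hiI).trans_lt (hBord _ _ hR' R (hbIdx R) y hy))
  · have hL' : bIdx (lo j) < bIdx L := hlt (hleft (lo j) j.2 hmem L hLmem).le hloL
    have hhiR' : hi j ≤ R := hleft' (lo j) (hi j) j.2 hmem rfl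
    have hR' : bIdx (hi j) < bIdx R := hlt hhiR' hhiR
    have hLhi : L ≤ hi j := by
      by_contra! h
      have hsub : PIc ⊆ Finset.Ioc (hi j) R := fun x hx =>
        Finset.mem_Ioc.2 ⟨h.trans_le (PIc.min'_le x hx), PIc.le_max' x hx⟩
      have := Finset.card_le_card hsub
      rw [Fin.card_Ioc, hPIccard] at this
      have : (hi j).1 = j.1 + (n - m) := rfl
      have := R.2
      omega
    have hlh : bIdx (lo j) < bIdx (hi j) := hL'.trans_le (hmono hLhi)
    exact hbad.not_ge (abs_meanIdx_sub_le_of_left hp hPIcclosest (hBne _) (hBne _)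
      (hBord _ _ hlh) hRmem (fun y hy => hBord _ _ hR' y hy R (hbIdx R))
      fun x hx i hiI => (hBord _ _ hL' x hx L (hbIdx L)).trans_le (PIc.min'_le i hiI))
end

section
/- Let p_1, …, p_n be real numbers (not necessarily distinct), let 1 ≤ m < n be an integer, and let c* ∈ ℝ satisfy cost^(m)(P,c*) ≤ cost^(m)(P,c) for all c ∈ ℝ (i.e. c* is an optimal center for the robust geometric median with m outliers). Then for every c ∈ ℝ, cost^(m)(P,c) ≥ (⌊(n − m)/2⌋ − m)·|c − c*|. -/
open Finset
open scoped Classical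

/-- If `a` minimizes `c ↦ ∑ i ∈ I, |p i - c|`, then at least half of the points are at most `a`. -/
lemma card_le_two_mul_card_filter_le_of_isMin {ι : Type*} (I : Finset ι) (p : ι → ℝ) (a : ℝ)
    (h : ∀ c, ∑ i ∈ I, |p i - a| ≤ ∑ i ∈ I, |p i - c|) :
    I.card ≤ 2 * (I.filter (fun i => p i ≤ a)).card := by
  have hev : ∀ᶠ b in nhdsWithin a (Set.Ioi a), ∀ i ∈ I, a < p i → b < p i := by
    rw [Filter.eventually_all_finset]
    intro i _
    by_cases hi : a < p i
    · filter_upwards [nhdsWithin_le_nhds (Iio_mem_nhds hi)] with b hb _ using hb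
    · exact Filter.Eventually.of_forall fun b hb => absurd hb hi
  obtain ⟨b, hb, hab⟩ := (hev.and self_mem_nhdsWithin).exists
  replace hab : a < b := hab
  have hsum : ∑ i ∈ I, |p i - b| ≤
      ∑ i ∈ I, (|p i - a| + ((if p i ≤ a then 2 * (b - a) else 0) - (b - a))) := by
    refine Finset.sum_le_sum fun i hi => ?_
    split_ifs with hpa
    · rw [abs_of_nonpos (by linarith), abs_of_nonpos (by linarith)]
      linarith
    · have hbi := hb i hi (not_le.mp hpa)
      rw [abs_of_pos (by linarith), abs_of_pos (by linarith)]
      linarith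
  rw [Finset.sum_add_distrib, Finset.sum_sub_distrib, ← Finset.sum_filter] at hsum
  simp only [Finset.sum_const, nsmul_eq_mul] at hsum
  have hle := (h b).trans hsum
  have hcard : (I.card : ℝ) ≤ 2 * (I.filter (fun i => p i ≤ a)).card := by
    refine le_of_mul_le_mul_right ?_ (sub_pos.mpr hab)
    linarith
  exact_mod_cast hcard

/-- If `a` minimizes `c ↦ ∑ i ∈ I, |p i - c|`, then at least half of the points are at distance
at least `|c - a|` from any given `c`. -/
lemma card_le_two_mul_card_filter_abs_of_isMin {ι : Type*} (I : Finset ι) (p : ι → ℝ) (a c : ℝ)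
    (h : ∀ c, ∑ i ∈ I, |p i - a| ≤ ∑ i ∈ I, |p i - c|) :
    I.card ≤ 2 * (I.filter (fun i => |c - a| ≤ |p i - c|)).card := by
  rcases le_total a c with hac | hca
  · refine (card_le_two_mul_card_filter_le_of_isMin I p a h).trans ?_
    gcongr 2 * (Finset.card ?_)
    refine Finset.monotone_filter_right I fun i _ hi => ?_
    rw [abs_of_nonneg (by linarith), abs_of_nonpos (by linarith)]
    linarith
  · have hneg : ∀ x, ∑ i ∈ I, |-p i - -a| ≤ ∑ i ∈ I, |-p i - x| := by
      intro x
      convert h (-x) using 2 with i _ i _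
      · rw [← abs_neg]; ring_nf
      · rw [← abs_neg]; ring_nf
    refine (card_le_two_mul_card_filter_le_of_isMin I (fun i => -p i) (-a) hneg).trans ?_
    gcongr 2 * (Finset.card ?_)
    refine Finset.monotone_filter_right I fun i _ hi => ?_
    rw [abs_of_nonpos (by linarith), abs_of_nonneg (by linarith)]
    linarith

lemma rcostIdx_le {n m : ℕ} (p : Fin n → ℝ) (c : ℝ) {L : Finset (Fin n)} (hL : L.card = m) :
    rcostIdx m p c ≤ ∑ i ∈ Lᶜ, |p i - c| := by
  refine csInf_le ⟨0, ?_⟩ ⟨L, hL, rfl⟩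
  rintro y ⟨L', -, rfl⟩
  exact Finset.sum_nonneg fun i _ => abs_nonneg _

lemma exists_rcostIdx_eq {n m : ℕ} (hmn : m ≤ n) (p : Fin n → ℝ) (c : ℝ) :
    ∃ L : Finset (Fin n), L.card = m ∧ rcostIdx m p c = ∑ i ∈ Lᶜ, |p i - c| := by
  have hfin : {y : ℝ | ∃ L : Finset (Fin n), L.card = m ∧ y = ∑ i ∈ Lᶜ, |p i - c|}.Finite :=
    (Set.finite_range fun L : Finset (Fin n) => ∑ i ∈ Lᶜ, |p i - c|).subset
      fun y ⟨L, _, hy⟩ => ⟨L, hy.symm⟩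
  obtain ⟨L, -, hL⟩ := Finset.exists_subset_card_eq (s := (Finset.univ : Finset (Fin n)))
    (n := m) (by simpa using hmn)
  have hne : {y : ℝ | ∃ L : Finset (Fin n), L.card = m ∧ y = ∑ i ∈ Lᶜ, |p i - c|}.Nonempty :=
    ⟨_, L, hL, rfl⟩
  exact hne.csInf_mem hfin

/-- **Growth lower bound around an optimal robust center.**
If `c*` is an optimal center for the robust geometric median of
`p_1, …, p_n` with `m` outliers, then for every center `c`,
`cost^(m)(P, c) ≥ (⌊(n - m)/2⌋ - m) · |c - c*|`. -/
theorem robust_cost_growth_lower_bound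
    (n m : ℕ) (hm : 1 ≤ m) (hmn : m < n) (p : Fin n → ℝ)
    (cstar : ℝ) (hopt : ∀ c : ℝ, rcostIdx m p cstar ≤ rcostIdx m p c)
    (c : ℝ) :
    ((((n - m) / 2 : ℕ) : ℝ) - (m : ℝ)) * |c - cstar| ≤ rcostIdx m p c := by
  obtain ⟨L₀, hL₀, hcost₀⟩ := exists_rcostIdx_eq hmn.le p cstar
  obtain ⟨L, hL, hcost⟩ := exists_rcostIdx_eq hmn.le p c
  have hhalf := card_le_two_mul_card_filter_abs_of_isMin L₀ᶜ p cstar c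
    fun x => hcost₀ ▸ (hopt x).trans (rcostIdx_le p x hL₀)
  set S := L₀ᶜ.filter (fun i => |c - cstar| ≤ |p i - c|) with hS
  rw [Finset.card_compl, Fintype.card_fin, hL₀] at hhalf
  have hsdiff : S.card ≤ (S \ L).card + m := by
    have := Finset.le_card_sdiff L S
    omega
  have hcard : (((n - m) / 2 : ℕ) : ℝ) ≤ (S \ L).card + m := by
    exact_mod_cast (show (n - m) / 2 ≤ (S \ L).card + m by omega)
  rw [hcost]
  calc ((((n - m) / 2 : ℕ) : ℝ) - (m : ℝ)) * |c - cstar|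
      ≤ (S \ L).card * |c - cstar| := by
        gcongr
        linarith
    _ ≤ ∑ i ∈ S \ L, |p i - c| := by
        rw [← nsmul_eq_mul]
        refine Finset.card_nsmul_le_sum _ _ _ fun i hi => ?_
        exact (Finset.mem_filter.mp (Finset.mem_sdiff.mp hi).1).2
    _ ≤ ∑ i ∈ Lᶜ, |p i - c| := by
        refine Finset.sum_le_sum_of_subset_of_nonneg ?_ fun i _ _ => abs_nonneg _
        exact fun i hi => Finset.mem_compl.mpr (Finset.mem_sdiff.mp hi).2
end

section
/- Let p_1 ≤ p_2 ≤ ⋯ ≤ p_n be real numbers and let m ≥ 0 be an integer with n > 2m. Then for every c ∈ ℝ with c ≥ p_{n−m}, cost^(m)(P,c) ≥ (n − 2m)·(c − p_{n−m}); symmetrically, for every c ∈ ℝ with c ≤ p_{m+1}, cost^(m)(P,c) ≥ (n − 2m)·(p_{m+1} − c). -/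
open Finset
open scoped Classical

/-- If at least `n - m` points lie at distance at least `d` from `c`, then the robust cost of `c`
is at least `(n - 2m) d`. -/
lemma mul_le_rcostIdx {n m : ℕ} (hmn : m ≤ n) (p : Fin n → ℝ) (c d : ℝ) (hd : 0 ≤ d)
    (S : Finset (Fin n)) (hS : n ≤ S.card + m) (h : ∀ i ∈ S, d ≤ |p i - c|) :
    ((n : ℝ) - 2 * m) * d ≤ rcostIdx m p c := by
  refine le_csInf ?_ ?_
  · obtain ⟨L, -, hL⟩ := Finset.exists_subset_card_eq
      (s := (Finset.univ : Finset (Fin n))) (n := m) (by simpa using hmn)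
    exact ⟨_, L, hL, rfl⟩
  · rintro _ ⟨L, hL, rfl⟩
    have hcard : n ≤ (S \ L).card + 2 * m := by
      have := Finset.le_card_sdiff L S
      omega
    have hcard' : (n : ℝ) - 2 * m ≤ (S \ L).card := by
      have : (n : ℝ) ≤ (S \ L).card + 2 * m := mod_cast hcard
      linarith
    calc ((n : ℝ) - 2 * m) * d ≤ (S \ L).card * d := by gcongr
      _ = ∑ _i ∈ S \ L, d := by simp
      _ ≤ ∑ i ∈ S \ L, |p i - c| :=
        Finset.sum_le_sum fun i hi => h i (Finset.mem_sdiff.1 hi).1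
      _ ≤ ∑ i ∈ Lᶜ, |p i - c| :=
        Finset.sum_le_sum_of_subset_of_nonneg
          (fun i hi => Finset.mem_compl.2 (Finset.mem_sdiff.1 hi).2)
          fun _ _ _ => abs_nonneg _

/-- **Robust cost lower bound for far centers.**
Let `p_1 ≤ ⋯ ≤ p_n` and `0 ≤ m` with `n > 2m`. For every `c ≥ p_{n-m}` we have
`cost^(m)(P, c) ≥ (n - 2m)·(c - p_{n-m})`, and symmetrically for every
`c ≤ p_{m+1}` we have `cost^(m)(P, c) ≥ (n - 2m)·(p_{m+1} - c)`. -/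
theorem robust_cost_far_center_lower_bound
    (n m : ℕ) (hmn : 2 * m < n) (p : Fin n → ℝ) (hp : Monotone p) (c : ℝ) :
    (p ⟨n - m - 1, by omega⟩ ≤ c →
      ((n : ℝ) - 2 * m) * (c - p ⟨n - m - 1, by omega⟩) ≤ rcostIdx m p c) ∧
    (c ≤ p ⟨m, by omega⟩ →
      ((n : ℝ) - 2 * m) * (p ⟨m, by omega⟩ - c) ≤ rcostIdx m p c) := by
  constructor
  · intro hc
    refine mul_le_rcostIdx (by omega) p c _ (sub_nonneg.2 hc)
      (Finset.Iic ⟨n - m - 1, by omega⟩) (by rw [Fin.card_Iic]; dsimp only; omega)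
      fun i hi => ?_
    have := hp (Finset.mem_Iic.1 hi)
    have := neg_le_abs (p i - c)
    linarith
  · intro hc
    refine mul_le_rcostIdx (by omega) p c _ (sub_nonneg.2 hc)
      (Finset.Ici ⟨m, by omega⟩) (by rw [Fin.card_Ici]; dsimp only; omega)
      fun i hi => ?_
    have := hp (Finset.mem_Ici.1 hi)
    have := le_abs_self (p i - c)
    linarith
end

section
/- Let P be a finite set of n points in Euclidean space ℝ^d, 1 ≤ m < n, and c* ∈ ℝ^d. Let L^* ⊆ P with |L^*| = m attain cost^(m)(P,c*), set P_I^* := P ∖ L^*, and let S_O ⊆ L^* be nonempty with uniform weights w(p) := m/|S_O|. Let ε ∈ (0,1) with ε·m ≥ 1, and suppose that for every c ∈ ℝ^d and every u > 0, | |L^* ∩ Ball(c,u)| − (m/|S_O|)·|S_O ∩ Ball(c,u)| | ≤ ε·m. Then for every center c ∈ ℝ^d such that the distances ‖p − c‖, p ∈ P, are pairwise distinct, |m_P − m_S| ≤ 2·ε·m, where m_P := |L^* ∩ L^{(c)}| for the unique m-subset L^{(c)} of P attaining cost^(m)(P,c), and m_S := Σ_{p∈S_O}(w(p) − w'(p))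 for the unique minimizer w' defining the weighted robust cost cost^(m)(S_O ∪ P_I^*, c). -/
open Finset
open scoped Classical

/-- Robust cost with `m` outliers of a center `c` for a finite set `P ⊂ ℝ^d`. -/
noncomputable def rcostE {d : ℕ} (m : ℕ) (P : Finset (EuclideanSpace ℝ (Fin d)))
    (c : EuclideanSpace ℝ (Fin d)) : ℝ :=
  sInf {y : ℝ | ∃ L : Finset (EuclideanSpace ℝ (Fin d)),
    L ⊆ P ∧ L.card = m ∧ y = ∑ p ∈ P \ L, dist p c}

/-- Weighted robust cost of a weighted finite set `(S, w) ⊂ ℝ^d` at target total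
inlier weight `t`. -/
noncomputable def wrcostE {d : ℕ} (t : ℝ) (S : Finset (EuclideanSpace ℝ (Fin d)))
    (w : EuclideanSpace ℝ (Fin d) → ℝ) (c : EuclideanSpace ℝ (Fin d)) : ℝ :=
  sInf {y : ℝ | ∃ w' : EuclideanSpace ℝ (Fin d) → ℝ,
    (∀ p ∈ S, 0 ≤ w' p ∧ w' p ≤ w p) ∧
    (∑ p ∈ S, w' p) = t ∧ y = ∑ p ∈ S, w' p * dist p c}

/-- An optimal set of outliers lies at least as far from the center as every inlier. -/
theorem dist_le_dist_of_sum_eq_rcostE {d m : ℕ} {P L : Finset (EuclideanSpace ℝ (Fin d))}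
    {c : EuclideanSpace ℝ (Fin d)} (hL : L ⊆ P) (hcard : L.card = m)
    (hopt : ∑ p ∈ P \ L, dist p c = rcostE m P c) {p q : EuclideanSpace ℝ (Fin d)}
    (hp : p ∈ P \ L) (hq : q ∈ L) : dist p c ≤ dist q c := by
  obtain ⟨hpP, hpL⟩ := mem_sdiff.1 hp
  have hpq : p ≠ q := fun h => hpL (h ▸ hq)
  have hswap : P \ insert p (L.erase q) = insert q ((P \ L).erase p) := by
    ext x
    simp only [mem_sdiff, mem_insert, mem_erase]
    by_cases hxq : x = q
    · subst hxq
      simp [hL hq, hpq.symm]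
    · simp only [hxq, false_or]
      tauto
  have hle : rcostE m P c ≤ ∑ x ∈ P \ insert p (L.erase q), dist x c := by
    refine csInf_le ⟨0, ?_⟩ ⟨insert p (L.erase q), ?_, ?_, rfl⟩
    · rintro y ⟨L', -, -, rfl⟩
      exact sum_nonneg fun _ _ => dist_nonneg
    · exact insert_subset hpP ((erase_subset _ _).trans hL)
    · rw [card_insert_of_notMem (fun h => hpL (mem_of_mem_erase h)), card_erase_add_one hq, hcard]
  have hq' : q ∉ (P \ L).erase p := fun h => (mem_sdiff.1 (mem_of_mem_erase h)).2 hq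
  rw [hswap, sum_insert hq', ← hopt, ← add_sum_erase _ _ hp] at hle
  linarith

/-- In an optimal weighting, a point is saturated as soon as a strictly farther point has
positive weight. -/
theorem eq_weight_of_sum_eq_wrcostE {d : ℕ} {t : ℝ} {S : Finset (EuclideanSpace ℝ (Fin d))}
    {w w' : EuclideanSpace ℝ (Fin d) → ℝ} {c : EuclideanSpace ℝ (Fin d)}
    (hw : ∀ p ∈ S, 0 ≤ w' p ∧ w' p ≤ w p) (hsum : ∑ p ∈ S, w' p = t)
    (hopt : ∑ p ∈ S, w' p * dist p c = wrcostE t S w c)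
    {p q : EuclideanSpace ℝ (Fin d)} (hp : p ∈ S) (hq : q ∈ S)
    (hpq : dist p c < dist q c) (hpos : 0 < w' q) : w' p = w p := by
  by_contra hne
  have hlt : w' p < w p := lt_of_le_of_ne (hw p hp).2 hne
  have hne' : p ≠ q := by
    rintro rfl
    exact lt_irrefl _ hpq
  obtain ⟨δ, hδ, hδlt⟩ := exists_between (lt_min hpos (sub_pos.2 hlt))
  obtain ⟨hδq, hδp⟩ := lt_min_iff.1 hδlt
  let v : EuclideanSpace ℝ (Fin d) → ℝ := fun x =>
    w' x + ((if x = p then δ else 0) - (if x = q then δ else 0))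
  have hle : wrcostE t S w c ≤ ∑ x ∈ S, v x * dist x c := by
    refine csInf_le ⟨0, ?_⟩ ⟨v, fun x hx => ?_, ?_, rfl⟩
    · rintro y ⟨u, hu, -, rfl⟩
      exact sum_nonneg fun x hx => mul_nonneg (hu x hx).1 dist_nonneg
    · obtain ⟨h0, h1⟩ := hw x hx
      by_cases hxp : x = p
      · subst hxp
        simp only [v, if_true, if_neg hne']
        constructor <;> linarith
      · by_cases hxq : x = q
        · subst hxq
          simp only [v, if_true, if_neg hxp]
          constructor <;> linarith
        · simp only [v, if_neg hxp, if_neg hxq]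
          constructor <;> linarith
    · simp [v, sum_add_distrib, sum_sub_distrib, hp, hq, hsum]
  have hcost : ∑ x ∈ S, v x * dist x c
      = ∑ x ∈ S, w' x * dist x c + (δ * dist p c - δ * dist q c) := by
    simp [v, add_mul, sub_mul, sum_add_distrib, sum_sub_distrib, hp, hq, ite_mul]
  rw [hcost, ← hopt] at hle
  nlinarith

/-- Two finite nonempty families of nonnegative reals, one strictly below the other, are
separated by a positive real. -/
theorem exists_pos_separating {α : Type*} {A B : Finset α} (hA : A.Nonempty) (hB : B.Nonempty)
    {f : α → ℝ} (hf : ∀ x, 0 ≤ f x) (h : ∀ a ∈ A, ∀ b ∈ B, f a < f b) :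
    ∃ u, 0 < u ∧ (∀ a ∈ A, f a ≤ u) ∧ ∀ b ∈ B, u < f b := by
  obtain ⟨a, ha, hmax⟩ := A.exists_max_image f hA
  obtain ⟨b, hb, hmin⟩ := B.exists_min_image f hB
  obtain ⟨u, hau, hub⟩ := exists_between (h a ha b hb)
  exact ⟨u, (hf a).trans_lt hau, fun x hx => (hmax x hx).trans hau.le,
    fun x hx => hub.trans_le (hmin x hx)⟩

/-- **Bounding the misaligned outlier count (Lemma `refined outlier gap`).**
If `S_O ⊆ L*` is a nonempty uniform subsample with weights `m/|S_O|` such that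
for every center `c` and radius `u > 0`,
`| |L* ∩ Ball(c,u)| - (m/|S_O|)·|S_O ∩ Ball(c,u)| | ≤ ε·m` (with `ε·m ≥ 1`),
then for every center `c` with pairwise distinct distances to the points of
`P`, the number `m_P = |L* ∩ L^{(c)}|` of shared outliers and the outlier mass
`m_S = Σ_{p∈S_O}(w(p) - w'(p))` of the optimal weighting `w'` satisfy
`|m_P - m_S| ≤ 2·ε·m`. -/
theorem misaligned_outlier_count
    (d n m : ℕ) (hm : 1 ≤ m) (hmn : m < n)
    (P : Finset (EuclideanSpace ℝ (Fin d))) (hP : P.card = n)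
    (cstar : EuclideanSpace ℝ (Fin d))
    (Lstar : Finset (EuclideanSpace ℝ (Fin d)))
    (hLsub : Lstar ⊆ P) (hLcard : Lstar.card = m)
    (hLattain : (∑ p ∈ P \ Lstar, dist p cstar) = rcostE m P cstar)
    (SO : Finset (EuclideanSpace ℝ (Fin d)))
    (hSOsub : SO ⊆ Lstar) (hSOne : SO.Nonempty)
    (ε : ℝ) (hε0 : 0 < ε) (hε1 : ε < 1) (hεm : 1 ≤ ε * m)
    (hball : ∀ (c : EuclideanSpace ℝ (Fin d)) (u : ℝ), 0 < u →
      |(((Lstar.filter (fun p => dist p c ≤ u)).card : ℝ)) -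
        ((m : ℝ) / SO.card) * ((SO.filter (fun p => dist p c ≤ u)).card : ℝ)| ≤ ε * m) :
    ∀ c : EuclideanSpace ℝ (Fin d),
      (∀ p ∈ P, ∀ q ∈ P, p ≠ q → dist p c ≠ dist q c) →
      ∀ Lc : Finset (EuclideanSpace ℝ (Fin d)),
        Lc ⊆ P → Lc.card = m →
        (∑ p ∈ P \ Lc, dist p c) = rcostE m P c →
        ∀ w' : EuclideanSpace ℝ (Fin d) → ℝ,
          (∀ p ∈ SO ∪ (P \ Lstar),
            0 ≤ w' p ∧ w' p ≤ (if p ∈ SO then (m : ℝ) / SO.card else 1)) →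
          (∑ p ∈ SO ∪ (P \ Lstar), w' p) = (n : ℝ) - m →
          (∑ p ∈ SO ∪ (P \ Lstar), w' p * dist p c) =
            wrcostE ((n : ℝ) - m) (SO ∪ (P \ Lstar))
              (fun p => if p ∈ SO then (m : ℝ) / SO.card else 1) c →
          |(((Lstar ∩ Lc).card : ℝ)) -
              (∑ p ∈ SO, ((m : ℝ) / SO.card - w' p))| ≤ 2 * ε * m := by
  intro c hdist Lc hLc hLccard hLcopt w' hw hwsum hwopt
  have hLc_ne : Lc.Nonempty := card_pos.1 (by omega)
  have hIc_ne : (P \ Lc).Nonempty := card_pos.1 (by rw [card_sdiff_of_subset hLc]; omega)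
  obtain ⟨u, hu, hin, hout⟩ := exists_pos_separating hIc_ne hLc_ne
    (f := fun p => dist p c) (fun _ => dist_nonneg) fun p hp q hq =>
      lt_of_le_of_ne (dist_le_dist_of_sum_eq_rcostE hLc hLccard hLcopt hp hq)
        (hdist p (mem_sdiff.1 hp).1 q (hLc hq) fun h => (mem_sdiff.1 hp).2 (h ▸ hq))
  have hmem : ∀ p ∈ P, (dist p c ≤ u ↔ p ∉ Lc) := fun p hp =>
    ⟨fun h hpL => (hout p hpL).not_ge h, fun h => hin p (mem_sdiff.2 ⟨hp, h⟩)⟩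
  have hdisj : Disjoint SO (P \ Lstar) :=
    disjoint_left.2 fun p hp hp' => (mem_sdiff.1 hp').2 (hSOsub hp)
  have hb := abs_le.1 (hball c u hu)
  set a : ℕ := (Lstar.filter (fun p => dist p c ≤ u)).card with ha
  set b : ℕ := (SO.filter (fun p => dist p c ≤ u)).card
  set i : ℕ := ((P \ Lstar).filter (fun p => dist p c ≤ u)).card with hi
  set k : ℝ := (m : ℝ) / SO.card with hk
  have hk0 : 0 ≤ k := by positivity
  have haL : (a : ℝ) + (Lstar ∩ Lc).card = m := by
    have h : Lstar.filter (fun p => dist p c ≤ u) = Lstar \ Lc := by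
      ext p
      simp only [mem_filter, mem_sdiff]
      exact and_congr_right fun hp => hmem p (hLsub hp)
    rw [ha, h]
    exact_mod_cast (card_sdiff_add_card_inter Lstar Lc).trans hLcard
  have hai : (a : ℝ) + i = n - m := by
    have h : Lstar.filter (fun p => dist p c ≤ u) ∪ (P \ Lstar).filter (fun p => dist p c ≤ u)
        = P \ Lc := by
      rw [← filter_union, union_sdiff_of_subset hLsub]
      ext p
      simp only [mem_filter, mem_sdiff]
      exact and_congr_right fun hp => hmem p hp
    have hcard := congrArg Finset.card h
    rw [card_union_of_disjoint (disjoint_filter_filter disjoint_sdiff),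
      card_sdiff_of_subset hLc, hP, hLccard] at hcard
    rw [← Nat.cast_sub hmn.le]
    exact_mod_cast hcard
  have hmS : ∑ p ∈ SO, (k - w' p) = m - ∑ p ∈ SO, w' p := by
    have : (SO.card : ℝ) ≠ 0 := by exact_mod_cast hSOne.card_pos.ne'
    rw [sum_sub_distrib, sum_const, nsmul_eq_mul, hk, mul_div_cancel₀ _ this]
  have hXY := hwsum
  rw [sum_union hdisj] at hXY
  have hwSO : ∀ p ∈ SO, 0 ≤ w' p ∧ w' p ≤ k := fun p hp => by
    simpa [hp] using hw p (mem_union_left _ hp)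
  have hwI : ∀ p ∈ P \ Lstar, 0 ≤ w' p ∧ w' p ≤ 1 := fun p hp => by
    simpa [disjoint_right.1 hdisj hp] using hw p (mem_union_right _ hp)
  have hbsum : ∑ p ∈ SO, (if dist p c ≤ u then k else 0) = k * b := by
    rw [← sum_filter, sum_const, nsmul_eq_mul, mul_comm]
  have hisum : ∑ p ∈ P \ Lstar, (if dist p c ≤ u then (1 : ℝ) else 0) = i := by
    rw [← sum_filter, sum_const, nsmul_eq_mul, mul_one]
  rw [hmS, abs_le]
  by_cases hfar : ∃ q ∈ SO ∪ (P \ Lstar), u < dist q c ∧ 0 < w' q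
  · obtain ⟨q, hq, huq, hqpos⟩ := hfar
    have hfull : ∀ p ∈ SO ∪ (P \ Lstar), dist p c ≤ u → w' p = if p ∈ SO then k else 1 :=
      fun p hp hpu => eq_weight_of_sum_eq_wrcostE hw hwsum hwopt hp hq (hpu.trans_lt huq) hqpos
    have hX : k * b ≤ ∑ p ∈ SO, w' p := by
      rw [← hbsum]
      refine sum_le_sum fun p hp => ?_
      split_ifs with h
      · simp [hfull p (mem_union_left _ hp) h, hp]
      · exact (hwSO p hp).1
    have hY : (i : ℝ) ≤ ∑ p ∈ P \ Lstar, w' p := by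
      rw [← hisum]
      refine sum_le_sum fun p hp => ?_
      split_ifs with h
      · simp [hfull p (mem_union_right _ hp) h, disjoint_right.1 hdisj hp]
      · exact (hwI p hp).1
    constructor <;> linarith [hb.1, hb.2]
  · push Not at hfar
    have hX : ∑ p ∈ SO, w' p ≤ k * b := by
      rw [← hbsum]
      refine sum_le_sum fun p hp => ?_
      split_ifs with h
      · exact (hwSO p hp).2
      · exact hfar p (mem_union_left _ hp) (not_le.1 h)
    have hY : ∑ p ∈ P \ Lstar, w' p ≤ i := by
      rw [← hisum]
      refine sum_le_sum fun p hp => ?_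
      split_ifs with h
      · exact (hwI p hp).2
      · exact hfar p (mem_union_right _ hp) (not_le.1 h)
    constructor <;> linarith [hb.1, hb.2]
end
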